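/- There exists an absolute constant c > 0 such that for every ε ∈ (0, 1/2) and every normed space X = (ℝⁿ, ‖·‖) with n ≥ 2 there exists a linear subspace E ⊆ ℝⁿ with dim E = k ≥ c·ε·log n / log(1/ε) which is (1+ε)-Euclidean: there exists a > 0 such that (1 − ε)·a·‖x‖₂ ≤ ‖x‖ ≤ (1 + ε)·a·‖x‖₂ for all x ∈ E. -/

import Mathlib

open Real

/-- The Euclidean norm on `ℝⁿ`. -/
noncomputable def euclNorm {n : ℕ} (x : Fin n → ℝ) : ℝ :=
  Real.sqrt (∑ i, (x i) ^ 2)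

namespace Dvoretzky

open MeasureTheory ProbabilityTheory

set_option linter.unusedSectionVars false

section

/-- The standard Gaussian measure on `ℝᵐ`. -/
noncomputable abbrev gauss (m : ℕ) : Measure (Fin m → ℝ) := Measure.pi fun _ => gaussianReal 0 1

lemma charFunDual_gaussian_line (L : StrongDual ℝ ℝ) :
    charFunDual (gaussianReal 0 1) L = Complex.exp (-((L 1 : ℝ) : ℂ) ^ 2 / 2) := by
  rw [charFunDual_eq_charFun_map_one, gaussianReal_map_continuousLinearMap, charFun_gaussianReal]
  congr 1
  simp [max_eq_left (sq_nonneg (L 1)), neg_div]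

lemma rotation_line {c s : ℝ} (h : c ^ 2 + s ^ 2 = 1) :
    MeasurePreserving (fun p : ℝ × ℝ => (c * p.1 + s * p.2, s * p.1 - c * p.2))
      ((gaussianReal 0 1).prod (gaussianReal 0 1)) ((gaussianReal 0 1).prod (gaussianReal 0 1)) := by
  refine ⟨by fun_prop, ?_⟩
  let T : ℝ × ℝ →L[ℝ] ℝ × ℝ :=
    ContinuousLinearMap.prod
      (c • ContinuousLinearMap.fst ℝ ℝ ℝ + s • ContinuousLinearMap.snd ℝ ℝ ℝ)
      (s • ContinuousLinearMap.fst ℝ ℝ ℝ - c • ContinuousLinearMap.snd ℝ ℝ ℝ)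
  have hT : (fun p : ℝ × ℝ => (c * p.1 + s * p.2, s * p.1 - c * p.2)) = T := by
    ext p <;> simp [T]
  rw [hT]
  apply Measure.ext_of_charFunDual
  ext L
  rw [charFunDual_map, charFunDual_prod, charFunDual_prod, charFunDual_gaussian_line,
    charFunDual_gaussian_line, charFunDual_gaussian_line, charFunDual_gaussian_line,
    ← Complex.exp_add, ← Complex.exp_add]
  have e1 : (L.comp T) (1, 0) = c * L (1, 0) + s * L (0, 1) := by
    have : T (1, 0) = c • ((1:ℝ), (0:ℝ)) + s • ((0:ℝ), (1:ℝ)) := by ext <;> simp [T]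
    simp only [ContinuousLinearMap.comp_apply, this, map_add, map_smul, smul_eq_mul]
  have e2 : (L.comp T) (0, 1) = s * L (1, 0) - c * L (0, 1) := by
    have : T (0, 1) = s • ((1:ℝ), (0:ℝ)) - c • ((0:ℝ), (1:ℝ)) := by ext <;> simp [T]
    simp only [ContinuousLinearMap.comp_apply, this, map_sub, map_smul, smul_eq_mul]
  have f1 : ∀ M : StrongDual ℝ (ℝ × ℝ), (M.comp (.inl ℝ ℝ ℝ)) 1 = M (1, 0) := fun M => by simp
  have f2 : ∀ M : StrongDual ℝ (ℝ × ℝ), (M.comp (.inr ℝ ℝ ℝ)) 1 = M (0, 1) := fun M => by simp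
  rw [f1, f2, f1, f2, e1, e2]
  congr 1
  push_cast
  have hc : (c : ℂ) ^ 2 + (s : ℂ) ^ 2 = 1 := by exact_mod_cast h
  linear_combination (-((L (1, 0) : ℝ) : ℂ) ^ 2 / 2 - ((L (0, 1) : ℝ) : ℂ) ^ 2 / 2) * hc

variable {m : ℕ}

lemma rotation {c s : ℝ} (h : c ^ 2 + s ^ 2 = 1) :
    MeasurePreserving (fun p : (Fin m → ℝ) × (Fin m → ℝ) => (c • p.1 + s • p.2, s • p.1 - c • p.2))
      ((gauss m).prod (gauss m)) ((gauss m).prod (gauss m)) := by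
  have h1 := measurePreserving_arrowProdEquivProdArrow ℝ ℝ (Fin m)
    (fun _ => gaussianReal 0 1) (fun _ => gaussianReal 0 1)
  have h2 := measurePreserving_pi (fun _ : Fin m => (gaussianReal 0 1).prod (gaussianReal 0 1))
    (fun _ : Fin m => (gaussianReal 0 1).prod (gaussianReal 0 1)) (fun _ => rotation_line h)
  have h3 := (h1.comp h2).comp h1.symm
  exact h3

lemma rotation_fst {c s : ℝ} (h : c ^ 2 + s ^ 2 = 1) :
    MeasurePreserving (fun p : (Fin m → ℝ) × (Fin m → ℝ) => c • p.1 + s • p.2)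
      ((gauss m).prod (gauss m)) (gauss m) :=
  measurePreserving_fst.comp (rotation h)


/-- Bounded measurable real functions. -/
def BddMeas {α : Type*} [MeasurableSpace α] (u : α → ℝ) : Prop :=
  Measurable u ∧ ∃ C : ℝ, ∀ x, |u x| ≤ C

namespace BddMeas

variable {α β : Type*} [MeasurableSpace α] [MeasurableSpace β] {u v : α → ℝ}

lemma measurable (hu : BddMeas u) : Measurable u := hu.1

lemma integrable (hu : BddMeas u) (μ : Measure α) [IsFiniteMeasure μ] : Integrable u μ := by
  obtain ⟨hm, C, hC⟩ := hu
  exact Integrable.of_bound hm.aestronglyMeasurable C (.of_forall hC)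

lemma const (c : ℝ) : BddMeas (fun _ : α => c) := ⟨measurable_const, |c|, fun _ => le_rfl⟩

lemma comp (hu : BddMeas u) {g : β → α} (hg : Measurable g) : BddMeas (fun x => u (g x)) :=
  ⟨hu.1.comp hg, hu.2.choose, fun x => hu.2.choose_spec (g x)⟩

lemma add (hu : BddMeas u) (hv : BddMeas v) : BddMeas (fun x => u x + v x) := by
  obtain ⟨hm, C, hC⟩ := hu
  obtain ⟨hm', C', hC'⟩ := hv
  exact ⟨hm.add hm', C + C', fun x => (abs_add_le _ _).trans (add_le_add (hC x) (hC' x))⟩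

lemma neg (hu : BddMeas u) : BddMeas (fun x => - u x) :=
  ⟨hu.1.neg, hu.2.choose, fun x => by rw [abs_neg]; exact hu.2.choose_spec x⟩

lemma sub (hu : BddMeas u) (hv : BddMeas v) : BddMeas (fun x => u x - v x) := by
  simpa only [sub_eq_add_neg] using hu.add hv.neg

lemma mul (hu : BddMeas u) (hv : BddMeas v) : BddMeas (fun x => u x * v x) := by
  obtain ⟨hm, C, hC⟩ := hu
  obtain ⟨hm', C', hC'⟩ := hv
  refine ⟨hm.mul hm', C * C', fun x => ?_⟩
  rw [abs_mul]
  exact mul_le_mul (hC x) (hC' x) (abs_nonneg _) ((abs_nonneg _).trans (hC x))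

lemma pow (hu : BddMeas u) (n : ℕ) : BddMeas (fun x => u x ^ n) := by
  induction n with
  | zero => simpa using const 1
  | succ n ih => simpa only [pow_succ] using ih.mul hu

lemma abs (hu : BddMeas u) : BddMeas (fun x => |u x|) :=
  ⟨hu.1.abs, hu.2.choose, fun x => by rw [abs_abs]; exact hu.2.choose_spec x⟩

lemma rpow (hu : BddMeas u) (h0 : ∀ x, 0 ≤ u x) {p : ℝ} (hp : 0 ≤ p) :
    BddMeas (fun x => u x ^ p) := by
  obtain ⟨hm, C, hC⟩ := hu
  refine ⟨hm.pow_const p, C ^ p, fun x => ?_⟩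
  rw [abs_of_nonneg (Real.rpow_nonneg (h0 x) _)]
  exact Real.rpow_le_rpow (h0 x) ((le_abs_self _).trans (hC x)) hp

lemma integral_right {w : α → β → ℝ} (hw : BddMeas (Function.uncurry w)) (μ : Measure β)
    [IsProbabilityMeasure μ] : BddMeas (fun x => ∫ y, w x y ∂μ) := by
  obtain ⟨hm, C, hC⟩ := hw
  refine ⟨(hm.stronglyMeasurable.integral_prod_right).measurable, C, fun x => ?_⟩
  have := norm_integral_le_of_norm_le_const (μ := μ) (f := w x) (C := C)
    (.of_forall fun y => hC (x, y))
  simpa using this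

lemma exp (hu : BddMeas u) : BddMeas (fun x => rexp (u x)) := by
  obtain ⟨hm, C, hC⟩ := hu
  refine ⟨hm.exp, rexp C, fun x => ?_⟩
  rw [abs_of_pos (exp_pos _)]
  exact exp_le_exp.2 ((le_abs_self _).trans (hC x))

end BddMeas

lemma sq_integral_mul_le_of_integrable {α : Type*} [MeasurableSpace α] {μ : Measure α}
    {u v : α → ℝ} (hu : Integrable (fun x => u x ^ 2) μ) (hv : Integrable (fun x => v x ^ 2) μ)
    (huv : Integrable (fun x => u x * v x) μ) :
    (∫ x, u x * v x ∂μ) ^ 2 ≤ (∫ x, u x ^ 2 ∂μ) * ∫ x, v x ^ 2 ∂μ := by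
  have key : ∀ t : ℝ, 0 ≤ (∫ x, u x ^ 2 ∂μ) * (t * t) + (-2 * ∫ x, u x * v x ∂μ) * t
      + ∫ x, v x ^ 2 ∂μ := by
    intro t
    have e : (∫ x, (t * u x - v x) ^ 2 ∂μ) = (∫ x, u x ^ 2 ∂μ) * (t * t)
        + (-2 * ∫ x, u x * v x ∂μ) * t + ∫ x, v x ^ 2 ∂μ := by
      have : ∀ x, (t * u x - v x) ^ 2 = t * t * u x ^ 2 + (-2 * t) * (u x * v x) + v x ^ 2 :=
        fun x => by ring
      simp_rw [this]
      rw [integral_add, integral_add, integral_const_mul, integral_const_mul]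
      · ring
      · exact hu.const_mul _
      · exact huv.const_mul _
      · exact (hu.const_mul _).add (huv.const_mul _)
      · exact hv
    rw [← e]
    exact integral_nonneg fun x => sq_nonneg _
  have := discrim_le_zero key
  rw [discrim] at this
  nlinarith

lemma sq_integral_mul_le {α : Type*} [MeasurableSpace α] {μ : Measure α} [IsFiniteMeasure μ]
    {u v : α → ℝ} (hu : BddMeas u) (hv : BddMeas v) :
    (∫ x, u x * v x ∂μ) ^ 2 ≤ (∫ x, u x ^ 2 ∂μ) * ∫ x, v x ^ 2 ∂μ :=
  sq_integral_mul_le_of_integrable ((hu.pow 2).integrable μ) ((hv.pow 2).integrable μ)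
    ((hu.mul hv).integrable μ)

section Semigroup

variable {V : Type*} [NormedAddCommGroup V] [NormedSpace ℝ V] [MeasurableSpace V] [BorelSpace V]
  [SecondCountableTopology V]

/-- Invariance of `μ ⊗ μ` under the reflections `(x, y) ↦ (c x + s y, s x - c y)`. -/
def RotInv (μ : Measure V) : Prop :=
  ∀ c s : ℝ, c ^ 2 + s ^ 2 = 1 →
    MeasurePreserving (fun p : V × V => (c • p.1 + s • p.2, s • p.1 - c • p.2))
      (μ.prod μ) (μ.prod μ)

lemma rotInv_gauss : RotInv (gauss m) := fun _ _ h => rotation h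

lemma rotInv_line : RotInv (gaussianReal 0 1) := fun _ _ h => rotation_line h

/-- The Ornstein–Uhlenbeck operators. -/
noncomputable def ou (μ : Measure V) (r : ℝ) (u : V → ℝ) (x : V) : ℝ :=
  ∫ y, u (r • x + √(1 - r ^ 2) • y) ∂μ

variable {μ : Measure V} [IsProbabilityMeasure μ] {u v : V → ℝ} {r s : ℝ}

lemma RotInv.integral_comp (hμ : RotInv μ) {c s : ℝ} (h : c ^ 2 + s ^ 2 = 1) {w : V × V → ℝ}
    (hw : Measurable w) :
    ∫ p, w (c • p.1 + s • p.2, s • p.1 - c • p.2) ∂(μ.prod μ) = ∫ p, w p ∂(μ.prod μ) := by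
  have := hμ c s h
  rw [← this.map_eq, integral_map this.measurable.aemeasurable hw.aestronglyMeasurable, this.map_eq]

lemma BddMeas.ou (hu : BddMeas u) (μ : Measure V) [IsProbabilityMeasure μ] (r : ℝ) :
    BddMeas (ou μ r u) :=
  BddMeas.integral_right (w := fun x y => u (r • x + √(1 - r ^ 2) • y))
    (hu.comp (by fun_prop)) μ

lemma ou_symm (hμ : RotInv μ) (hu : BddMeas u) (hv : BddMeas v) (h : r ^ 2 ≤ 1) :
    ∫ x, ou μ r u x * v x ∂μ = ∫ x, u x * ou μ r v x ∂μ := by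
  have hs : r ^ 2 + √(1 - r ^ 2) ^ 2 = 1 := by rw [Real.sq_sqrt (by linarith)]; ring
  set s := √(1 - r ^ 2)
  have hb1 : BddMeas (fun p : V × V => u (r • p.1 + s • p.2) * v p.1) :=
    (hu.comp (by fun_prop)).mul (hv.comp (by fun_prop))
  have hb2 : BddMeas (fun p : V × V => u p.1 * v (r • p.1 + s • p.2)) :=
    (hu.comp (by fun_prop)).mul (hv.comp (by fun_prop))
  have e1 : ∫ x, ou μ r u x * v x ∂μ = ∫ p, u (r • p.1 + s • p.2) * v p.1 ∂(μ.prod μ) := by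
    rw [integral_prod _ (hb1.integrable _)]
    simp only [ou, integral_mul_const, s]
  have e2 : ∫ x, u x * ou μ r v x ∂μ = ∫ p, u p.1 * v (r • p.1 + s • p.2) ∂(μ.prod μ) := by
    rw [integral_prod _ (hb2.integrable _)]
    simp only [ou, integral_const_mul, s]
  rw [e1, e2, ← hμ.integral_comp hs hb2.measurable]
  congr 1
  ext p
  congr 2
  have : r • (r • p.1 + s • p.2) + s • (s • p.1 - r • p.2) = (r ^ 2 + s ^ 2) • p.1 := by module
  rw [this, hs, one_smul]

lemma ou_ou (hμ : RotInv μ) (hv : BddMeas v) (hr : r ^ 2 ≤ 1) (hs : s ^ 2 ≤ 1) (x : V) :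
    ou μ r (ou μ s v) x = ou μ (r * s) v x := by
  have hr' : √(1 - r ^ 2) ^ 2 = 1 - r ^ 2 := Real.sq_sqrt (by linarith)
  have hs' : √(1 - s ^ 2) ^ 2 = 1 - s ^ 2 := Real.sq_sqrt (by linarith)
  have hrs : (r * s) ^ 2 ≤ 1 := by nlinarith [mul_le_mul hr hs (sq_nonneg _) zero_le_one]
  have ht' : √(1 - (r * s) ^ 2) ^ 2 = 1 - (r * s) ^ 2 := Real.sq_sqrt (by linarith)
  simp only [ou]
  set r' := √(1 - r ^ 2)
  set s' := √(1 - s ^ 2)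
  set t := √(1 - (r * s) ^ 2)
  by_cases ht : t = 0
  · rw [ht] at ht'
    have h1 : s' = 0 := by nlinarith [sq_nonneg (r * s), sq_nonneg r, sq_nonneg s]
    have h2 : s * r' = 0 := by
      have : (s * r') ^ 2 = 0 := by rw [mul_pow, hr']; nlinarith
      exact pow_eq_zero_iff two_ne_zero |>.1 this
    have : ∀ y z, s • (r • x + r' • y) + s' • z = (r * s) • x := fun y z => by
      rw [h1, smul_add, smul_smul, smul_smul, h2]; simp [mul_comm]
    simp only [this, ht, zero_smul, add_zero]
    simp
  · have hc : (s * r' / t) ^ 2 + (s' / t) ^ 2 = 1 := by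
      field_simp
      rw [hr', hs', ht']; ring
    have hb : BddMeas (fun p : V × V => v (s • (r • x + r' • p.1) + s' • p.2)) :=
      hv.comp (by fun_prop)
    have hb2 : BddMeas (fun p : V × V => v ((r * s) • x + t • p.1)) :=
      hv.comp (by fun_prop)
    rw [← integral_prod (fun p : V × V => v (s • (r • x + r' • p.1) + s' • p.2)) (hb.integrable _)]
    have e2 : ∫ y, v ((r * s) • x + t • y) ∂μ
        = ∫ p : V × V, v ((r * s) • x + t • p.1) ∂(μ.prod μ) := by
      rw [integral_prod _ (hb2.integrable _)]
      simp
    rw [e2, ← hμ.integral_comp hc hb2.measurable]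
    congr 1
    ext p
    congr 1
    have e3 : t * (s * r' / t) = s * r' := by field_simp
    have e4 : t * (s' / t) = s' := by field_simp
    rw [smul_add t, smul_smul t, smul_smul t, e3, e4]
    module

lemma integral_ou (hμ : RotInv μ) (hu : BddMeas u) (h : r ^ 2 ≤ 1) :
    ∫ x, ou μ r u x ∂μ = ∫ x, u x ∂μ := by
  have := ou_symm hμ hu (BddMeas.const 1) h
  simpa [ou] using this

end Semigroup

end

/-- The density of the law of `r x + √(1 - r²) Y` with respect to the standard Gaussian. -/
noncomputable def mehler (r x y : ℝ) : ℝ :=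
  (√(1 - r ^ 2))⁻¹ * rexp (-(y - r * x) ^ 2 / (2 * (1 - r ^ 2)) + y ^ 2 / 2)

lemma mehler_nonneg (r x y : ℝ) : 0 ≤ mehler r x y := by unfold mehler; positivity

lemma measurable_mehler (r x : ℝ) : Measurable (mehler r x) := by unfold mehler; fun_prop

lemma integral_gauss_line (w : ℝ → ℝ) :
    ∫ y, w y ∂gaussianReal 0 1 = ∫ y, gaussianPDFReal 0 1 y * w y := by
  rw [integral_gaussianReal_eq_integral_smul one_ne_zero]
  rfl

lemma ou_eq_mehler {r : ℝ} (hr : r ^ 2 < 1) (v : ℝ → ℝ) (hv : Measurable v) (x : ℝ) :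
    ou (gaussianReal 0 1) r v x = ∫ y, mehler r x y * v y ∂gaussianReal 0 1 := by
  have h0 : 0 < 1 - r ^ 2 := by linarith
  set s := √(1 - r ^ 2) with hs
  have hs0 : 0 < s := Real.sqrt_pos.2 h0
  have hss : s ^ 2 = 1 - r ^ 2 := Real.sq_sqrt h0.le
  have h1 : (gaussianReal 0 1).map (fun y => r * x + s * y)
      = gaussianReal (r * x) (s ^ 2).toNNReal := by
    have : (fun y => r * x + s * y) = (fun y => r * x + y) ∘ (fun y => s * y) := rfl
    rw [this, ← Measure.map_map (by fun_prop) (by fun_prop), gaussianReal_map_const_mul,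
      gaussianReal_map_const_add]
    congr 1
    · simp
    · ext
      rw [mul_one, Real.coe_toNNReal _ (sq_nonneg s)]
      rfl
  have hne : (s ^ 2).toNNReal ≠ 0 := by
    simpa using hs0.ne'
  have h2 : ou (gaussianReal 0 1) r v x = ∫ z, v z ∂gaussianReal (r * x) (s ^ 2).toNNReal := by
    rw [← h1, integral_map (by fun_prop) hv.aestronglyMeasurable]
    simp [ou, hs]
  rw [h2, integral_gaussianReal_eq_integral_smul hne, integral_gauss_line]
  congr 1
  ext y
  simp only [smul_eq_mul]
  rw [← mul_assoc]
  congr 1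
  simp only [gaussianPDFReal, mehler, Real.coe_toNNReal _ (sq_nonneg s), NNReal.coe_one, ← hss,
    Real.sqrt_sq hs0.le, sub_zero]
  have : √(2 * π * s ^ 2) = √(2 * π * 1) * s := by
    rw [Real.sqrt_mul' _ (sq_nonneg s), Real.sqrt_sq hs0.le, mul_one]
  have key : rexp (-(y - r * x) ^ 2 / (2 * s ^ 2))
      = rexp (-y ^ 2 / (2 * 1)) * rexp (-(y - r * x) ^ 2 / (2 * s ^ 2) + y ^ 2 / 2) := by
    rw [← exp_add]
    congr 1
    ring
  rw [this, mul_inv, key]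
  ring

lemma integral_exp_sq_mul {t : ℝ} (ht : t < 1 / 2) :
    Integrable (fun x => rexp (t * x ^ 2)) (gaussianReal 0 1) ∧
    ∫ x, rexp (t * x ^ 2) ∂gaussianReal 0 1 = (√(1 - 2 * t))⁻¹ := by
  have h0 : 0 < 1 - 2 * t := by linarith
  have e : ∀ x, gaussianPDFReal 0 1 x * rexp (t * x ^ 2)
      = (√(1 - 2 * t))⁻¹ * gaussianPDFReal 0 ((1 - 2 * t)⁻¹).toNNReal x := by
    intro x
    simp only [gaussianPDFReal, Real.coe_toNNReal _ (inv_pos.2 h0).le, NNReal.coe_one, mul_one, sub_zero]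
    rw [Real.sqrt_mul (show 0 ≤ 2 * π by positivity) (1 - 2 * t)⁻¹, Real.sqrt_inv, mul_inv, inv_inv,
      mul_assoc, ← exp_add]
    have : √(1 - 2 * t) ≠ 0 := (Real.sqrt_pos.2 h0).ne'
    field_simp
    congr 1
    field_simp
    ring
  have hne : ((1 - 2 * t)⁻¹).toNNReal ≠ 0 := by
    simpa using h0
  constructor
  · rw [gaussianReal_of_var_ne_zero _ one_ne_zero,
      integrable_withDensity_iff_integrable_smul₀' (measurable_gaussianPDF 0 1).aemeasurable
        (.of_forall fun _ => gaussianPDF_lt_top)]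
    simp only [toReal_gaussianPDF, smul_eq_mul, e]
    exact (integrable_gaussianPDFReal _ _).const_mul _
  · rw [integral_gauss_line]
    simp only [e]
    rw [integral_const_mul, integral_gaussianPDFReal_eq_one _ hne, mul_one]

lemma integral_mehler_sq {r : ℝ} (hr : r ^ 2 < 1) (x : ℝ) :
    Integrable (fun y => mehler r x y ^ 2) (gaussianReal 0 1) ∧
    ∫ y, mehler r x y ^ 2 ∂gaussianReal 0 1
      = (√(1 - r ^ 4))⁻¹ * rexp (r ^ 2 / (1 + r ^ 2) * x ^ 2) := by
  have h0 : 0 < 1 - r ^ 2 := by linarith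
  have h4 : 1 - r ^ 4 = (1 - r ^ 2) * (1 + r ^ 2) := by ring
  have hv0 : 0 < (1 - r ^ 2) / (1 + r ^ 2) := by positivity
  have e : ∀ y, gaussianPDFReal 0 1 y * mehler r x y ^ 2
      = ((√(1 - r ^ 4))⁻¹ * rexp (r ^ 2 / (1 + r ^ 2) * x ^ 2)) *
        gaussianPDFReal (2 * r * x / (1 + r ^ 2)) ((1 - r ^ 2) / (1 + r ^ 2)).toNNReal y := by
    intro y
    simp only [gaussianPDFReal, mehler, Real.coe_toNNReal _ hv0.le, NNReal.coe_one, mul_one, sub_zero]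
    rw [mul_pow, ← Real.exp_nat_mul, h4, Real.sqrt_mul h0.le,
      Real.sqrt_mul (show 0 ≤ 2 * π by positivity) ((1 - r ^ 2) / (1 + r ^ 2)),
      Real.sqrt_div h0.le]
    have hA : √(1 - r ^ 2) ≠ 0 := (Real.sqrt_pos.2 h0).ne'
    have hB : √(1 + r ^ 2) ≠ 0 := (Real.sqrt_pos.2 (by positivity)).ne'
    have e1 : rexp (-y ^ 2 / 2) * rexp ((2 : ℕ) * (-(y - r * x) ^ 2 / (2 * (1 - r ^ 2)) + y ^ 2 / 2))
        = rexp (r ^ 2 / (1 + r ^ 2) * x ^ 2) * rexp (-(y - 2 * r * x / (1 + r ^ 2)) ^ 2 /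
          (2 * ((1 - r ^ 2) / (1 + r ^ 2)))) := by
      rw [← exp_add, ← exp_add]
      congr 1
      push_cast
      field_simp
      ring
    have e2 : ∀ a b c d a' b' : ℝ, b * d = a' * b' → (a * b) * (c * d) = (a * c) * (a' * b') := by
      intro a b c d a' b' h
      rw [← h]; ring
    rw [e2 _ _ _ _ _ _ e1]
    field_simp
  have hne : ((1 - r ^ 2) / (1 + r ^ 2)).toNNReal ≠ 0 := by
    simpa using hv0
  constructor
  · rw [gaussianReal_of_var_ne_zero _ one_ne_zero,
      integrable_withDensity_iff_integrable_smul₀' (measurable_gaussianPDF 0 1).aemeasurable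
        (.of_forall fun _ => gaussianPDF_lt_top)]
    simp only [toReal_gaussianPDF, smul_eq_mul, e]
    exact (integrable_gaussianPDFReal _ _).const_mul _
  · rw [integral_gauss_line]
    simp only [e]
    rw [integral_const_mul, integral_gaussianPDFReal_eq_one _ hne, mul_one]


lemma integral_ou_pow_four_le {v : ℝ → ℝ} (hv : BddMeas v) :
    ∫ x, ou (gaussianReal 0 1) (1 / 10) v x ^ 4 ∂gaussianReal 0 1
      ≤ (∫ x, v x ^ 2 ∂gaussianReal 0 1) ^ 2 := by
  set μ := gaussianReal 0 1 with hμ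
  set r : ℝ := 1 / 10 with hr
  have hr1 : r ^ 2 < 1 := by norm_num [hr]
  set a := ∫ x, v x ∂μ with ha
  set A := (√(1 - r ^ 4))⁻¹ with hA
  set β := r ^ 2 / (1 + r ^ 2) with hβ
  have hβv : β = 1 / 101 := by norm_num [hβ, hr]
  have hva : BddMeas (fun x => v x - a) := hv.sub (.const a)
  set τ := ∫ x, (v x - a) ^ 2 ∂μ with hτ
  have hτ0 : 0 ≤ τ := integral_nonneg fun _ => sq_nonneg _
  have hτ2 : τ = ∫ x, v x ^ 2 ∂μ - a ^ 2 := by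
    have : ∀ x, (v x - a) ^ 2 = v x ^ 2 - 2 * a * v x + a ^ 2 := fun x => by ring
    simp_rw [hτ, this]
    rw [integral_add, integral_sub, integral_const_mul, ← ha]
    · simp; ring
    · exact (hv.pow 2).integrable μ
    · exact (hv.integrable μ).const_mul _
    · exact ((hv.pow 2).integrable μ).sub ((hv.integrable μ).const_mul _)
    · exact integrable_const _
  set w : ℝ → ℝ := fun x => ou μ r v x - a with hw
  have hwb : BddMeas w := (hv.ou μ r).sub (.const a)
  have hw0 : ∫ x, w x ∂μ = 0 := by
    rw [hw, integral_sub ((hv.ou μ r).integrable μ) (integrable_const _),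
      integral_ou rotInv_line hv hr1.le]
    simp [ha, hμ]
  -- pointwise bound
  have hpt : ∀ x, w x ^ 2 ≤ (A * rexp (β * x ^ 2) - 1) * τ := by
    intro x
    obtain ⟨hi, hval⟩ := integral_mehler_sq hr1 x
    have hM1 : ∫ y, mehler r x y ∂μ = 1 := by
      have := ou_eq_mehler hr1 (fun _ => 1) measurable_const x
      simpa [ou] using this.symm
    have hMi : Integrable (mehler r x) μ := by
      refine Integrable.mono' (hi.add (integrable_const 1))
        (measurable_mehler r x).aestronglyMeasurable (.of_forall fun y => ?_)
      rw [Real.norm_of_nonneg (mehler_nonneg _ _ _)]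
      simp only [Pi.add_apply]
      nlinarith [sq_nonneg (mehler r x y - 1), mehler_nonneg r x y]
    have hMv : ∀ {u : ℝ → ℝ}, BddMeas u → Integrable (fun y => mehler r x y * u y) μ := by
      intro u hu
      exact hMi.mul_bdd (c := hu.2.choose) hu.1.aestronglyMeasurable
        (.of_forall fun y => hu.2.choose_spec y)
    have e1 : w x = ∫ y, (mehler r x y - 1) * (v y - a) ∂μ := by
      have : ∀ y, (mehler r x y - 1) * (v y - a)
          = mehler r x y * v y - a * mehler r x y - (v y - a) := fun y => by ring
      simp_rw [this]
      rw [integral_sub, integral_sub, integral_const_mul, hM1, hw]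
      · have h := ou_eq_mehler hr1 v hv.1 x
        rw [← hμ] at h
        show ou μ r v x - a = _
        rw [integral_sub (hv.integrable μ) (integrable_const _), h, ← ha]
        simp [hμ]
      · exact hMv hv
      · exact hMi.const_mul _
      · exact (hMv hv).sub (hMi.const_mul _)
      · exact hva.integrable μ
    have hi2 : Integrable (fun y => (mehler r x y - 1) ^ 2) μ := by
      have : ∀ y, (mehler r x y - 1) ^ 2 = mehler r x y ^ 2 - 2 * mehler r x y + 1 :=
        fun y => by ring
      simp_rw [this]
      exact (hi.sub (hMi.const_mul _)).add (integrable_const _)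
    have e2 : ∫ y, (mehler r x y - 1) ^ 2 ∂μ = A * rexp (β * x ^ 2) - 1 := by
      have : ∀ y, (mehler r x y - 1) ^ 2 = mehler r x y ^ 2 - 2 * mehler r x y + 1 :=
        fun y => by ring
      simp_rw [this]
      rw [integral_add, integral_sub, integral_const_mul, hM1, hμ, hval]
      · simp
        ring
      · exact hi
      · exact hMi.const_mul _
      · exact hi.sub (hMi.const_mul _)
      · exact integrable_const _
    rw [e1, ← e2]
    refine sq_integral_mul_le_of_integrable hi2 ((hva.pow 2).integrable μ) ?_
    have : ∀ y, (mehler r x y - 1) * (v y - a) = mehler r x y * (v y - a) - (v y - a) :=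
      fun y => by ring
    simp_rw [this]
    exact (hMv hva).sub (hva.integrable μ)
  have hA1 : 1 ≤ A := by
    rw [hA]
    refine (one_le_inv₀ (Real.sqrt_pos.2 (by norm_num [hr]))).2 ?_
    exact Real.sqrt_le_one.2 (by norm_num [hr])
  have hA2 : A ≤ 1.001 := by
    rw [hA, inv_le_comm₀ (Real.sqrt_pos.2 (by norm_num [hr])) (by norm_num)]
    apply Real.le_sqrt_of_sq_le
    norm_num [hr]
  have hexp : ∀ {t : ℝ}, t ≤ 1 / 25 → (√(1 - 2 * t))⁻¹ ≤ 1.05 := by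
    intro t ht
    rw [inv_le_comm₀ (Real.sqrt_pos.2 (by linarith)) (by norm_num)]
    apply Real.le_sqrt_of_sq_le
    norm_num
    linarith
  obtain ⟨i1, j1⟩ := integral_exp_sq_mul (t := β) (by rw [hβv]; norm_num)
  obtain ⟨i2, j2⟩ := integral_exp_sq_mul (t := 2 * β) (by rw [hβv]; norm_num)
  have b2 : ∫ x, w x ^ 2 ∂μ ≤ τ / 4 := by
    calc ∫ x, w x ^ 2 ∂μ ≤ ∫ x, (A * τ * rexp (β * x ^ 2) - τ) ∂μ := by
          refine integral_mono ((hwb.pow 2).integrable μ)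
            ((i1.const_mul _).sub (integrable_const _)) fun x => ?_
          have := hpt x
          simp only
          linarith
      _ = A * τ * (√(1 - 2 * β))⁻¹ - τ := by
          rw [integral_sub (i1.const_mul _) (integrable_const _), integral_const_mul, j1]
          simp
      _ ≤ 1.001 * τ * 1.05 - τ := by
          gcongr
          · exact hexp (by rw [hβv]; norm_num)
      _ ≤ τ / 4 := by linarith
  have b4 : ∫ x, w x ^ 4 ∂μ ≤ τ ^ 2 / 4 := by
    calc ∫ x, w x ^ 4 ∂μ ≤ ∫ x, (A ^ 2 * τ ^ 2 * rexp (2 * β * x ^ 2) - τ ^ 2) ∂μ := by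
          refine integral_mono ((hwb.pow 4).integrable μ)
            ((i2.const_mul _).sub (integrable_const _)) fun x => ?_
          have h := hpt x
          have h0 : 0 ≤ w x ^ 2 := sq_nonneg _
          have h1 : w x ^ 4 ≤ ((A * rexp (β * x ^ 2) - 1) * τ) ^ 2 := by
            rw [show w x ^ 4 = (w x ^ 2) ^ 2 by ring]
            exact pow_le_pow_left₀ h0 h 2
          have h2 : rexp (2 * β * x ^ 2) = rexp (β * x ^ 2) ^ 2 := by
            rw [← Real.exp_nat_mul]; congr 1; push_cast; ring
          have h3 : 1 ≤ A * rexp (β * x ^ 2) := by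
            have : 1 ≤ rexp (β * x ^ 2) := Real.one_le_exp (by rw [hβv]; positivity)
            nlinarith
          simp only
          rw [h2]
          nlinarith [sq_nonneg τ]
      _ = A ^ 2 * τ ^ 2 * (√(1 - 2 * (2 * β)))⁻¹ - τ ^ 2 := by
          rw [integral_sub (i2.const_mul _) (integrable_const _), integral_const_mul, j2]
          simp
      _ ≤ 1.001 ^ 2 * τ ^ 2 * 1.05 - τ ^ 2 := by
          gcongr
          · exact hexp (by rw [hβv]; norm_num)
      _ ≤ τ ^ 2 / 4 := by nlinarith [sq_nonneg τ]
  calc ∫ x, ou μ r v x ^ 4 ∂μ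
      ≤ ∫ x, (a ^ 4 + 4 * a ^ 3 * w x + 8 * a ^ 2 * w x ^ 2 + 3 * w x ^ 4) ∂μ := by
        refine integral_mono (((hv.ou μ r).pow 4).integrable μ)
          (((((BddMeas.const (a ^ 4)).add ((BddMeas.const (4 * a ^ 3)).mul hwb)).add
            ((BddMeas.const (8 * a ^ 2)).mul (hwb.pow 2))).add
            ((BddMeas.const 3).mul (hwb.pow 4))).integrable μ) fun x => ?_
        have : ou μ r v x = a + w x := by simp [hw]
        simp only [this]
        nlinarith [sq_nonneg (w x * (a - w x))]
    _ = a ^ 4 + 8 * a ^ 2 * ∫ x, w x ^ 2 ∂μ + 3 * ∫ x, w x ^ 4 ∂μ := by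
        rw [integral_add, integral_add, integral_add, integral_const_mul, integral_const_mul,
          integral_const_mul, hw0]
        · simp [hμ]
        · exact (BddMeas.const _).integrable μ
        · exact ((BddMeas.const _).mul hwb).integrable μ
        · exact ((BddMeas.const _).add ((BddMeas.const _).mul hwb)).integrable μ
        · exact ((BddMeas.const _).mul (hwb.pow 2)).integrable μ
        · exact (((BddMeas.const _).add ((BddMeas.const _).mul hwb)).add
            ((BddMeas.const _).mul (hwb.pow 2))).integrable μ
        · exact ((BddMeas.const _).mul (hwb.pow 4)).integrable μ
    _ ≤ a ^ 4 + 8 * a ^ 2 * (τ / 4) + 3 * (τ ^ 2 / 4) := by gcongr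
    _ ≤ (a ^ 2 + τ) ^ 2 := by nlinarith [sq_nonneg τ]
    _ = (∫ x, v x ^ 2 ∂μ) ^ 2 := by rw [hτ2]; ring

section

lemma abs_integral_rpow_le {α : Type*} [MeasurableSpace α] {μ : Measure α}
    [IsProbabilityMeasure μ] {u : α → ℝ} (hu : BddMeas u) {p : ℝ} (hp : 1 ≤ p) :
    |∫ x, u x ∂μ| ^ p ≤ ∫ x, |u x| ^ p ∂μ := by
  calc |∫ x, u x ∂μ| ^ p ≤ (∫ x, |u x| ∂μ) ^ p :=
        Real.rpow_le_rpow (abs_nonneg _) (abs_integral_le_integral_abs) (by linarith)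
    _ ≤ ∫ x, |u x| ^ p ∂μ :=
        (convexOn_rpow hp).map_integral_le (continuousOn_id.rpow_const fun _ _ => .inr (by linarith))
          isClosed_Ici (.of_forall fun x => Set.mem_Ici.2 (abs_nonneg _)) (hu.abs.integrable μ)
          ((hu.abs.rpow (fun _ => abs_nonneg _) (by linarith)).integrable μ)

lemma integral_mul_le_rpow {α : Type*} [MeasurableSpace α] {μ : Measure α}
    [IsProbabilityMeasure μ] {u v : α → ℝ} (hu : BddMeas u) (hv : BddMeas v) (hu0 : ∀ x, 0 ≤ u x)
    (hv0 : ∀ x, 0 ≤ v x) {p q : ℝ} (hpq : p.HolderConjugate q) :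
    ∫ x, u x * v x ∂μ ≤ (∫ x, u x ^ p ∂μ) ^ (1 / p) * (∫ x, v x ^ q ∂μ) ^ (1 / q) := by
  refine integral_mul_le_Lp_mul_Lq_of_nonneg hpq (.of_forall hu0) (.of_forall hv0) ?_ ?_
  · obtain ⟨hm, C, hC⟩ := hu
    exact MemLp.of_bound hm.aestronglyMeasurable C (.of_forall hC)
  · obtain ⟨hm, C, hC⟩ := hv
    exact MemLp.of_bound hm.aestronglyMeasurable C (.of_forall hC)

lemma integral_ou_sq_le {u : ℝ → ℝ} (hu : BddMeas u) (hu0 : ∀ x, 0 ≤ u x) :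
    ∫ x, ou (gaussianReal 0 1) (1 / 10) u x ^ 2 ∂gaussianReal 0 1
      ≤ (∫ x, u x ^ (4 / 3 : ℝ) ∂gaussianReal 0 1) ^ (3 / 2 : ℝ) := by
  set μ := gaussianReal 0 1 with hμ
  have hR : RotInv μ := rotInv_line
  set r : ℝ := 1 / 10 with hr
  have hr1 : r ^ 2 ≤ 1 := by norm_num [hr]
  set N := ∫ x, ou μ r u x ^ 2 ∂μ with hN
  have hN0 : 0 ≤ N := integral_nonneg fun _ => sq_nonneg _
  have hnn : ∀ {v : ℝ → ℝ}, (∀ x, 0 ≤ v x) → ∀ x, 0 ≤ ou μ r v x := fun h x =>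
    integral_nonneg fun _ => h _
  set S := ∫ x, u x ^ (4 / 3 : ℝ) ∂μ with hS
  have hS0 : 0 ≤ S := integral_nonneg fun x => Real.rpow_nonneg (hu0 x) _
  have h1 : N = ∫ x, u x * ou μ r (ou μ r u) x ∂μ := by
    rw [← ou_symm hR hu (hu.ou μ r) hr1]
    simp only [hN, sq]
  have h2 : N ≤ S ^ (3 / 4 : ℝ) * N ^ (1 / 2 : ℝ) := by
    have h := integral_mul_le_rpow (μ := μ) hu ((hu.ou μ r).ou μ r) hu0 (hnn (hnn hu0))
      (p := 4 / 3) (q := 4) ⟨by norm_num, by norm_num, by norm_num⟩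
    rw [← h1] at h
    refine h.trans ?_
    have e : (1 / (4 / 3) : ℝ) = 3 / 4 := by norm_num
    rw [e]
    gcongr
    have h4 := integral_ou_pow_four_le (hu.ou μ r)
    calc (∫ x, ou μ r (ou μ r u) x ^ (4 : ℝ) ∂μ) ^ (1 / 4 : ℝ)
        = (∫ x, ou μ r (ou μ r u) x ^ (4 : ℕ) ∂μ) ^ (1 / 4 : ℝ) := by norm_cast
      _ ≤ (N ^ 2) ^ (1 / 4 : ℝ) := by
          refine Real.rpow_le_rpow (integral_nonneg fun x => by positivity) h4 (by norm_num)
      _ = N ^ (1 / 2 : ℝ) := by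
          rw [← Real.rpow_natCast, ← Real.rpow_mul hN0]; norm_num
  rcases hN0.eq_or_lt with h0 | h0
  · rw [← h0]; positivity
  · have h3 : N ^ (1 / 2 : ℝ) ≤ S ^ (3 / 4 : ℝ) := by
      have : N = N ^ (1 / 2 : ℝ) * N ^ (1 / 2 : ℝ) := by
        rw [← Real.rpow_add h0]; norm_num
      rw [this, Real.mul_rpow (by positivity) (by positivity), ← this] at h2
      have hp : 0 < N ^ (1 / 2 : ℝ) := by positivity
      have h2' : N ^ (1 / 2 : ℝ) * N ^ (1 / 2 : ℝ) ≤ S ^ (3 / 4 : ℝ) * N ^ (1 / 2 : ℝ) := by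
        rw [← this]
        rw [← Real.mul_rpow (by positivity) (by positivity), ← this] at h2
        exact h2
      exact le_of_mul_le_mul_right h2' hp
    calc N = (N ^ (1 / 2 : ℝ)) ^ 2 := by rw [← Real.rpow_natCast, ← Real.rpow_mul hN0]; norm_num
      _ ≤ (S ^ (3 / 4 : ℝ)) ^ 2 := by gcongr
      _ = S ^ (3 / 2 : ℝ) := by rw [← Real.rpow_natCast, ← Real.rpow_mul hS0]; norm_num

lemma hypercontractive_line {u v : ℝ → ℝ} (hu : BddMeas u) (hv : BddMeas v)
    (hu0 : ∀ x, 0 ≤ u x) (hv0 : ∀ x, 0 ≤ v x) :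
    ∫ x, u x * ou (gaussianReal 0 1) (1 / 100) v x ∂gaussianReal 0 1
      ≤ (∫ x, u x ^ (4 / 3 : ℝ) ∂gaussianReal 0 1) ^ (3 / 4 : ℝ) *
        (∫ x, v x ^ (4 / 3 : ℝ) ∂gaussianReal 0 1) ^ (3 / 4 : ℝ) := by
  set μ := gaussianReal 0 1 with hμ
  have hR : RotInv μ := rotInv_line
  have hr1 : (1 / 10 : ℝ) ^ 2 ≤ 1 := by norm_num
  have hS0 : 0 ≤ ∫ x, u x ^ (4 / 3 : ℝ) ∂μ := integral_nonneg fun x => Real.rpow_nonneg (hu0 x) _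
  have hT0 : 0 ≤ ∫ x, v x ^ (4 / 3 : ℝ) ∂μ := integral_nonneg fun x => Real.rpow_nonneg (hv0 x) _
  have e : ∫ x, u x * ou μ (1 / 100) v x ∂μ = ∫ x, ou μ (1 / 10) u x * ou μ (1 / 10) v x ∂μ := by
    rw [ou_symm hR hu (hv.ou μ _) hr1]
    congr 1
    ext x
    rw [ou_ou hR hv hr1 hr1]
    norm_num
  rw [e]
  refine (le_abs_self _).trans (abs_le_of_sq_le_sq ?_ (by positivity))
  refine (sq_integral_mul_le (hu.ou μ _) (hv.ou μ _)).trans ?_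
  rw [mul_pow]
  have p2 : ∀ S : ℝ, 0 ≤ S → (S ^ (3 / 4 : ℝ)) ^ 2 = S ^ (3 / 2 : ℝ) := fun S hS => by
    rw [← Real.rpow_natCast, ← Real.rpow_mul hS]; norm_num
  rw [p2 _ hS0, p2 _ hT0]
  exact mul_le_mul (integral_ou_sq_le hu hu0) (integral_ou_sq_le hv hv0)
    (integral_nonneg fun _ => sq_nonneg _) (by positivity)

variable {m : ℕ}

lemma measurePreserving_cons :
    MeasurePreserving (fun p : ℝ × (Fin m → ℝ) => (Fin.cons p.1 p.2 : Fin (m + 1) → ℝ))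
      ((gaussianReal 0 1).prod (gauss m)) (gauss (m + 1)) := by
  have h := (measurePreserving_piFinSuccAbove (fun _ : Fin (m + 1) => gaussianReal 0 1) 0).symm
  convert h using 1
  funext p
  simp [MeasurableEquiv.piFinSuccAbove, Fin.insertNthEquiv]

lemma integral_cons {h : (Fin (m + 1) → ℝ) → ℝ} (hh : BddMeas h) :
    ∫ x, h x ∂gauss (m + 1)
      = ∫ x₀, ∫ x, h (Fin.cons x₀ x) ∂gauss m ∂gaussianReal 0 1 := by
  rw [← measurePreserving_cons.map_eq, integral_map measurePreserving_cons.aemeasurable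
    hh.1.aestronglyMeasurable, integral_prod]
  exact (hh.comp measurePreserving_cons.measurable).integrable _

end

section

variable {m : ℕ}

lemma integral_swap_of_bdd {α β : Type*} [MeasurableSpace α] [MeasurableSpace β]
    {μ : Measure α} {ν : Measure β} [IsProbabilityMeasure μ] [IsProbabilityMeasure ν]
    {w : α → β → ℝ} (hw : BddMeas (Function.uncurry w)) :
    ∫ x, ∫ y, w x y ∂ν ∂μ = ∫ y, ∫ x, w x y ∂μ ∂ν :=
  integral_integral_swap (hw.integrable _)

lemma BddMeas.integral_mono {α : Type*} [MeasurableSpace α] {μ : Measure α} [IsFiniteMeasure μ]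
    {u v : α → ℝ} (hu : BddMeas u) (hv : BddMeas v) (h : ∀ x, u x ≤ v x) :
    ∫ x, u x ∂μ ≤ ∫ x, v x ∂μ :=
  MeasureTheory.integral_mono (hu.integrable μ) (hv.integrable μ) h

@[fun_prop]
lemma measurable_cons' {α : Type*} [MeasurableSpace α] {f : α → ℝ} {g : α → Fin m → ℝ}
    (hf : Measurable f) (hg : Measurable g) :
    Measurable (fun a => (Fin.cons (f a) (g a) : Fin (m + 1) → ℝ)) :=
  measurePreserving_cons.measurable.comp (hf.prodMk hg)

lemma ou_cons (r : ℝ) {v : (Fin (m + 1) → ℝ) → ℝ} (hv : BddMeas v) (x₀ : ℝ) (x : Fin m → ℝ) :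
    ou (gauss (m + 1)) r v (Fin.cons x₀ x)
      = ∫ y₀, ou (gauss m) r (fun z => v (Fin.cons (r • x₀ + √(1 - r ^ 2) • y₀) z)) x
          ∂gaussianReal 0 1 := by
  unfold ou
  rw [integral_cons (hv.comp (by fun_prop))]
  congr 1 with y₀
  congr 1 with y
  congr 1
  funext i
  refine Fin.cases ?_ (fun i => ?_) i <;> simp

lemma BddMeas.ou_param {α : Type*} [MeasurableSpace α] {w : α → (Fin m → ℝ) → ℝ}
    (hw : BddMeas (Function.uncurry w)) (r : ℝ) :
    BddMeas (fun p : α × (Fin m → ℝ) => Dvoretzky.ou (gauss m) r (w p.1) p.2) :=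
  BddMeas.integral_right (w := fun (p : α × (Fin m → ℝ)) y =>
    w p.1 (r • p.2 + √(1 - r ^ 2) • y))
    (hw.comp (g := fun q : (α × (Fin m → ℝ)) × (Fin m → ℝ) =>
      (q.1.1, r • q.1.2 + √(1 - r ^ 2) • q.2)) (by fun_prop)) _

lemma integral_mul_ou_cons (r : ℝ) {u v : (Fin (m + 1) → ℝ) → ℝ} (hu : BddMeas u)
    (hv : BddMeas v) :
    ∫ x, u x * ou (gauss (m + 1)) r v x ∂gauss (m + 1)
      = ∫ x₀, ∫ y₀, ∫ x, u (Fin.cons x₀ x) *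
          ou (gauss m) r (fun z => v (Fin.cons (r • x₀ + √(1 - r ^ 2) • y₀) z)) x
          ∂gauss m ∂gaussianReal 0 1 ∂gaussianReal 0 1 := by
  rw [integral_cons (hu.mul (hv.ou _ r))]
  congr 1 with x₀
  have hb : BddMeas (fun p : (Fin m → ℝ) × ℝ =>
      ou (gauss m) r (fun z => v (Fin.cons (r • x₀ + √(1 - r ^ 2) • p.2) z)) p.1) :=
    (BddMeas.ou_param (w := fun (y₀ : ℝ) z => v (Fin.cons (r • x₀ + √(1 - r ^ 2) • y₀) z))
      (hv.comp (by fun_prop)) r).comp (g := fun p : (Fin m → ℝ) × ℝ => (p.2, p.1)) (by fun_prop)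
  rw [← integral_swap_of_bdd (w := fun x y₀ => u (Fin.cons x₀ x) *
          ou (gauss m) r (fun z => v (Fin.cons (r • x₀ + √(1 - r ^ 2) • y₀) z)) x)
    ((hu.comp (g := fun p : (Fin m → ℝ) × ℝ => Fin.cons x₀ p.1) (by fun_prop)).mul hb)]
  congr 1 with x
  rw [ou_cons r hv, integral_const_mul]


lemma hypercontractive (m : ℕ) : ∀ {u v : (Fin m → ℝ) → ℝ}, BddMeas u → BddMeas v →
    (∀ x, 0 ≤ u x) → (∀ x, 0 ≤ v x) →
    ∫ x, u x * ou (gauss m) (1 / 100) v x ∂gauss m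
      ≤ (∫ x, u x ^ (4 / 3 : ℝ) ∂gauss m) ^ (3 / 4 : ℝ) *
        (∫ x, v x ^ (4 / 3 : ℝ) ∂gauss m) ^ (3 / 4 : ℝ) := by
  induction m with
  | zero =>
    intro u v hu hv hu0 hv0
    have e : ∀ x : Fin 0 → ℝ, x = 0 := fun x => Subsingleton.elim _ _
    have e2 : ∀ w : (Fin 0 → ℝ) → ℝ, w = fun _ => w 0 := fun w => by funext x; rw [e x]
    rw [e2 u, e2 v]
    simp only [ou, integral_const, probReal_univ, smul_eq_mul, one_mul]
    rw [← Real.rpow_mul (hu0 0), ← Real.rpow_mul (hv0 0)]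
    norm_num
  | succ m ih =>
    intro u v hu hv hu0 hv0
    have hc : BddMeas (fun p : ℝ × (Fin m → ℝ) => u (Fin.cons p.1 p.2)) := hu.comp (by fun_prop)
    have hd : BddMeas (fun p : ℝ × (Fin m → ℝ) => v (Fin.cons p.1 p.2)) := hv.comp (by fun_prop)
    have key : ∀ {w : (Fin (m + 1) → ℝ) → ℝ}, BddMeas w → (∀ x, 0 ≤ w x) →
        BddMeas (fun x₀ : ℝ => (∫ x, w (Fin.cons x₀ x) ^ (4 / 3 : ℝ) ∂gauss m) ^ (3 / 4 : ℝ)) := by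
      intro w hw hw0
      refine BddMeas.rpow (BddMeas.integral_right
        (w := fun (x₀ : ℝ) (x : Fin m → ℝ) => w (Fin.cons x₀ x) ^ (4 / 3 : ℝ)) ?_ _) ?_ (by norm_num)
      · exact (hw.rpow hw0 (by norm_num)).comp
          (g := fun p : ℝ × (Fin m → ℝ) => Fin.cons p.1 p.2) (by fun_prop)
      · exact fun x => integral_nonneg fun y => Real.rpow_nonneg (hw0 _) _
    have key0 : ∀ {w : (Fin (m + 1) → ℝ) → ℝ}, (∀ x, 0 ≤ w x) → ∀ x₀ : ℝ,
        0 ≤ (∫ x, w (Fin.cons x₀ x) ^ (4 / 3 : ℝ) ∂gauss m) ^ (3 / 4 : ℝ) := fun hw0 x₀ =>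
      Real.rpow_nonneg (integral_nonneg fun y => Real.rpow_nonneg (hw0 _) _) _
    have fin : ∀ {w : (Fin (m + 1) → ℝ) → ℝ}, BddMeas w → (∀ x, 0 ≤ w x) →
        ∫ x₀, ((∫ x, w (Fin.cons x₀ x) ^ (4 / 3 : ℝ) ∂gauss m) ^ (3 / 4 : ℝ)) ^ (4 / 3 : ℝ)
          ∂gaussianReal 0 1 = ∫ x, w x ^ (4 / 3 : ℝ) ∂gauss (m + 1) := by
      intro w hw hw0
      rw [integral_cons (hw.rpow hw0 (by norm_num))]
      congr 1 with x₀
      rw [← Real.rpow_mul (integral_nonneg fun y => Real.rpow_nonneg (hw0 _) _)]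
      norm_num
    set U := fun x₀ : ℝ => (∫ x, u (Fin.cons x₀ x) ^ (4 / 3 : ℝ) ∂gauss m) ^ (3 / 4 : ℝ) with hU
    set V := fun x₀ : ℝ => (∫ x, v (Fin.cons x₀ x) ^ (4 / 3 : ℝ) ∂gauss m) ^ (3 / 4 : ℝ) with hV
    have main : ∫ x, u x * ou (gauss (m + 1)) (1 / 100) v x ∂gauss (m + 1)
        ≤ ∫ x, U x * ou (gaussianReal 0 1) (1 / 100) V x ∂gaussianReal 0 1 := by
      rw [integral_mul_ou_cons _ hu hv]
      set σ := √(1 - (1 / 100 : ℝ) ^ 2)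
      have b1 : BddMeas (fun p : ℝ × ℝ => ∫ x, u (Fin.cons p.1 x) *
          ou (gauss m) (1 / 100) (fun z => v (Fin.cons ((1 / 100 : ℝ) • p.1 + σ • p.2) z)) x
          ∂gauss m) := by
        refine BddMeas.integral_right (w := fun (p : ℝ × ℝ) x => u (Fin.cons p.1 x) *
          ou (gauss m) (1 / 100) (fun z => v (Fin.cons ((1 / 100 : ℝ) • p.1 + σ • p.2) z)) x) ?_ _
        refine BddMeas.mul (u := fun q : (ℝ × ℝ) × (Fin m → ℝ) => u (Fin.cons q.1.1 q.2))
          (hu.comp (by fun_prop)) ?_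
        exact BddMeas.ou_param (w := fun (p : ℝ × ℝ) z =>
          v (Fin.cons ((1 / 100 : ℝ) • p.1 + σ • p.2) z)) (hv.comp (by fun_prop)) _
      have b2 : BddMeas (fun p : ℝ × ℝ => U p.1 * V ((1 / 100 : ℝ) • p.1 + σ • p.2)) :=
        ((key hu hu0).comp (by fun_prop)).mul ((key hv hv0).comp (by fun_prop))
      have e3 : ∀ x₀, U x₀ * ou (gaussianReal 0 1) (1 / 100) V x₀
          = ∫ y₀, U x₀ * V ((1 / 100 : ℝ) • x₀ + σ • y₀) ∂gaussianReal 0 1 := fun x₀ => by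
        rw [integral_const_mul]; rfl
      simp_rw [e3]
      refine (BddMeas.integral_right (w := fun x₀ y₀ => ∫ x, u (Fin.cons x₀ x) *
          ou (gauss m) (1 / 100) (fun z => v (Fin.cons ((1 / 100 : ℝ) • x₀ + σ • y₀) z)) x
          ∂gauss m) b1 _).integral_mono
        (BddMeas.integral_right (w := fun x₀ y₀ => U x₀ * V ((1 / 100 : ℝ) • x₀ + σ • y₀)) b2 _)
        fun x₀ => ?_
      refine (b1.comp (g := fun y₀ => (x₀, y₀)) (by fun_prop)).integral_mono
        (b2.comp (g := fun y₀ => (x₀, y₀)) (by fun_prop)) fun y₀ => ?_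
      exact ih (hu.comp (by fun_prop)) (hv.comp (by fun_prop)) (fun _ => hu0 _) (fun _ => hv0 _)
    refine main.trans ((hypercontractive_line (key hu hu0) (key hv hv0) (key0 hu0)
      (key0 hv0)).trans ?_)
    rw [fin hu hu0, fin hv hv0]

end

section

variable {m : ℕ}

@[fun_prop]
lemma measurable_upd {α : Type*} [MeasurableSpace α] {f : α → ℝ} {g : α → Fin m → ℝ} {i : Fin m}
    (hf : Measurable f) (hg : Measurable g) :
    Measurable (fun a => Function.update (g a) i (f a)) :=
  measurable_update'.comp (hg.prodMk hf)

/-- The `L^{4/3}` influence of the `i`-th coordinate. -/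
noncomputable def infl (u : (Fin m → ℝ) → ℝ) (i : Fin m) : ℝ :=
  ∫ x, ∫ y, |u x - u (Function.update x i y)| ^ (4 / 3 : ℝ) ∂gaussianReal 0 1 ∂gauss m

lemma infl_nonneg (u : (Fin m → ℝ) → ℝ) (i : Fin m) : 0 ≤ infl u i :=
  integral_nonneg fun _ => integral_nonneg fun _ => by positivity

lemma BddMeas.infl_aux {u : (Fin m → ℝ) → ℝ} (hu : BddMeas u) (i : Fin m) :
    BddMeas (fun p : (Fin m → ℝ) × ℝ => |u p.1 - u (Function.update p.1 i p.2)| ^ (4 / 3 : ℝ)) :=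
  ((hu.comp (by fun_prop)).sub (hu.comp (by fun_prop))).abs.rpow (fun _ => abs_nonneg _)
    (by norm_num)

lemma abs_ou_le {μ : Measure (Fin m → ℝ)} [IsProbabilityMeasure μ]
    (u : (Fin m → ℝ) → ℝ) (r : ℝ) (x : Fin m → ℝ) :
    |ou μ r u x| ≤ ou μ r (fun z => |u z|) x := abs_integral_le_integral_abs

lemma integral_mul_ou_le {u : (Fin m → ℝ) → ℝ} (hu : BddMeas u) :
    ∫ x, u x * ou (gauss m) (1 / 100) u x ∂gauss m
      ≤ (∫ x, |u x| ^ (4 / 3 : ℝ) ∂gauss m) ^ (3 / 2 : ℝ) := by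
  have h0 : 0 ≤ ∫ x, |u x| ^ (4 / 3 : ℝ) ∂gauss m := integral_nonneg fun _ => by positivity
  calc ∫ x, u x * ou (gauss m) (1 / 100) u x ∂gauss m
      ≤ ∫ x, |u x| * ou (gauss m) (1 / 100) (fun z => |u z|) x ∂gauss m := by
        refine (hu.mul (hu.ou _ _)).integral_mono (hu.abs.mul (hu.abs.ou _ _)) fun x => ?_
        refine (le_abs_self _).trans ?_
        rw [abs_mul]
        gcongr
        exact abs_ou_le _ _ _
    _ ≤ _ := hypercontractive m hu.abs hu.abs (fun _ => abs_nonneg _) (fun _ => abs_nonneg _)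
    _ = _ := by rw [← Real.rpow_add_of_nonneg h0 (by norm_num) (by norm_num)]; norm_num

theorem cov_ou_le (m : ℕ) : ∀ {u : (Fin m → ℝ) → ℝ}, BddMeas u →
    ∫ x, u x * ou (gauss m) (1 / 100) u x ∂gauss m - (∫ x, u x ∂gauss m) ^ 2
      ≤ ∑ i, infl u i ^ (3 / 2 : ℝ) := by
  induction m with
  | zero =>
    intro u hu
    have e : ∀ x : Fin 0 → ℝ, x = 0 := fun x => Subsingleton.elim _ _
    have e2 : ∀ w : (Fin 0 → ℝ) → ℝ, w = fun _ => w 0 := fun w => by funext x; rw [e x]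
    rw [e2 u]
    simp [ou, sq]
  | succ m ih =>
    intro u hu
    set ρ : ℝ := 1 / 100 with hρ
    have hρ1 : ρ ^ 2 ≤ 1 := by norm_num [hρ]
    set u1 : (Fin m → ℝ) → ℝ := fun x => ∫ x₀, u (Fin.cons x₀ x) ∂gaussianReal 0 1 with hu1
    have bu1 : BddMeas u1 := BddMeas.integral_right
      (w := fun (x : Fin m → ℝ) x₀ => u (Fin.cons x₀ x)) (hu.comp (by fun_prop)) _
    set t : (Fin (m + 1) → ℝ) → ℝ := fun x => u1 (Fin.tail x) with ht
    have mt : Measurable (fun x : Fin (m + 1) → ℝ => Fin.tail x) := by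
      unfold Fin.tail; fun_prop
    have bt : BddMeas t := bu1.comp mt
    set w : (Fin (m + 1) → ℝ) → ℝ := fun x => u x - t x with hw
    have bw : BddMeas w := hu.sub bt
    have ouT : ∀ x₀ x, ou (gauss (m + 1)) ρ t (Fin.cons x₀ x) = ou (gauss m) ρ u1 x := by
      intro x₀ x
      rw [ou_cons _ bt]
      simp [ht]
    have meanu : ∫ x, u x ∂gauss (m + 1) = ∫ x, u1 x ∂gauss m := by
      rw [integral_cons hu, integral_swap_of_bdd (w := fun x₀ x => u (Fin.cons x₀ x))
        (hu.comp (g := fun p : ℝ × (Fin m → ℝ) => Fin.cons p.1 p.2) (by fun_prop))]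
    have cross : ∫ x, w x * ou (gauss (m + 1)) ρ t x ∂gauss (m + 1) = 0 := by
      rw [integral_cons (bw.mul (bt.ou _ _))]
      simp_rw [ouT]
      rw [integral_swap_of_bdd (w := fun x₀ x => w (Fin.cons x₀ x) * ou (gauss m) ρ u1 x)
        ((bw.comp (g := fun p : ℝ × (Fin m → ℝ) => Fin.cons p.1 p.2) (by fun_prop)).mul
          ((bu1.ou (gauss m) ρ).comp (g := fun p : ℝ × (Fin m → ℝ) => p.2) (by fun_prop)))]
      have : ∀ x, ∫ x₀, w (Fin.cons x₀ x) * ou (gauss m) ρ u1 x ∂gaussianReal 0 1 = 0 := by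
        intro x
        rw [integral_mul_const]
        simp only [hw, ht, Fin.tail_cons]
        rw [integral_sub ((hu.comp (by fun_prop)).integrable _) (integrable_const _)]
        simp [hu1]
      simp [this]
    have cross' : ∫ x, t x * ou (gauss (m + 1)) ρ w x ∂gauss (m + 1) = 0 := by
      rw [← ou_symm rotInv_gauss bt bw hρ1, ← cross]
      simp_rw [mul_comm]
    have diag : ∫ x, t x * ou (gauss (m + 1)) ρ t x ∂gauss (m + 1)
        = ∫ x, u1 x * ou (gauss m) ρ u1 x ∂gauss m := by
      rw [integral_cons (bt.mul (bt.ou _ _))]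
      simp_rw [ouT]
      simp [ht]
    have ouadd : ∀ x, ou (gauss (m + 1)) ρ u x
        = ou (gauss (m + 1)) ρ w x + ou (gauss (m + 1)) ρ t x := by
      intro x
      unfold ou
      rw [← integral_add ((bw.comp (by fun_prop)).integrable _)
        ((bt.comp (by fun_prop)).integrable _)]
      simp [hw]
    have split : ∫ x, u x * ou (gauss (m + 1)) ρ u x ∂gauss (m + 1)
        = ∫ x, w x * ou (gauss (m + 1)) ρ w x ∂gauss (m + 1)
          + ∫ x, u1 x * ou (gauss m) ρ u1 x ∂gauss m := by
      have : ∀ x, u x * ou (gauss (m + 1)) ρ u x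
          = (w x * ou (gauss (m + 1)) ρ w x + w x * ou (gauss (m + 1)) ρ t x)
            + (t x * ou (gauss (m + 1)) ρ w x + t x * ou (gauss (m + 1)) ρ t x) := by
        intro x
        rw [ouadd]; simp only [hw]; ring
      simp_rw [this]
      have b1 := bw.mul (bw.ou (gauss (m + 1)) ρ)
      have b2 := bw.mul (bt.ou (gauss (m + 1)) ρ)
      have b3 := bt.mul (bw.ou (gauss (m + 1)) ρ)
      have b4 := bt.mul (bt.ou (gauss (m + 1)) ρ)
      rw [integral_add ((b1.add b2).integrable _) ((b3.add b4).integrable _),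
        integral_add (b1.integrable _) (b2.integrable _),
        integral_add (b3.integrable _) (b4.integrable _), cross, cross', diag]
      ring
    have first : ∫ x, |w x| ^ (4 / 3 : ℝ) ∂gauss (m + 1) ≤ infl u 0 := by
      refine (bw.abs.rpow (fun _ => abs_nonneg _) (by norm_num)).integral_mono
        (BddMeas.integral_right (w := fun x y =>
          |u x - u (Function.update x 0 y)| ^ (4 / 3 : ℝ)) (hu.infl_aux 0) _) fun x => ?_
      have e : w x = ∫ y, (u x - u (Function.update x 0 y)) ∂gaussianReal 0 1 := by
        rw [integral_sub (integrable_const _) ((hu.comp (by fun_prop)).integrable _)]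
        simp only [hw, ht, hu1, integral_const, probReal_univ, one_smul]
        congr 2 with y
        rw [← Fin.cons_self_tail x, Fin.update_cons_zero, Fin.tail_cons]
      rw [e]
      exact abs_integral_rpow_le ((BddMeas.const _).sub (hu.comp (by fun_prop))) (by norm_num)
    have rest : ∀ i, infl u1 i ≤ infl u i.succ := by
      intro i
      have bb : BddMeas (fun p : ℝ × ((Fin m → ℝ) × ℝ) => |u (Fin.cons p.1 p.2.1)
          - u (Function.update (Fin.cons p.1 p.2.1) i.succ p.2.2)| ^ (4 / 3 : ℝ)) :=
        (hu.infl_aux i.succ).comp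
          (g := fun p : ℝ × ((Fin m → ℝ) × ℝ) => (Fin.cons p.1 p.2.1, p.2.2)) (by fun_prop)
      have e : infl u i.succ = ∫ x, ∫ x₀, ∫ y, |u (Fin.cons x₀ x)
          - u (Function.update (Fin.cons x₀ x) i.succ y)| ^ (4 / 3 : ℝ)
          ∂gaussianReal 0 1 ∂gaussianReal 0 1 ∂gauss m := by
        unfold infl
        rw [integral_cons (BddMeas.integral_right (w := fun x y =>
          |u x - u (Function.update x i.succ y)| ^ (4 / 3 : ℝ)) (hu.infl_aux _) _)]
        refine integral_swap_of_bdd (w := fun x₀ x => ∫ y, |u (Fin.cons x₀ x)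
          - u (Function.update (Fin.cons x₀ x) i.succ y)| ^ (4 / 3 : ℝ) ∂gaussianReal 0 1) ?_
        exact BddMeas.integral_right (w := fun (p : ℝ × (Fin m → ℝ)) y => |u (Fin.cons p.1 p.2)
          - u (Function.update (Fin.cons p.1 p.2) i.succ y)| ^ (4 / 3 : ℝ))
          (bb.comp (g := fun q : (ℝ × (Fin m → ℝ)) × ℝ => (q.1.1, (q.1.2, q.2))) (by fun_prop)) _
      rw [e]
      refine (BddMeas.integral_right (w := fun x y => |u1 x - u1 (Function.update x i y)|
        ^ (4 / 3 : ℝ)) (bu1.infl_aux i) _).integral_mono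
        (BddMeas.integral_right (w := fun x x₀ => ∫ y, |u (Fin.cons x₀ x)
          - u (Function.update (Fin.cons x₀ x) i.succ y)| ^ (4 / 3 : ℝ) ∂gaussianReal 0 1)
          (BddMeas.integral_right (w := fun (p : (Fin m → ℝ) × ℝ) y => |u (Fin.cons p.2 p.1)
          - u (Function.update (Fin.cons p.2 p.1) i.succ y)| ^ (4 / 3 : ℝ))
          (bb.comp (g := fun q : ((Fin m → ℝ) × ℝ) × ℝ => (q.1.2, (q.1.1, q.2)))
            (by fun_prop)) _) _) fun x => ?_
      rw [integral_swap_of_bdd (w := fun x₀ y => |u (Fin.cons x₀ x)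
          - u (Function.update (Fin.cons x₀ x) i.succ y)| ^ (4 / 3 : ℝ))
          (bb.comp (g := fun q : ℝ × ℝ => (q.1, (x, q.2))) (by fun_prop))]
      refine ((bu1.infl_aux i).comp (g := fun y : ℝ => (x, y)) (by fun_prop)).integral_mono
        (BddMeas.integral_right (w := fun y x₀ => |u (Fin.cons x₀ x)
          - u (Function.update (Fin.cons x₀ x) i.succ y)| ^ (4 / 3 : ℝ))
          (bb.comp (g := fun q : ℝ × ℝ => (q.2, (x, q.1))) (by fun_prop)) _) fun y => ?_
      have e1 : u1 x - u1 (Function.update x i y) = ∫ x₀, (u (Fin.cons x₀ x)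
          - u (Function.update (Fin.cons x₀ x) i.succ y)) ∂gaussianReal 0 1 := by
        rw [integral_sub ((hu.comp (by fun_prop)).integrable _)
          ((hu.comp (by fun_prop)).integrable _)]
        simp only [hu1, Fin.cons_update]
      show |u1 x - u1 (Function.update x i y)| ^ (4 / 3 : ℝ) ≤ _
      rw [e1]
      exact abs_integral_rpow_le ((hu.comp (by fun_prop)).sub (hu.comp (by fun_prop)))
        (by norm_num)
    rw [split, meanu, Fin.sum_univ_succ, add_sub_assoc]
    refine add_le_add ?_ ((ih bu1).trans ?_)
    · refine (integral_mul_ou_le bw).trans ?_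
      exact Real.rpow_le_rpow (integral_nonneg fun _ => by positivity) first (by norm_num)
    · exact Finset.sum_le_sum fun i _ =>
        Real.rpow_le_rpow (infl_nonneg _ _) (rest i) (by norm_num)

end

section
variable {V : Type*} [NormedAddCommGroup V] [NormedSpace ℝ V] [MeasurableSpace V] [BorelSpace V]
  [SecondCountableTopology V] {μ : Measure V} [IsProbabilityMeasure μ]

lemma ou_energy (hμ : RotInv μ) {G : V → ℝ} (hG : BddMeas G) {q : ℝ} (hq : q ^ 2 ≤ 1) :
    ∫ x, G x ^ 2 ∂μ - ∫ x, G x * ou μ q G x ∂μ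
      = 1 / 2 * ∫ p : V × V, (G p.1 - G (q • p.1 + √(1 - q ^ 2) • p.2)) ^ 2 ∂(μ.prod μ) := by
  have hs : q ^ 2 + √(1 - q ^ 2) ^ 2 = 1 := by rw [Real.sq_sqrt (by linarith)]; ring
  set s := √(1 - q ^ 2) with hsdef
  have b1 : BddMeas (fun p : V × V => G p.1) := hG.comp (by fun_prop)
  have b2 : BddMeas (fun p : V × V => G (q • p.1 + s • p.2)) := hG.comp (by fun_prop)
  have e1 : ∫ p : V × V, G p.1 ^ 2 ∂(μ.prod μ) = ∫ x, G x ^ 2 ∂μ := by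
    rw [integral_prod _ ((b1.pow 2).integrable _)]; simp
  have e2 : ∫ p : V × V, G (q • p.1 + s • p.2) ^ 2 ∂(μ.prod μ) = ∫ x, G x ^ 2 ∂μ := by
    rw [← e1, ← hμ.integral_comp hs (b1.pow 2).measurable]
  have e3 : ∫ p : V × V, G p.1 * G (q • p.1 + s • p.2) ∂(μ.prod μ)
      = ∫ x, G x * ou μ q G x ∂μ := by
    rw [integral_prod _ ((b1.mul b2).integrable _)]
    simp only [ou, integral_const_mul, hsdef]
  have e4 : ∀ p : V × V, (G p.1 - G (q • p.1 + s • p.2)) ^ 2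
      = (G p.1 ^ 2 + G (q • p.1 + s • p.2) ^ 2) - 2 * (G p.1 * G (q • p.1 + s • p.2)) :=
    fun p => by ring
  simp_rw [e4]
  rw [integral_sub (((b1.pow 2).add (b2.pow 2)).integrable _)
    (((BddMeas.const 2).mul (b1.mul b2)).integrable _),
    integral_add ((b1.pow 2).integrable _) ((b2.pow 2).integrable _), integral_const_mul,
    e1, e2, e3]
  ring

lemma pow_le_ratio {a : ℕ → ℝ} (h0 : ∀ j, 0 ≤ a j) (hc : ∀ j, a (j + 1) ^ 2 ≤ a j * a (j + 2))
    (ha : 0 < a 0) (n : ℕ) : a 0 * (a 1 / a 0) ^ n ≤ a n := by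
  have hb : 0 ≤ a 1 / a 0 := div_nonneg (h0 _) (h0 _)
  have step : ∀ j, a 1 / a 0 * a j ≤ a (j + 1) := by
    intro j
    induction j with
    | zero => rw [div_mul_cancel₀ _ ha.ne']
    | succ j ih =>
      rcases (h0 j).eq_or_lt with h | h
      · have : a (j + 1) = 0 := by
          have := hc j
          rw [← h, zero_mul] at this
          nlinarith [sq_nonneg (a (j + 1))]
        rw [this]
        simpa using h0 (j + 2)
      · have h1 : a 1 / a 0 * a j * a (j + 1) ≤ a j * a (j + 2) := by
          refine le_trans ?_ (hc j)
          rw [sq]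
          exact mul_le_mul_of_nonneg_right ih (h0 _)
        have h2 : a j * (a 1 / a 0 * a (j + 1)) ≤ a j * a (j + 1 + 1) := by
          linarith [h1, mul_comm (a 1 / a 0 * a j) (a (j + 1)),
            show a j * (a 1 / a 0 * a (j + 1)) = a 1 / a 0 * a j * a (j + 1) by ring]
        exact le_of_mul_le_mul_left h2 h
  induction n with
  | zero => simp
  | succ n ih =>
    calc a 0 * (a 1 / a 0) ^ (n + 1) = a 1 / a 0 * (a 0 * (a 1 / a 0) ^ n) := by ring
      _ ≤ a 1 / a 0 * a n := by gcongr
      _ ≤ _ := step n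

lemma ou_mul_self (hμ : RotInv μ) {G : V → ℝ} (hG : BddMeas G) {r s : ℝ} (hr : r ^ 2 ≤ 1)
    (hs : s ^ 2 ≤ 1) :
    ∫ x, G x * ou μ (r * s) G x ∂μ = ∫ x, ou μ r G x * ou μ s G x ∂μ := by
  rw [ou_symm hμ hG (hG.ou μ s) hr]
  congr 1 with x
  rw [ou_ou hμ hG hr hs]

lemma ou_log_convex (hμ : RotInv μ) {G : V → ℝ} (hG : BddMeas G) {ρ : ℝ} (h0 : 0 < ρ)
    (h1 : ρ ≤ 1) (hV : 0 < ∫ x, G x ^ 2 ∂μ) {n : ℕ} (hn : 0 < n) :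
    (∫ x, G x ^ 2 ∂μ) *
        ((∫ x, G x * ou μ (ρ ^ (1 / n : ℝ)) G x ∂μ) / ∫ x, G x ^ 2 ∂μ) ^ n
      ≤ ∫ x, G x * ou μ ρ G x ∂μ := by
  set p : ℝ := ρ ^ (1 / (2 * n) : ℝ) with hp
  have hp0 : 0 ≤ p := by positivity
  have hp1 : p ≤ 1 := Real.rpow_le_one h0.le h1 (by positivity)
  have hpp : ∀ j : ℕ, (p ^ j) ^ 2 ≤ 1 := fun j => by
    rw [← pow_mul]; exact pow_le_one₀ hp0 hp1
  set a : ℕ → ℝ := fun j => ∫ x, G x * ou μ (p ^ (2 * j)) G x ∂μ with ha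
  have aj : ∀ i j k : ℕ, i + j = 2 * k → a k = ∫ x, ou μ (p ^ i) G x * ou μ (p ^ j) G x ∂μ := by
    intro i j k h
    rw [← ou_mul_self hμ hG (hpp i) (hpp j), ← pow_add, h]
  have a0 : ∀ j, 0 ≤ a j := fun j => by
    rw [aj j j j (by ring)]
    exact integral_nonneg fun x => mul_self_nonneg _
  have ac : ∀ j, a (j + 1) ^ 2 ≤ a j * a (j + 2) := fun j => by
    rw [aj j (j + 2) (j + 1) (by ring), aj j j j (by ring),
      aj (j + 2) (j + 2) (j + 2) (by ring)]
    simpa only [sq] using sq_integral_mul_le (hG.ou μ (p ^ j)) (hG.ou μ (p ^ (j + 2)))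
  have e0 : a 0 = ∫ x, G x ^ 2 ∂μ := by simp [ha, ou, sq]
  have hn' : (n : ℝ) ≠ 0 := by positivity
  have e1 : p ^ (2 * 1) = ρ ^ (1 / n : ℝ) := by
    rw [← Real.rpow_natCast, hp, ← Real.rpow_mul h0.le]
    congr 1; push_cast; field_simp
  have en : p ^ (2 * n) = ρ := by
    rw [← Real.rpow_natCast, hp, ← Real.rpow_mul h0.le]
    have : 1 / (2 * (n : ℝ)) * ((2 * n : ℕ) : ℝ) = 1 := by push_cast; field_simp
    rw [this, Real.rpow_one]
  have := pow_le_ratio a0 ac (by rw [e0]; exact hV) n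
  rw [e0] at this
  simpa only [ha, e1, en] using this

/-- If the energy of `G` at scale `q` is at most `B (1 - q²)` for `q` close to `1`, the
correlations `∫ G · P_ρ G` decay no faster than `exp (- 2 B log (1 / ρ) / Var)`. -/
lemma ou_lower (hμ : RotInv μ) {G : V → ℝ} (hG : BddMeas G) {ρ : ℝ} (h0 : 0 < ρ) (h1 : ρ ≤ 1)
    (hV : 0 < ∫ x, G x ^ 2 ∂μ) {B δ : ℝ} (hB : 0 ≤ B) (hδ : 0 < δ)
    (hE : ∀ q : ℝ, 0 ≤ q → q ≤ 1 → 1 - q ^ 2 ≤ δ →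
      ∫ x, G x ^ 2 ∂μ - ∫ x, G x * ou μ q G x ∂μ ≤ B * (1 - q ^ 2)) :
    (∫ x, G x ^ 2 ∂μ) * rexp (-(2 * B * log (1 / ρ) / ∫ x, G x ^ 2 ∂μ))
      ≤ ∫ x, G x * ou μ ρ G x ∂μ := by
  set W := ∫ x, G x ^ 2 ∂μ with hW
  set ℓ := log (1 / ρ) with hℓ
  have hℓ0 : 0 ≤ ℓ := Real.log_nonneg (by rw [le_div_iff₀ h0]; linarith)
  set t := -(2 * B * ℓ / W) with ht
  have lim : Filter.Tendsto (fun n : ℕ => W * (1 + t / n) ^ n) Filter.atTop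
      (nhds (W * rexp t)) := (Real.tendsto_one_add_div_pow_exp t).const_mul W
  refine le_of_tendsto lim ?_
  obtain ⟨N, hN⟩ := exists_nat_gt (max (-t) (2 * ℓ / δ))
  filter_upwards [Filter.eventually_ge_atTop (N + 1)] with n hn
  have hn0 : 0 < n := by omega
  have hn0' : (0 : ℝ) < n := by exact_mod_cast hn0
  have hNn : max (-t) (2 * ℓ / δ) < n := hN.trans_le (by exact_mod_cast (by omega : N ≤ n))
  have hnt : -t < n := (le_max_left _ _).trans_lt hNn
  have hnδ : 2 * ℓ / δ < n := (le_max_right _ _).trans_lt hNn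
  set q : ℝ := ρ ^ (1 / n : ℝ) with hq
  have hq0 : 0 ≤ q := by positivity
  have hq1 : q ≤ 1 := Real.rpow_le_one h0.le h1 (by positivity)
  have hσ : 1 - q ^ 2 ≤ 2 * ℓ / n := by
    have e : q ^ 2 = rexp (-(2 * ℓ / n)) := by
      rw [hq, Real.rpow_def_of_pos h0, ← Real.exp_nat_mul, hℓ, one_div ρ, Real.log_inv]
      congr 1; push_cast; ring
    rw [e]
    linarith [Real.add_one_le_exp (-(2 * ℓ / n))]
  have hb := hE q hq0 hq1 (hσ.trans (by
    rw [div_le_iff₀ hn0']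
    rw [div_lt_iff₀ hδ] at hnδ
    linarith))
  refine le_trans ?_ (ou_log_convex hμ hG h0 h1 hV hn0)
  have hle : 1 + t / n ≤ (∫ x, G x * ou μ q G x ∂μ) / W := by
    rw [le_div_iff₀ hV]
    have h3 : (1 + t / n) * W = W - B * (2 * ℓ / n) := by
      rw [ht]; field_simp; ring
    rw [h3]
    have : B * (1 - q ^ 2) ≤ B * (2 * ℓ / n) := by gcongr
    linarith
  have hpos : 0 ≤ 1 + t / n := by
    have : -1 ≤ t / n := by rw [le_div_iff₀ hn0']; linarith
    linarith
  gcongr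

end

section

variable {m : ℕ}

lemma sq_euclNorm (x : Fin m → ℝ) : euclNorm x ^ 2 = ∑ i, x i ^ 2 :=
  Real.sq_sqrt (Finset.sum_nonneg fun _ _ => sq_nonneg _)

lemma exists_norming (f : Seminorm ℝ (Fin m → ℝ)) (x : Fin m → ℝ) :
    ∃ a : Fin m → ℝ, (∀ z, ∑ i, a i * z i ≤ f z) ∧ ∑ i, a i * x i = f x := by
  have key : ∃ g : (Fin m → ℝ) →ₗ[ℝ] ℝ, g x = f x ∧ ∀ z, g z ≤ f z := by
    by_cases hx : x = 0
    · exact ⟨0, by simp [hx], fun z => apply_nonneg f z⟩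
    · let p : (Fin m → ℝ) →ₗ.[ℝ] ℝ := LinearPMap.mkSpanSingleton x (f x) hx
      obtain ⟨g, hg1, hg2⟩ := exists_extension_of_le_sublinear p f
        (fun c hc z => by rw [map_smul_eq_mul, Real.norm_of_nonneg hc.le])
        (fun y z => map_add_le_add f y z) (by
          rintro ⟨z, hz⟩
          have hz' : z ∈ Submodule.span ℝ {x} := hz
          obtain ⟨c, rfl⟩ := Submodule.mem_span_singleton.1 hz'
          have : p ⟨c • x, hz⟩ = c • f x := LinearPMap.mkSpanSingleton'_apply ..
          rw [this, map_smul_eq_mul, smul_eq_mul]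
          exact mul_le_mul_of_nonneg_right (le_abs_self c) (apply_nonneg f x))
      refine ⟨g, ?_, hg2⟩
      have hx' : x ∈ p.domain := Submodule.mem_span_singleton_self x
      exact (hg1 ⟨x, hx'⟩).trans (LinearPMap.mkSpanSingleton'_apply_self ..)
  obtain ⟨g, h1, h2⟩ := key
  have e : ∀ z, g z = ∑ i, g (Pi.single i 1) * z i := fun z => by
    conv_lhs => rw [LinearMap.pi_apply_eq_sum_univ g z]
    simp only [smul_eq_mul]
    refine Finset.sum_congr rfl fun i _ => ?_
    rw [mul_comm]
    congr 2
    ext j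
    simp [Pi.single_apply, eq_comm]
  exact ⟨fun i => g (Pi.single i 1), fun z => by rw [← e]; exact h2 z, by rw [← e, h1]⟩

lemma sum_sq_le_one {a : Fin m → ℝ} (h : ∀ z, ∑ i, a i * z i ≤ euclNorm z) : ∑ i, a i ^ 2 ≤ 1 := by
  have h1 := h a
  simp only [← sq, ← sq_euclNorm] at h1
  rw [← sq_euclNorm]
  nlinarith

lemma sum_abs_le {a : Fin m → ℝ} {f : Seminorm ℝ (Fin m → ℝ)} (h : ∀ z, ∑ i, a i * z i ≤ f z)
    {K : ℝ} (hK : ∀ z, f z ≤ K * ‖z‖) (hK0 : 0 ≤ K) : ∑ i, |a i| ≤ K := by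
  have h1 := (h fun i => SignType.sign (a i)).trans (hK _)
  have h2 : ‖fun i => ((SignType.sign (a i) : SignType) : ℝ)‖ ≤ 1 := by
    refine (pi_norm_le_iff_of_nonneg zero_le_one).2 fun i => ?_
    rcases lt_trichotomy (a i) 0 with h | h | h <;> simp [h, sign_pos]
  simp only [self_mul_sign] at h1
  nlinarith

lemma seminorm_continuous (f : Seminorm ℝ (Fin m → ℝ)) : Continuous f :=
  (ConvexOn.locallyLipschitz f.convexOn).continuous

lemma mgf_line (t : ℝ) : ∫ x, rexp (t * x) ∂gaussianReal 0 1 = rexp (t ^ 2 / 2) := by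
  have := congrFun (mgf_id_gaussianReal (μ := 0) (v := 1)) t
  simpa [mgf] using this

lemma integrable_exp_line (t : ℝ) : Integrable (fun x => rexp (t * x)) (gaussianReal 0 1) :=
  integrable_exp_mul_gaussianReal t

lemma integrable_exp_lin (a : Fin m → ℝ) :
    Integrable (fun z : Fin m → ℝ => rexp (∑ i, a i * z i)) (gauss m) := by
  simp_rw [Real.exp_sum]
  exact Integrable.fintype_prod (f := fun i x => rexp (a i * x)) fun i => integrable_exp_line _

lemma mgf_lin (a : Fin m → ℝ) :
    ∫ z, rexp (∑ i, a i * z i) ∂gauss m = rexp ((∑ i, a i ^ 2) / 2) := by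
  simp_rw [Real.exp_sum]
  rw [integral_fintype_prod_eq_prod (f := fun i x => rexp (a i * x)), Finset.sum_div, Real.exp_sum]
  simp_rw [mgf_line]

lemma exp_abs_lin_le (a z : Fin m → ℝ) (t : ℝ) :
    rexp (t * |∑ i, a i * z i|)
      ≤ rexp (∑ i, (t * a i) * z i) + rexp (∑ i, (-t * a i) * z i) := by
  have e1 : ∑ i, (t * a i) * z i = t * ∑ i, a i * z i := by
    rw [Finset.mul_sum]; exact Finset.sum_congr rfl fun _ _ => by ring
  have e2 : ∑ i, (-t * a i) * z i = -(t * ∑ i, a i * z i) := by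
    rw [Finset.mul_sum, ← Finset.sum_neg_distrib]; exact Finset.sum_congr rfl fun _ _ => by ring
  rw [e1, e2]
  rcases abs_cases (∑ i, a i * z i) with ⟨h, _⟩ | ⟨h, _⟩ <;> rw [h]
  · linarith [Real.exp_pos (-(t * ∑ i, a i * z i))]
  · rw [mul_neg]
    linarith [Real.exp_pos (t * ∑ i, a i * z i)]

lemma integrable_exp_abs_lin (a : Fin m → ℝ) (t : ℝ) :
    Integrable (fun z : Fin m → ℝ => rexp (t * |∑ i, a i * z i|)) (gauss m) := by
  refine Integrable.mono' ((integrable_exp_lin fun i => t * a i).add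
    (integrable_exp_lin fun i => -t * a i))
    (Continuous.aestronglyMeasurable (by fun_prop)) (.of_forall fun z => ?_)
  rw [Real.norm_of_nonneg (Real.exp_pos _).le]
  exact exp_abs_lin_le a z t

lemma mgf_abs_lin_le {a : Fin m → ℝ} (ha : ∑ i, a i ^ 2 ≤ 1) (t : ℝ) :
    ∫ z, rexp (t * |∑ i, a i * z i|) ∂gauss m ≤ 2 * rexp (t ^ 2 / 2) := by
  have h1 := MeasureTheory.integral_mono (integrable_exp_abs_lin a t)
    ((integrable_exp_lin fun i => t * a i).add (integrable_exp_lin fun i => -t * a i))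
    (fun z => exp_abs_lin_le a z t)
  refine h1.trans ?_
  simp only [Pi.add_apply]
  rw [integral_add (integrable_exp_lin _) (integrable_exp_lin _), mgf_lin, mgf_lin]
  have : rexp ((∑ i, (t * a i) ^ 2) / 2) ≤ rexp (t ^ 2 / 2) := by
    gcongr
    simp_rw [mul_pow]
    rw [← Finset.mul_sum]
    nlinarith [sq_nonneg t]
  simp only [neg_mul, neg_sq] at *
  linarith

/-- Truncation of a seminorm at level `R`. -/
noncomputable def trunc (f : Seminorm ℝ (Fin m → ℝ)) (R : ℝ) (x : Fin m → ℝ) : ℝ := min (f x) R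

variable {f : Seminorm ℝ (Fin m → ℝ)} {R : ℝ}

lemma trunc_nonneg (hR : 0 ≤ R) (x : Fin m → ℝ) : 0 ≤ trunc f R x := le_min (apply_nonneg f x) hR

lemma trunc_le (x : Fin m → ℝ) : trunc f R x ≤ R := min_le_right _ _

lemma continuous_trunc : Continuous (trunc f R) := (seminorm_continuous f).min continuous_const

@[fun_prop]
lemma measurable_trunc : Measurable (trunc f R) := continuous_trunc.measurable

lemma bddMeas_trunc (hR : 0 ≤ R) : BddMeas (trunc f R) :=
  ⟨measurable_trunc, R, fun x => by rw [abs_of_nonneg (trunc_nonneg hR x)]; exact trunc_le x⟩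

lemma trunc_sub_le (hR : 0 ≤ R) {x : Fin m → ℝ} {a : Fin m → ℝ} (ha : ∀ z, ∑ i, a i * z i ≤ f z)
    (hax : ∑ i, a i * x i = f x) {c s : ℝ} (hc0 : 0 ≤ c) (hc1 : c ≤ 1) (z : Fin m → ℝ) :
    trunc f R x - trunc f R (c • x + s • z) ≤ (1 - c) * R + |s| * |∑ i, a i * z i| := by
  have h1 := ha (c • x + s • z)
  have e : ∑ i, a i * (c • x + s • z) i = c * f x + s * ∑ i, a i * z i := by
    rw [← hax, Finset.mul_sum, Finset.mul_sum, ← Finset.sum_add_distrib]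
    exact Finset.sum_congr rfl fun i _ => by simp; ring
  rw [e] at h1
  have h2 : -(|s| * |∑ i, a i * z i|) ≤ s * ∑ i, a i * z i := by
    rw [← abs_mul]; exact neg_abs_le _
  have h3 : 0 ≤ |s| * |∑ i, a i * z i| := by positivity
  have h4 : trunc f R x ≤ f x := min_le_left _ _
  have h5 : trunc f R x ≤ R := trunc_le x
  rcases min_cases (f (c • x + s • z)) R with ⟨h, _⟩ | ⟨h, _⟩
  · have : trunc f R (c • x + s • z) = f (c • x + s • z) := h
    rw [this]
    nlinarith
  · have : trunc f R (c • x + s • z) = R := h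
    rw [this]
    nlinarith

lemma sq_exp_sub_le {μ a b D : ℝ} (hab : b ≤ a) (hD : a - b ≤ D) :
    (rexp (μ * a) - rexp (μ * b)) ^ 2 ≤ rexp (μ * a) ^ 2 * (μ ^ 2 * (D ^ 2 * rexp (2 * |μ| * D))) := by
  have hD0 : 0 ≤ D := by linarith
  have e : rexp (μ * a) - rexp (μ * b) = rexp (μ * a) * (1 - rexp (-(μ * (a - b)))) := by
    rw [mul_sub, mul_one, ← Real.exp_add]; congr 2; ring
  have h1 : |1 - rexp (-(μ * (a - b)))| ≤ |μ| * D * rexp (|μ| * D) := by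
    set t := μ * (a - b)
    have ht : |t| ≤ |μ| * D := by
      rw [abs_mul, abs_of_nonneg (by linarith : 0 ≤ a - b)]; gcongr
    have h2 : |1 - rexp (-t)| ≤ |t| * rexp |t| := by
      rw [abs_le]
      constructor
      · have := Real.add_one_le_exp t
        have h3 : rexp (-t) ≤ rexp |t| := Real.exp_le_exp.2 (neg_le_abs t)
        have h4 : rexp (-t) - 1 ≤ -t * rexp (-t) := by
          have h5 : rexp t * rexp (-t) = 1 := by rw [← Real.exp_add]; simp
          nlinarith [Real.exp_pos (-t)]
        have h6 : -t * rexp (-t) ≤ |t| * rexp |t| :=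
          mul_le_mul (neg_le_abs t) h3 (Real.exp_pos _).le (abs_nonneg _)
        linarith
      · have := Real.add_one_le_exp (-t)
        have h7 : |t| * 1 ≤ |t| * rexp |t| := by
          gcongr; exact Real.one_le_exp (abs_nonneg _)
        linarith [le_abs_self t]
    refine h2.trans ?_
    gcongr
  rw [e, mul_pow]
  gcongr
  rw [← sq_abs (1 - _)]
  calc |1 - rexp (-(μ * (a - b)))| ^ 2 ≤ (|μ| * D * rexp (|μ| * D)) ^ 2 := by gcongr
    _ = |μ| ^ 2 * (D ^ 2 * (rexp (|μ| * D)) ^ 2) := by ring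
    _ = _ := by rw [sq_abs, ← Real.exp_nat_mul]; congr 3; push_cast; ring_nf

end

section

variable {m : ℕ} {f : Seminorm ℝ (Fin m → ℝ)} {R : ℝ}

lemma bddMeas_exp_trunc (hR : 0 ≤ R) (μ : ℝ) : BddMeas (fun x => rexp (μ * trunc f R x)) :=
  ((BddMeas.const μ).mul (bddMeas_trunc hR)).exp

lemma integrable_of_le {α : Type*} [MeasurableSpace α] {μ : Measure α} {u v : α → ℝ}
    (hv : Integrable v μ) (hu : Measurable u) (h0 : ∀ x, 0 ≤ u x) (h : ∀ x, u x ≤ v x) :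
    Integrable u μ :=
  hv.mono' hu.aestronglyMeasurable (.of_forall fun x => by rw [Real.norm_of_nonneg (h0 x)]; exact h x)

lemma energy_le (hf : ∀ x, f x ≤ euclNorm x) (hR : 0 ≤ R) {μ q : ℝ} (hq0 : 0 ≤ q) (hq1 : q ≤ 1)
    (h1 : √(1 - q ^ 2) * R ≤ 1) (h2 : |μ| * √(1 - q ^ 2) ≤ 1 / 4) :
    ∫ p : (Fin m → ℝ) × (Fin m → ℝ), (rexp (μ * trunc f R p.1)
        - rexp (μ * trunc f R (q • p.1 + √(1 - q ^ 2) • p.2))) ^ 2 ∂((gauss m).prod (gauss m))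
      ≤ 4 * rexp (11 / 2) * (μ ^ 2 * ∫ x, rexp (μ * trunc f R x) ^ 2 ∂gauss m) * (1 - q ^ 2) := by
  have hq2 : q ^ 2 ≤ 1 := pow_le_one₀ hq0 hq1
  have hσ2 : √(1 - q ^ 2) ^ 2 = 1 - q ^ 2 := Real.sq_sqrt (by linarith)
  have hs : q ^ 2 + √(1 - q ^ 2) ^ 2 = 1 := by rw [hσ2]; ring
  have hσ0 : 0 ≤ √(1 - q ^ 2) := Real.sqrt_nonneg _
  set σ := √(1 - q ^ 2) with hσ
  set F : (Fin m → ℝ) → ℝ := fun x => rexp (μ * trunc f R x) with hF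
  have bF : BddMeas F := bddMeas_exp_trunc hR μ
  set A : (Fin m → ℝ) × (Fin m → ℝ) → ℝ := fun p => (F p.1 - F (q • p.1 + σ • p.2)) ^ 2 with hA
  have bA : BddMeas A :=
    ((bF.comp (g := fun p : (Fin m → ℝ) × (Fin m → ℝ) => p.1) (by fun_prop)).sub
      (bF.comp (by fun_prop))).pow 2
  have hA0 : ∀ p, 0 ≤ A p := fun p => sq_nonneg _
  set B : (Fin m → ℝ) × (Fin m → ℝ) → ℝ := fun p =>
    if trunc f R (q • p.1 + σ • p.2) ≤ trunc f R p.1 then A p else 0 with hB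
  have hBA : ∀ p, B p ≤ A p := fun p => by
    simp only [hB]; split_ifs <;> [exact le_rfl; exact hA0 p]
  have hB0 : ∀ p, 0 ≤ B p := fun p => by
    simp only [hB]; split_ifs <;> [exact hA0 p; exact le_rfl]
  have bB : BddMeas B := by
    refine ⟨Measurable.ite (measurableSet_le (by fun_prop) (by fun_prop)) bA.1 measurable_const,
      bA.2.choose, fun p => ?_⟩
    rw [abs_of_nonneg (hB0 p)]
    exact (hBA p).trans ((le_abs_self _).trans (bA.2.choose_spec p))
  have step1 : ∫ p, A p ∂((gauss m).prod (gauss m)) ≤ 2 * ∫ p, B p ∂((gauss m).prod (gauss m)) := by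
    have e := rotInv_gauss.integral_comp hs bB.measurable
    have bB' : BddMeas (fun p : (Fin m → ℝ) × (Fin m → ℝ) =>
        B (q • p.1 + σ • p.2, σ • p.1 - q • p.2)) := bB.comp (by fun_prop)
    have : ∫ p, A p ∂((gauss m).prod (gauss m)) ≤ ∫ p, (B p
        + B (q • p.1 + σ • p.2, σ • p.1 - q • p.2)) ∂((gauss m).prod (gauss m)) := by
      refine bA.integral_mono (bB.add bB') fun p => ?_
      have e3 : q • (q • p.1 + σ • p.2) + σ • (σ • p.1 - q • p.2) = p.1 := by
        have : q • (q • p.1 + σ • p.2) + σ • (σ • p.1 - q • p.2) = (q ^ 2 + σ ^ 2) • p.1 := by module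
        rw [this, hs, one_smul]
      have eA : A (q • p.1 + σ • p.2, σ • p.1 - q • p.2) = A p := by
        simp only [hA, e3]; ring
      simp only [hB, e3, eA]
      have := hA0 p
      split_ifs with i1 i2 i2 <;> linarith
    rw [integral_add (bB.integrable _) (bB'.integrable _), e] at this
    linarith
  have step2 : ∫ p, B p ∂((gauss m).prod (gauss m))
      ≤ ∫ x, F x ^ 2 * (μ ^ 2 * ((1 - q ^ 2) * (2 * rexp (11 / 2)))) ∂gauss m := by
    rw [integral_prod _ (bB.integrable _)]
    refine (BddMeas.integral_right (w := fun x y => B (x, y)) bB _).integral_mono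
      ((bF.pow 2).mul (BddMeas.const _)) fun x => ?_
    obtain ⟨a, ha, hax⟩ := exists_norming f x
    have ha1 : ∑ i, a i ^ 2 ≤ 1 := sum_sq_le_one fun z => (ha z).trans (hf z)
    have pt : ∀ z, B (x, z) ≤ F x ^ 2 * (μ ^ 2 * ((1 - q ^ 2) * (rexp 1 * rexp (3 * |∑ i, a i * z i|)))) := by
      intro z
      have hp : 0 ≤ 1 - q ^ 2 := by linarith
      simp only [hB]
      split_ifs with i1
      · set t := |∑ i, a i * z i| with ht
        have ht0 : 0 ≤ t := abs_nonneg _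
        have hD := trunc_sub_le hR ha hax hq0 hq1 (s := σ) z
        rw [abs_of_nonneg hσ0, ← ht] at hD
        have hD' : trunc f R x - trunc f R (q • x + σ • z) ≤ σ * (1 + t) := by
          have : (1 - q) * R ≤ σ * (σ * R) := by
            rw [← mul_assoc, ← sq, hσ2]; gcongr; nlinarith
          have : σ * (σ * R) ≤ σ * 1 := by gcongr
          linarith
        refine (sq_exp_sub_le (μ := μ) i1 hD').trans ?_
        refine mul_le_mul_of_nonneg_left (mul_le_mul_of_nonneg_left ?_ (sq_nonneg _)) (sq_nonneg _)
        have hσt : (σ * (1 + t)) ^ 2 = (1 - q ^ 2) * (1 + t) ^ 2 := by rw [mul_pow, hσ2]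
        rw [hσt, mul_assoc]
        refine mul_le_mul_of_nonneg_left ?_ hp
        rw [← Real.exp_add]
        have i2 : (1 + t) ^ 2 ≤ rexp (2 * t) := by
          have : 1 + t ≤ rexp t := by linarith [Real.add_one_le_exp t]
          calc (1 + t) ^ 2 ≤ rexp t ^ 2 := by gcongr
            _ = _ := by rw [← Real.exp_nat_mul]; norm_num
        have i3 : rexp (2 * |μ| * (σ * (1 + t))) ≤ rexp ((1 + t) / 2) := by
          gcongr
          nlinarith
        calc (1 + t) ^ 2 * rexp (2 * |μ| * (σ * (1 + t)))
            ≤ rexp (2 * t) * rexp ((1 + t) / 2) := by gcongr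
          _ = rexp (2 * t + (1 + t) / 2) := by rw [Real.exp_add]
          _ ≤ rexp (1 + 3 * t) := Real.exp_le_exp.2 (by linarith)
      · positivity
    calc ∫ z, B (x, z) ∂gauss m
        ≤ ∫ z, F x ^ 2 * (μ ^ 2 * ((1 - q ^ 2) * (rexp 1 * rexp (3 * |∑ i, a i * z i|)))) ∂gauss m :=
          MeasureTheory.integral_mono ((bB.comp (g := fun z => (x, z)) (by fun_prop)).integrable _)
            (((((integrable_exp_abs_lin a 3).const_mul _).const_mul _).const_mul _).const_mul _) pt
      _ = F x ^ 2 * (μ ^ 2 * ((1 - q ^ 2) * (rexp 1 * ∫ z, rexp (3 * |∑ i, a i * z i|) ∂gauss m))) := by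
          simp only [integral_const_mul]
      _ ≤ F x ^ 2 * (μ ^ 2 * ((1 - q ^ 2) * (rexp 1 * (2 * rexp (3 ^ 2 / 2))))) := by
          have hp : 0 ≤ 1 - q ^ 2 := by linarith
          gcongr
          exact mgf_abs_lin_le ha1 3
      _ = _ := by
          have : rexp (11 / 2) = rexp 1 * rexp (3 ^ 2 / 2) := by rw [← Real.exp_add]; norm_num
          rw [this]; ring
  rw [integral_mul_const] at step2
  calc ∫ p, A p ∂((gauss m).prod (gauss m)) ≤ _ := step1
    _ ≤ _ := mul_le_mul_of_nonneg_left step2 zero_le_two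
    _ = _ := by ring

/-- A lower bound for the correlation of `exp (μ ψ)` with its smoothing. -/
theorem exp_trunc_lower (hf : ∀ x, f x ≤ euclNorm x) (hR : 0 ≤ R) (μ : ℝ) {ρ : ℝ} (h0 : 0 < ρ)
    (h1 : ρ ≤ 1)
    (hV : 0 < ∫ x, rexp (μ * trunc f R x) ^ 2 ∂gauss m - (∫ x, rexp (μ * trunc f R x) ∂gauss m) ^ 2) :
    (∫ x, rexp (μ * trunc f R x) ^ 2 ∂gauss m - (∫ x, rexp (μ * trunc f R x) ∂gauss m) ^ 2)
      * rexp (-(4 * rexp (11 / 2) * log (1 / ρ) * (μ ^ 2 * ∫ x, rexp (μ * trunc f R x) ^ 2 ∂gauss m)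
        / (∫ x, rexp (μ * trunc f R x) ^ 2 ∂gauss m - (∫ x, rexp (μ * trunc f R x) ∂gauss m) ^ 2)))
      ≤ ∫ x, rexp (μ * trunc f R x) * ou (gauss m) ρ (fun x => rexp (μ * trunc f R x)) x ∂gauss m
        - (∫ x, rexp (μ * trunc f R x) ∂gauss m) ^ 2 := by
  set F : (Fin m → ℝ) → ℝ := fun x => rexp (μ * trunc f R x) with hF
  have bF : BddMeas F := bddMeas_exp_trunc hR μ
  set E := ∫ x, F x ∂gauss m with hE
  set G : (Fin m → ℝ) → ℝ := fun x => F x - E with hG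
  have bG : BddMeas G := bF.sub (BddMeas.const _)
  have eG : ∫ x, G x ^ 2 ∂gauss m = ∫ x, F x ^ 2 ∂gauss m - E ^ 2 := by
    have : ∀ x, G x ^ 2 = F x ^ 2 - (2 * E) * F x + E ^ 2 := fun x => by simp only [hG]; ring
    simp_rw [this]
    rw [integral_add (((bF.pow 2).sub ((BddMeas.const _).mul bF)).integrable _)
      (integrable_const _), integral_sub ((bF.pow 2).integrable _)
      (((BddMeas.const _).mul bF).integrable _), integral_const_mul, ← hE]
    simp; ring
  have ouG : ∀ r x, ou (gauss m) r G x = ou (gauss m) r F x - E := fun r x => by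
    unfold ou
    simp only [hG]
    rw [integral_sub ((bF.comp (by fun_prop)).integrable _) (integrable_const _)]
    simp
  have eGo : ∫ x, G x * ou (gauss m) ρ G x ∂gauss m
      = ∫ x, F x * ou (gauss m) ρ F x ∂gauss m - E ^ 2 := by
    have : ∀ x, G x * ou (gauss m) ρ G x = F x * ou (gauss m) ρ F x - E * F x
        - (E * ou (gauss m) ρ F x - E ^ 2) := fun x => by
      rw [ouG]; simp only [hG]; ring
    simp_rw [this]
    have b1 := bF.mul (bF.ou (gauss m) ρ)
    have b2 := (BddMeas.const E).mul bF
    have b3 := (BddMeas.const E).mul (bF.ou (gauss m) ρ)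
    rw [integral_sub ((b1.sub b2).integrable _) ((b3.sub (BddMeas.const _)).integrable _),
      integral_sub (b1.integrable _) (b2.integrable _),
      integral_sub (b3.integrable _) (integrable_const _), integral_const_mul, integral_const_mul,
      integral_ou rotInv_gauss bF (by nlinarith), ← hE]
    simp; ring
  have := ou_lower rotInv_gauss bG h0 h1 (by rw [eG]; exact hV)
    (B := 2 * rexp (11 / 2) * (μ ^ 2 * ∫ x, F x ^ 2 ∂gauss m)) (δ := 1 / (1 + R ^ 2 + 16 * μ ^ 2))
    (mul_nonneg (by positivity) (mul_nonneg (sq_nonneg _) (integral_nonneg fun _ => sq_nonneg _)))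
    (by positivity) (by
      intro q hq0 hq1 hδ
      have hq2 : q ^ 2 ≤ 1 := pow_le_one₀ hq0 hq1
      rw [le_div_iff₀ (by positivity)] at hδ
      have hσ2 : √(1 - q ^ 2) ^ 2 = 1 - q ^ 2 := Real.sq_sqrt (by linarith)
      have hσ0 : 0 ≤ √(1 - q ^ 2) := Real.sqrt_nonneg _
      have key := energy_le hf hR (μ := μ) hq0 hq1
        (by
          refine (abs_le_of_sq_le_sq (a := √(1 - q ^ 2) * R) (b := 1) ?_ zero_le_one) |> (le_abs_self _).trans
          rw [mul_pow, hσ2]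
          nlinarith [mul_nonneg (sub_nonneg.2 hq2) (sq_nonneg μ)])
        (by
          refine (abs_le_of_sq_le_sq (a := |μ| * √(1 - q ^ 2)) (b := 1 / 4) ?_ (by norm_num))
            |> (le_abs_self _).trans
          rw [mul_pow, hσ2, sq_abs]
          nlinarith [mul_nonneg (sub_nonneg.2 hq2) (sq_nonneg R)])
      rw [ou_energy rotInv_gauss bG hq2]
      have e : ∀ p : (Fin m → ℝ) × (Fin m → ℝ), G p.1 - G (q • p.1 + √(1 - q ^ 2) • p.2)
          = F p.1 - F (q • p.1 + √(1 - q ^ 2) • p.2) := fun p => by simp only [hG]; ring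
      simp_rw [e]
      linarith [key])
  rw [eG, eGo] at this
  refine le_trans (le_of_eq ?_) this
  congr 3
  ring

end

section

variable {m : ℕ}

lemma integral_prod_swap_coord (i : Fin m) {h : (Fin m → ℝ) × ℝ → ℝ} (hh : BddMeas h) :
    ∫ p, h (Function.update p.1 i p.2, p.1 i) ∂((gauss m).prod (gaussianReal 0 1))
      = ∫ p, h p ∂((gauss m).prod (gaussianReal 0 1)) := by
  have mt : Measurable (fun x : Fin (m + 1) → ℝ => Fin.tail x) := by unfold Fin.tail; fun_prop
  have key : ∀ {g : (Fin m → ℝ) × ℝ → ℝ}, BddMeas g →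
      ∫ p, g p ∂((gauss m).prod (gaussianReal 0 1)) = ∫ z, g (Fin.tail z, z 0) ∂gauss (m + 1) := by
    intro g hg
    rw [integral_cons (hg.comp (mt.prodMk (measurable_pi_apply 0))), integral_prod _ (hg.integrable _),
      integral_swap_of_bdd (w := fun x y => g (x, y)) hg]
    simp
  let E := MeasurableEquiv.piCongrLeft (fun _ : Fin (m + 1) => ℝ) (Equiv.swap 0 i.succ)
  have hσ : MeasurePreserving E (gauss (m + 1)) (gauss (m + 1)) :=
    measurePreserving_piCongrLeft (fun _ : Fin (m + 1) => gaussianReal 0 1) (Equiv.swap 0 i.succ)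
  have e : ∀ z j, E z j = z (Equiv.swap 0 i.succ j) := by
    intro z j
    have := MeasurableEquiv.piCongrLeft_apply_apply (β := fun _ : Fin (m + 1) => ℝ)
      (Equiv.swap 0 i.succ) z (Equiv.swap 0 i.succ j)
    rwa [Equiv.swap_apply_self] at this
  rw [key hh, key (hh.comp (by fun_prop)), ← hσ.integral_comp']
  congr 1 with z
  congr 1
  refine Prod.ext ?_ ?_
  · funext j
    by_cases hj : j = i
    · subst hj; simp [Fin.tail, e]
    · change Function.update (Fin.tail (E z)) i (E z 0) j = z j.succ
      rw [Function.update_of_ne hj]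
      change E z j.succ = _
      rw [e, Equiv.swap_apply_of_ne_of_ne (Fin.succ_ne_zero _)
        (fun h => hj (Fin.succ_injective _ h))]
  · simp [e, Fin.tail]

lemma integral_mul_le_of_integrable_rpow {α : Type*} [MeasurableSpace α] {μ : Measure α}
    {u v : α → ℝ} (hu : Measurable u) (hv : Measurable v) (hu0 : ∀ x, 0 ≤ u x)
    (hv0 : ∀ x, 0 ≤ v x) {p q : ℝ} (hpq : p.HolderConjugate q)
    (hup : Integrable (fun x => u x ^ p) μ) (hvq : Integrable (fun x => v x ^ q) μ) :
    ∫ x, u x * v x ∂μ ≤ (∫ x, u x ^ p ∂μ) ^ (1 / p) * (∫ x, v x ^ q ∂μ) ^ (1 / q) := by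
  have key : ∀ {u : α → ℝ} {p : ℝ}, Measurable u → (∀ x, 0 ≤ u x) → 0 < p →
      Integrable (fun x => u x ^ p) μ → MemLp u (ENNReal.ofReal p) μ := by
    intro u p hu hu0 hp hup
    rw [← integrable_norm_rpow_iff hu.aestronglyMeasurable (by simpa using hp) ENNReal.ofReal_ne_top,
      ENNReal.toReal_ofReal hp.le]
    simpa only [Real.norm_of_nonneg (hu0 _)] using hup
  exact integral_mul_le_Lp_mul_Lq_of_nonneg hpq (.of_forall hu0) (.of_forall hv0)
    (key hu hu0 hpq.pos hup) (key hv hv0 hpq.symm.pos hvq)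

lemma exp_abs_sub_le (t x y : ℝ) :
    rexp (t * |x - y|) ≤ rexp (t * x) * rexp (-t * y) + rexp (-t * x) * rexp (t * y) := by
  rw [← Real.exp_add, ← Real.exp_add]
  rcases abs_cases (x - y) with ⟨h, _⟩ | ⟨h, _⟩ <;> rw [h]
  · have : t * (x - y) = t * x + -t * y := by ring
    rw [this]
    linarith [Real.exp_pos (-t * x + t * y)]
  · have : t * -(x - y) = -t * x + t * y := by ring
    rw [this]
    linarith [Real.exp_pos (t * x + -t * y)]

lemma coord_eq (i : Fin m) (t : ℝ) (x : Fin m → ℝ) :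
    t * x i = ∑ j, (Pi.single i t : Fin m → ℝ) j * x j := by
  simp [Pi.single_apply]

lemma integrable_exp_coord (i : Fin m) (t : ℝ) :
    Integrable (fun x : Fin m → ℝ => rexp (t * x i)) (gauss m) :=
  (integrable_exp_lin (Pi.single i t)).congr (.of_forall fun x => by simp only [← coord_eq])

lemma mgf_coord (i : Fin m) (t : ℝ) :
    ∫ x : Fin m → ℝ, rexp (t * x i) ∂gauss m = rexp (t ^ 2 / 2) := by
  have e : (fun x : Fin m → ℝ => rexp (t * x i))
      = fun x => rexp (∑ j, (Pi.single i t : Fin m → ℝ) j * x j) := by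
    funext x; rw [← coord_eq]
  rw [e, mgf_lin]
  simp [Pi.single_apply, ite_pow]

lemma integrable_exp_abs_sub (i : Fin m) (t : ℝ) :
    Integrable (fun p : (Fin m → ℝ) × ℝ => rexp (t * |p.1 i - p.2|))
      ((gauss m).prod (gaussianReal 0 1)) :=
  integrable_of_le (((integrable_exp_coord i t).mul_prod (integrable_exp_line (-t))).add
    ((integrable_exp_coord i (-t)).mul_prod (integrable_exp_line t)))
    (by fun_prop) (fun _ => (Real.exp_pos _).le) fun p => exp_abs_sub_le _ _ _

lemma integral_exp_abs_sub_le (i : Fin m) (t : ℝ) :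
    ∫ p : (Fin m → ℝ) × ℝ, rexp (t * |p.1 i - p.2|) ∂((gauss m).prod (gaussianReal 0 1))
      ≤ 2 * rexp (t ^ 2) := by
  have j1 := (integrable_exp_coord i t).mul_prod (integrable_exp_line (-t))
  have j2 := (integrable_exp_coord i (-t)).mul_prod (integrable_exp_line t)
  refine (MeasureTheory.integral_mono (integrable_exp_abs_sub i t) (j1.add j2)
    fun p => exp_abs_sub_le _ _ _).trans ?_
  simp only [Pi.add_apply]
  rw [integral_add j1 j2, integral_prod_mul (fun x : Fin m → ℝ => rexp (t * x i))
    (fun y => rexp (-t * y)), integral_prod_mul (fun x : Fin m → ℝ => rexp (-t * x i))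
    (fun y => rexp (t * y)), mgf_coord, mgf_coord, mgf_line, mgf_line]
  simp only [neg_sq, ← Real.exp_add]
  ring_nf
  exact le_rfl

end

section

variable {m : ℕ} {f : Seminorm ℝ (Fin m → ℝ)} {R : ℝ}

/-- Positive part of the decrease of the truncated seminorm when coordinate `i` of `p.1` is
replaced by `p.2`. -/
noncomputable def updDrop (f : Seminorm ℝ (Fin m → ℝ)) (R : ℝ) (i : Fin m)
    (p : (Fin m → ℝ) × ℝ) : ℝ :=
  max (trunc f R p.1 - trunc f R (Function.update p.1 i p.2)) 0

lemma updDrop_nonneg (i : Fin m) (p : (Fin m → ℝ) × ℝ) : 0 ≤ updDrop f R i p := le_max_right _ _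

lemma updDrop_le (hR : 0 ≤ R) (i : Fin m) (p : (Fin m → ℝ) × ℝ) : updDrop f R i p ≤ R :=
  max_le ((sub_le_self _ (trunc_nonneg hR _)).trans (trunc_le _)) hR

lemma updDrop_le_abs (i : Fin m) (p : (Fin m → ℝ) × ℝ) :
    updDrop f R i p ≤ |trunc f R p.1 - trunc f R (Function.update p.1 i p.2)| :=
  max_le (le_abs_self _) (abs_nonneg _)

@[fun_prop]
lemma measurable_updDrop (i : Fin m) : Measurable (updDrop f R i) := by
  unfold updDrop; fun_prop

lemma bddMeas_updDrop (hR : 0 ≤ R) (i : Fin m) : BddMeas (updDrop f R i) :=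
  ⟨measurable_updDrop i, R, fun p => by
    rw [abs_of_nonneg (updDrop_nonneg i p)]; exact updDrop_le hR i p⟩

lemma updDrop_le_mul (hR : 0 ≤ R) (i : Fin m) (p : (Fin m → ℝ) × ℝ) {a : Fin m → ℝ}
    (ha : ∀ z, ∑ i, a i * z i ≤ f z) (hax : ∑ i, a i * p.1 i = f p.1) :
    updDrop f R i p ≤ |a i| * |p.1 i - p.2| := by
  refine max_le ?_ (by positivity)
  have h := trunc_sub_le hR ha hax zero_le_one le_rfl (s := 1) (Pi.single i (p.2 - p.1 i))
  have e : (1 : ℝ) • p.1 + (1 : ℝ) • (Pi.single i (p.2 - p.1 i) : Fin m → ℝ)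
      = Function.update p.1 i p.2 := by
    funext j
    by_cases hj : j = i
    · subst hj; simp
    · simp [hj]
  have e2 : ∑ j, a j * (Pi.single i (p.2 - p.1 i) : Fin m → ℝ) j = a i * (p.2 - p.1 i) := by
    simp [Pi.single_apply]
  rw [e, e2, abs_mul, abs_sub_comm p.2] at h
  simpa using h

lemma abs_le_one_of_norming (hf : ∀ x, f x ≤ euclNorm x) {a : Fin m → ℝ}
    (ha : ∀ z, ∑ i, a i * z i ≤ f z) (i : Fin m) : |a i| ≤ 1 := by
  have h := sum_sq_le_one fun z => (ha z).trans (hf z)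
  have h2 := Finset.single_le_sum (f := fun i => a i ^ 2) (fun j _ => sq_nonneg _)
    (Finset.mem_univ i)
  exact (sq_le_one_iff_abs_le_one _).1 (h2.trans h)

lemma updDrop_le_dist (hf : ∀ x, f x ≤ euclNorm x) (hR : 0 ≤ R) (i : Fin m)
    (p : (Fin m → ℝ) × ℝ) : updDrop f R i p ≤ |p.1 i - p.2| := by
  obtain ⟨a, ha, hax⟩ := exists_norming f p.1
  refine (updDrop_le_mul hR i p ha hax).trans ?_
  nlinarith [abs_le_one_of_norming hf ha i, abs_nonneg (p.1 i - p.2)]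

lemma updDrop_div_le (hR : 0 ≤ R) (i : Fin m) (p : (Fin m → ℝ) × ℝ) {a : Fin m → ℝ}
    (ha : ∀ z, ∑ i, a i * z i ≤ f z) (hax : ∑ i, a i * p.1 i = f p.1) :
    updDrop f R i p / |p.1 i - p.2| ≤ |a i| :=
  div_le_of_le_mul₀ (abs_nonneg _) (abs_nonneg _) (updDrop_le_mul hR i p ha hax)

lemma sq_mul_sq_le {D w : ℝ} (hD : 0 ≤ D) (hDw : D ≤ w) :
    D ^ 2 * w ^ 2 ≤ √D * (71 * rexp (w / 2)) := by
  have hw : 0 ≤ w := hD.trans hDw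
  have h1 := Real.pow_div_factorial_le_exp w hw 7
  have h2 : w ^ 7 ≤ 5040 * rexp w := by
    have : ((Nat.factorial 7 : ℕ) : ℝ) = 5040 := by norm_num [Nat.factorial]
    rw [this, div_le_iff₀ (by norm_num)] at h1
    linarith
  refine le_of_sq_le_sq ?_ (by positivity)
  have h3 : rexp (w / 2) ^ 2 = rexp w := by rw [← Real.exp_nat_mul]; congr 1; push_cast; ring
  calc (D ^ 2 * w ^ 2) ^ 2 = D * (D ^ 3 * w ^ 4) := by ring
    _ ≤ D * (w ^ 3 * w ^ 4) := by gcongr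
    _ = D * w ^ 7 := by ring
    _ ≤ D * (5041 * rexp w) := by gcongr; linarith [Real.exp_pos w]
    _ = (√D * (71 * rexp (w / 2))) ^ 2 := by
        rw [mul_pow, mul_pow, h3, Real.sq_sqrt hD]; ring

lemma rpow_two_thirds_aux {x : ℝ} (hx : 0 ≤ x) : (x ^ (2 / 3 : ℝ)) ^ (3 / 2 : ℝ) = x := by
  rw [← Real.rpow_mul hx]; norm_num

lemma rpow_two_thirds_cube {x : ℝ} (hx : 0 ≤ x) : (x ^ (2 / 3 : ℝ)) ^ (3 : ℝ) = x ^ 2 := by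
  rw [← Real.rpow_mul hx]; norm_num

lemma integral_updDrop_le (hR : 0 ≤ R) {τ : ℝ} (i : Fin m)
    (hτ : ∫ x, ∫ y, |trunc f R x - trunc f R (Function.update x i y)| ∂gaussianReal 0 1 ∂gauss m ≤ τ) :
    ∫ p, updDrop f R i p ∂((gauss m).prod (gaussianReal 0 1)) ≤ τ := by
  have b : BddMeas (fun p : (Fin m → ℝ) × ℝ =>
      |trunc f R p.1 - trunc f R (Function.update p.1 i p.2)|) :=
    (((bddMeas_trunc hR).comp (g := fun p : (Fin m → ℝ) × ℝ => p.1) (by fun_prop)).sub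
      ((bddMeas_trunc hR).comp (by fun_prop))).abs
  refine ((bddMeas_updDrop hR i).integral_mono b fun p => updDrop_le_abs i p).trans ?_
  rw [integral_prod _ (b.integrable _)]
  exact hτ

lemma integral_weight_le (hf : ∀ x, f x ≤ euclNorm x) (hR : 0 ≤ R) (μ : ℝ) {τ : ℝ} (i : Fin m)
    (hτ : ∫ x, ∫ y, |trunc f R x - trunc f R (Function.update x i y)| ∂gaussianReal 0 1 ∂gauss m ≤ τ) :
    Integrable (fun p : (Fin m → ℝ) × ℝ => (μ ^ 2 * (updDrop f R i p * |p.1 i - p.2|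
        * rexp (2 * |μ| * updDrop f R i p))) ^ 2) ((gauss m).prod (gaussianReal 0 1)) ∧
    ∫ p : (Fin m → ℝ) × ℝ, (μ ^ 2 * (updDrop f R i p * |p.1 i - p.2|
        * rexp (2 * |μ| * updDrop f R i p))) ^ 2 ∂((gauss m).prod (gaussianReal 0 1))
      ≤ μ ^ 4 * √(τ * (10082 * rexp ((8 * |μ| + 1) ^ 2))) := by
  set D := updDrop f R i with hD
  have hD0 : ∀ p, 0 ≤ D p := updDrop_nonneg i
  have mD : Measurable D := measurable_updDrop i
  have bD : BddMeas D := bddMeas_updDrop hR i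
  set v : (Fin m → ℝ) × ℝ → ℝ := fun p => 71 * rexp ((4 * |μ| + 1 / 2) * |p.1 i - p.2|) with hv
  have ev : ∀ p, v p ^ (2 : ℝ) = 5041 * rexp ((8 * |μ| + 1) * |p.1 i - p.2|) := fun p => by
    simp only [hv]
    rw [Real.rpow_two, mul_pow, ← Real.exp_nat_mul]
    congr 1
    · norm_num
    · congr 1; push_cast; ring
  have eD : ∀ p, √(D p) ^ (2 : ℝ) = D p := fun p => by rw [Real.rpow_two, Real.sq_sqrt (hD0 p)]
  have pt : ∀ p : (Fin m → ℝ) × ℝ, (μ ^ 2 * (D p * |p.1 i - p.2| * rexp (2 * |μ| * D p))) ^ 2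
      ≤ μ ^ 4 * (√(D p) * v p) := fun p => by
    have h1 := sq_mul_sq_le (hD0 p) (updDrop_le_dist hf hR i p)
    have h2 : rexp (2 * |μ| * D p) ^ 2 ≤ rexp (4 * |μ| * |p.1 i - p.2|) := by
      rw [← Real.exp_nat_mul]
      apply Real.exp_le_exp.2
      have := updDrop_le_dist hf hR i p
      push_cast
      have := mul_le_mul_of_nonneg_left this (by positivity : 0 ≤ 4 * |μ|)
      linarith
    calc (μ ^ 2 * (D p * |p.1 i - p.2| * rexp (2 * |μ| * D p))) ^ 2
        = μ ^ 4 * ((D p ^ 2 * |p.1 i - p.2| ^ 2) * rexp (2 * |μ| * D p) ^ 2) := by ring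
      _ ≤ μ ^ 4 * ((√(D p) * (71 * rexp (|p.1 i - p.2| / 2))) * rexp (4 * |μ| * |p.1 i - p.2|)) := by
          have : 0 ≤ μ ^ 4 := by positivity
          gcongr
      _ = μ ^ 4 * (√(D p) * v p) := by
          simp only [hv]
          rw [mul_assoc, mul_assoc 71, ← Real.exp_add]
          congr 4
          ring_nf
  have iv2 : Integrable (fun p => v p ^ (2 : ℝ)) ((gauss m).prod (gaussianReal 0 1)) := by
    simp_rw [ev]; exact (integrable_exp_abs_sub i _).const_mul _
  have iD2 : Integrable (fun p => √(D p) ^ (2 : ℝ)) ((gauss m).prod (gaussianReal 0 1)) := by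
    simp_rw [eD]; exact bD.integrable _
  have iv : Integrable v ((gauss m).prod (gaussianReal 0 1)) :=
    (integrable_exp_abs_sub i _).const_mul _
  have bsD : BddMeas (fun p => √(D p)) := by
    simp_rw [Real.sqrt_eq_rpow]; exact bD.rpow hD0 (by norm_num)
  have iDv : Integrable (fun p => √(D p) * v p) ((gauss m).prod (gaussianReal 0 1)) :=
    iv.bdd_mul (c := bsD.2.choose) bsD.1.aestronglyMeasurable (.of_forall bsD.2.choose_spec)
  have mW : Measurable (fun p : (Fin m → ℝ) × ℝ =>
      (μ ^ 2 * (D p * |p.1 i - p.2| * rexp (2 * |μ| * D p))) ^ 2) := by fun_prop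
  have iW := integrable_of_le (iDv.const_mul (μ ^ 4)) mW (fun p => sq_nonneg _) pt
  refine ⟨iW, (MeasureTheory.integral_mono iW (iDv.const_mul (μ ^ 4)) pt).trans ?_⟩
  rw [integral_const_mul]
  gcongr
  have hCS := integral_mul_le_of_integrable_rpow bsD.1 (v := v) (by fun_prop)
    (fun p => Real.sqrt_nonneg _) (fun p => by positivity) Real.HolderConjugate.two_two iD2 iv2
  refine hCS.trans ?_
  simp_rw [ev, eD]
  rw [integral_const_mul, ← Real.sqrt_eq_rpow, ← Real.sqrt_eq_rpow, ← Real.sqrt_mul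
    (integral_nonneg hD0)]
  apply Real.sqrt_le_sqrt
  have h1 := integral_updDrop_le hR i hτ
  have h2 := integral_exp_abs_sub_le i (8 * |μ| + 1)
  have h3 : 0 ≤ ∫ p, D p ∂((gauss m).prod (gaussianReal 0 1)) := integral_nonneg hD0
  have h4 : 0 ≤ ∫ p : (Fin m → ℝ) × ℝ, rexp ((8 * |μ| + 1) * |p.1 i - p.2|)
    ∂((gauss m).prod (gaussianReal 0 1)) := integral_nonneg fun p => (Real.exp_pos _).le
  calc _ ≤ τ * (5041 * (2 * rexp ((8 * |μ| + 1) ^ 2))) := by gcongr; exact h3.trans h1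
    _ = _ := by ring

end

section

variable {m : ℕ} {f : Seminorm ℝ (Fin m → ℝ)} {R : ℝ}

lemma infl_exp_trunc_le (hR : 0 ≤ R) (μ : ℝ) (i : Fin m) :
    infl (fun x => rexp (μ * trunc f R x)) i
      ≤ 2 * ∫ p : (Fin m → ℝ) × ℝ, (rexp (μ * trunc f R p.1) ^ 2 * (μ ^ 2 * (updDrop f R i p ^ 2
          * rexp (2 * |μ| * updDrop f R i p)))) ^ (2 / 3 : ℝ)
          ∂((gauss m).prod (gaussianReal 0 1)) := by
  set F : (Fin m → ℝ) → ℝ := fun x => rexp (μ * trunc f R x) with hF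
  have bF : BddMeas F := bddMeas_exp_trunc hR μ
  set G : (Fin m → ℝ) × ℝ → ℝ := fun p => (F p.1 ^ 2 * (μ ^ 2 * (updDrop f R i p ^ 2
          * rexp (2 * |μ| * updDrop f R i p)))) ^ (2 / 3 : ℝ) with hG
  have bD : BddMeas (updDrop f R i) := bddMeas_updDrop hR i
  have bG : BddMeas G :=
    (((bF.comp (g := fun p : (Fin m → ℝ) × ℝ => p.1) (by fun_prop)).pow 2).mul
      ((BddMeas.const _).mul ((bD.pow 2).mul ((BddMeas.const _).mul bD).exp))).rpow
      (fun p => by positivity) (by norm_num)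
  have bG' : BddMeas (fun p : (Fin m → ℝ) × ℝ => G (Function.update p.1 i p.2, p.1 i)) :=
    bG.comp (by fun_prop)
  have bA : BddMeas (fun p : (Fin m → ℝ) × ℝ =>
      |F p.1 - F (Function.update p.1 i p.2)| ^ (4 / 3 : ℝ)) :=
    (((bF.comp (g := fun p : (Fin m → ℝ) × ℝ => p.1) (by fun_prop)).sub
      (bF.comp (by fun_prop))).abs).rpow (fun p => abs_nonneg _) (by norm_num)
  have key : ∀ x x' : Fin m → ℝ, trunc f R x' ≤ trunc f R x →
      |F x - F x'| ^ (4 / 3 : ℝ) ≤ (F x ^ 2 * (μ ^ 2 * ((max (trunc f R x - trunc f R x') 0) ^ 2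
          * rexp (2 * |μ| * (max (trunc f R x - trunc f R x') 0))))) ^ (2 / 3 : ℝ) := by
    intro x x' h
    have h1 := sq_exp_sub_le (μ := μ) h (le_max_left (trunc f R x - trunc f R x') 0)
    have : |F x - F x'| ^ (4 / 3 : ℝ) = ((F x - F x') ^ 2) ^ (2 / 3 : ℝ) := by
      rw [← sq_abs, ← Real.rpow_natCast, ← Real.rpow_mul (abs_nonneg _)]
      norm_num
    rw [this]
    exact Real.rpow_le_rpow (sq_nonneg _) h1 (by norm_num)
  have pt : ∀ p : (Fin m → ℝ) × ℝ, |F p.1 - F (Function.update p.1 i p.2)| ^ (4 / 3 : ℝ)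
      ≤ G p + G (Function.update p.1 i p.2, p.1 i) := by
    intro p
    have g0 : ∀ p, 0 ≤ G p := fun p => by positivity
    rcases le_total (trunc f R (Function.update p.1 i p.2)) (trunc f R p.1) with h | h
    · exact (key _ _ h).trans (le_add_of_nonneg_right (g0 _))
    · have := key _ _ h
      rw [abs_sub_comm]
      refine le_trans ?_ (le_add_of_nonneg_left (g0 _))
      simpa only [hG, updDrop, Function.update_idem, Function.update_eq_self] using this
  have e : infl F i = ∫ p : (Fin m → ℝ) × ℝ, |F p.1 - F (Function.update p.1 i p.2)| ^ (4 / 3 : ℝ)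
      ∂((gauss m).prod (gaussianReal 0 1)) := by
    rw [integral_prod _ (bA.integrable _)]; rfl
  rw [e]
  refine (bA.integral_mono (bG.add bG') pt).trans ?_
  rw [integral_add (bG.integrable _) (bG'.integrable _), integral_prod_swap_coord i bG]
  linarith

lemma bddMeas_quot (hf : ∀ x, f x ≤ euclNorm x) (hR : 0 ≤ R) (i : Fin m) :
    BddMeas (fun p : (Fin m → ℝ) × ℝ => updDrop f R i p / |p.1 i - p.2|) := by
  refine ⟨by fun_prop, 1, fun p => ?_⟩
  obtain ⟨a, ha, hax⟩ := exists_norming f p.1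
  rw [abs_of_nonneg (div_nonneg (updDrop_nonneg i p) (abs_nonneg _))]
  exact (updDrop_div_le hR i p ha hax).trans (abs_le_one_of_norming hf ha i)

lemma infl_rpow_le (hf : ∀ x, f x ≤ euclNorm x) (hR : 0 ≤ R) (μ : ℝ) {τ : ℝ} (i : Fin m)
    (hτ : ∫ x, ∫ y, |trunc f R x - trunc f R (Function.update x i y)| ∂gaussianReal 0 1 ∂gauss m ≤ τ) :
    infl (fun x => rexp (μ * trunc f R x)) i ^ (3 / 2 : ℝ)
      ≤ 3 * μ ^ 2 * √√(τ * (10082 * rexp ((8 * |μ| + 1) ^ 2)))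
        * ∫ p : (Fin m → ℝ) × ℝ, rexp (μ * trunc f R p.1) ^ 2
          * (updDrop f R i p / |p.1 i - p.2|) ∂((gauss m).prod (gaussianReal 0 1)) := by
  set F : (Fin m → ℝ) → ℝ := fun x => rexp (μ * trunc f R x) with hF
  have bF : BddMeas F := bddMeas_exp_trunc hR μ
  set T := √(τ * (10082 * rexp ((8 * |μ| + 1) ^ 2))) with hT
  set D := updDrop f R i with hD
  have hD0 : ∀ p, 0 ≤ D p := updDrop_nonneg i
  have mD : Measurable D := measurable_updDrop i
  set U : (Fin m → ℝ) × ℝ → ℝ := fun p => F p.1 ^ 2 * (D p / |p.1 i - p.2|) with hU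
  set V : (Fin m → ℝ) × ℝ → ℝ := fun p => μ ^ 2 * (D p * |p.1 i - p.2|
        * rexp (2 * |μ| * D p)) with hV
  have bU : BddMeas U := ((bF.comp (g := fun p : (Fin m → ℝ) × ℝ => p.1) (by fun_prop)).pow 2).mul
    (bddMeas_quot hf hR i)
  have hU0 : ∀ p, 0 ≤ U p := fun p => mul_nonneg (sq_nonneg _) (div_nonneg (hD0 p) (abs_nonneg _))
  have hV0 : ∀ p, 0 ≤ V p := fun p => by have := hD0 p; positivity
  have mV : Measurable V := by fun_prop
  obtain ⟨iV, hVle⟩ := integral_weight_le hf hR μ i hτ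
  have hI := infl_exp_trunc_le (f := f) hR μ i
  have e1 : ∀ p : (Fin m → ℝ) × ℝ, F p.1 ^ 2 * (μ ^ 2 * (D p ^ 2 * rexp (2 * |μ| * D p)))
      = U p * V p := fun p => by
    simp only [hU, hV]
    by_cases hw : |p.1 i - p.2| = 0
    · have : D p = 0 := le_antisymm ((updDrop_le_dist hf hR i p).trans hw.le) (hD0 p)
      simp [this]
    · field_simp
  have e2 : ∀ p : (Fin m → ℝ) × ℝ, (F p.1 ^ 2 * (μ ^ 2 * (D p ^ 2 * rexp (2 * |μ| * D p)))) ^ (2 / 3 : ℝ)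
      = U p ^ (2 / 3 : ℝ) * V p ^ (2 / 3 : ℝ) := fun p => by
    rw [e1, Real.mul_rpow (hU0 p) (hV0 p)]
  have hp : (3 / 2 : ℝ).HolderConjugate 3 := by
    rw [Real.holderConjugate_iff]; norm_num
  have ho := integral_mul_le_of_integrable_rpow (μ := (gauss m).prod (gaussianReal 0 1))
    (u := fun p => U p ^ (2 / 3 : ℝ)) (v := fun p => V p ^ (2 / 3 : ℝ))
    (bU.1.pow_const _) (mV.pow_const _) (fun p => Real.rpow_nonneg (hU0 p) _)
    (fun p => Real.rpow_nonneg (hV0 p) _) hp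
    (by simp_rw [rpow_two_thirds_aux (hU0 _)]; exact bU.integrable _)
    (by simp_rw [rpow_two_thirds_cube (hV0 _)]; exact iV)
  simp_rw [rpow_two_thirds_aux (hU0 _), rpow_two_thirds_cube (hV0 _)] at ho
  have hI1 := hI.trans_eq (congrArg (2 * ·) (integral_congr_ae (.of_forall e2)))
  have hI2 := hI1.trans (mul_le_mul_of_nonneg_left ho zero_le_two)
  set A := ∫ p, U p ∂((gauss m).prod (gaussianReal 0 1)) with hA
  set B := ∫ p, V p ^ 2 ∂((gauss m).prod (gaussianReal 0 1)) with hB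
  have hA0 : 0 ≤ A := integral_nonneg hU0
  have hB0 : 0 ≤ B := integral_nonneg fun p => sq_nonneg _
  have hI3 := Real.rpow_le_rpow (infl_nonneg _ _) hI2 (by norm_num : (0 : ℝ) ≤ 3 / 2)
  refine hI3.trans ?_
  rw [Real.mul_rpow zero_le_two (by positivity), Real.mul_rpow (by positivity) (by positivity),
    ← Real.rpow_mul hA0, ← Real.rpow_mul hB0]
  norm_num
  rw [← Real.sqrt_eq_rpow]
  have h2 : (2 : ℝ) ^ (3 / 2 : ℝ) ≤ 3 := by
    refine le_of_sq_le_sq ?_ (by norm_num)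
    rw [← Real.rpow_natCast, ← Real.rpow_mul zero_le_two]; norm_num
  have h3 : √B ≤ μ ^ 2 * √T := by
    have : √(μ ^ 4 * T) = μ ^ 2 * √T := by
      rw [Real.sqrt_mul (by positivity), show μ ^ 4 = (μ ^ 2) ^ 2 by ring,
        Real.sqrt_sq (sq_nonneg _)]
    rw [← this]
    exact Real.sqrt_le_sqrt hVle
  calc (2 : ℝ) ^ (3 / 2 : ℝ) * (A * √B) ≤ 3 * (A * (μ ^ 2 * √T)) := by gcongr
    _ = _ := by ring

theorem sum_infl_le (hf : ∀ x, f x ≤ euclNorm x) (hR : 0 ≤ R) (μ : ℝ) {τ K : ℝ}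
    (hK : ∀ z, f z ≤ K * ‖z‖) (hK0 : 0 ≤ K)
    (hτ : ∀ i : Fin m, ∫ x, ∫ y, |trunc f R x - trunc f R (Function.update x i y)|
      ∂gaussianReal 0 1 ∂gauss m ≤ τ) :
    ∑ i, infl (fun x => rexp (μ * trunc f R x)) i ^ (3 / 2 : ℝ)
      ≤ 3 * μ ^ 2 * √√(τ * (10082 * rexp ((8 * |μ| + 1) ^ 2)))
        * (K * ∫ x, rexp (μ * trunc f R x) ^ 2 ∂gauss m) := by
  refine (Finset.sum_le_sum fun i _ => infl_rpow_le hf hR μ i (hτ i)).trans ?_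
  rw [← Finset.mul_sum]
  gcongr
  have bF := (bddMeas_exp_trunc (f := f) hR μ).pow 2
  have bF1 := bF.comp (g := fun p : (Fin m → ℝ) × ℝ => p.1) (by fun_prop)
  have b := fun i => bF1.mul (bddMeas_quot hf hR i)
  rw [← integral_finsetSum _ fun i _ => (b i).integrable _]
  have h1 : ∫ p : (Fin m → ℝ) × ℝ, K * rexp (μ * trunc f R p.1) ^ 2
      ∂((gauss m).prod (gaussianReal 0 1)) = K * ∫ x, rexp (μ * trunc f R x) ^ 2 ∂gauss m := by
    rw [integral_const_mul, integral_prod _ (bF1.integrable _)]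
    simp
  rw [← h1]
  refine MeasureTheory.integral_mono (integrable_finsetSum _ fun i _ => (b i).integrable _)
    ((bF1.integrable _).const_mul K) fun p => ?_
  obtain ⟨a, ha, hax⟩ := exists_norming f p.1
  change ∑ i, _ ≤ _
  rw [← Finset.mul_sum, mul_comm]
  gcongr
  exact (Finset.sum_le_sum fun i _ => updDrop_div_le hR i p ha hax).trans (sum_abs_le ha hK hK0)

end

section

variable {m : ℕ} {f : Seminorm ℝ (Fin m → ℝ)} {R : ℝ}

/-- The constant in the variance bound. -/
noncomputable def varConst : ℝ := 8 * rexp (11 / 2) * log 100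

lemma one_le_varConst : 1 ≤ varConst := by
  have h1 : 1 ≤ rexp (11 / 2) := Real.one_le_exp (by norm_num)
  have h2 : 1 ≤ log 100 := by
    rw [Real.le_log_iff_exp_le (by norm_num)]
    linarith [Real.exp_one_lt_d9]
  unfold varConst
  nlinarith

lemma varConst_pos : 0 < varConst := zero_lt_one.trans_le one_le_varConst

lemma var_exp_trunc_le (hf : ∀ x, f x ≤ euclNorm x) (hR : 0 ≤ R) {μ ℓ : ℝ} (hℓ : 0 < ℓ)
    (hS : ∑ i, infl (fun x => rexp (μ * trunc f R x)) i ^ (3 / 2 : ℝ)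
      ≤ μ ^ 2 * (∫ x, rexp (μ * trunc f R x) ^ 2 ∂gauss m) * rexp (-ℓ)) :
    ∫ x, rexp (μ * trunc f R x) ^ 2 ∂gauss m - (∫ x, rexp (μ * trunc f R x) ∂gauss m) ^ 2
      ≤ varConst / ℓ * (μ ^ 2 * ∫ x, rexp (μ * trunc f R x) ^ 2 ∂gauss m) := by
  set Q := μ ^ 2 * ∫ x, rexp (μ * trunc f R x) ^ 2 ∂gauss m with hQ
  have hQ0 : 0 ≤ Q := mul_nonneg (sq_nonneg _) (integral_nonneg fun x => sq_nonneg _)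
  set V := ∫ x, rexp (μ * trunc f R x) ^ 2 ∂gauss m - (∫ x, rexp (μ * trunc f R x) ∂gauss m) ^ 2
    with hV
  have hc := varConst_pos
  by_contra! hcon
  have hV0 : 0 < V := lt_of_le_of_lt (by positivity) hcon
  have h1 := exp_trunc_lower hf hR μ (ρ := 1 / 100) (by norm_num) (by norm_num) hV0
  have h2 := cov_ou_le m (bddMeas_exp_trunc (f := f) hR μ)
  have h3 := h1.trans (h2.trans hS)
  rw [← hQ, ← hV] at h3
  have e : 4 * rexp (11 / 2) * log (1 / (1 / 100)) = varConst / 2 := by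
    unfold varConst; norm_num; ring
  rw [e] at h3
  have h4 : varConst * Q < V * ℓ := by
    rw [div_mul_eq_mul_div, div_lt_iff₀ hℓ] at hcon; exact hcon
  have h5 : varConst / 2 * Q / V ≤ ℓ / 2 := by
    rw [div_le_iff₀ hV0]; linarith
  have h6 : V * rexp (-(ℓ / 2)) ≤ Q * rexp (-ℓ) :=
    le_trans (by gcongr) h3
  have h7 : rexp (-ℓ) = rexp (-(ℓ / 2)) * rexp (-(ℓ / 2)) := by rw [← Real.exp_add]; congr 1; ring
  rw [h7, ← mul_assoc] at h6
  have h8 : V ≤ Q * rexp (-(ℓ / 2)) := le_of_mul_le_mul_right h6 (Real.exp_pos _)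
  have h9 : ℓ * rexp (-(ℓ / 2)) ≤ 1 := by
    have h10 := Real.quadratic_le_exp_of_nonneg (show 0 ≤ ℓ / 2 by positivity)
    have : rexp (ℓ / 2) * rexp (-(ℓ / 2)) = 1 := by rw [← Real.exp_add]; simp
    have h11 : ℓ ≤ rexp (ℓ / 2) := by nlinarith [sq_nonneg (ℓ / 2 - 1)]
    nlinarith [Real.exp_pos (-(ℓ / 2))]
  have h12 : V * ℓ ≤ Q * 1 := by
    calc V * ℓ ≤ Q * rexp (-(ℓ / 2)) * ℓ := by gcongr
      _ = Q * (ℓ * rexp (-(ℓ / 2))) := by ring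
      _ ≤ Q * 1 := by gcongr
  nlinarith [one_le_varConst]

lemma halving_iteration {h : ℝ → ℝ} {b Q Λ δ : ℝ} (hδ : 0 < δ)
    (h1 : ∀ t, |t| ≤ Λ → h t ≤ 2 * h (t / 2) + b / 2 * t ^ 2)
    (h2 : ∀ t, |t| ≤ δ → h t ≤ Q * t ^ 2) {t : ℝ} (ht : |t| ≤ Λ) : h t ≤ b * t ^ 2 := by
  have key : ∀ n : ℕ, h t ≤ 2 ^ n * h (t / 2 ^ n) + b * t ^ 2 * (1 - (1 / 2) ^ n) := by
    intro n
    induction n with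
    | zero => simp
    | succ n ih =>
      have h3 := h1 (t / 2 ^ n) (by
        rw [abs_div, abs_of_pos (by positivity : (0 : ℝ) < 2 ^ n)]
        exact (div_le_self (abs_nonneg _) (one_le_pow₀ (by norm_num))).trans ht)
      have e1 : t / 2 ^ n / 2 = t / 2 ^ (n + 1) := by rw [pow_succ, div_div]
      rw [e1] at h3
      have h4 : (2 : ℝ) ^ n * h (t / 2 ^ n)
          ≤ 2 ^ n * (2 * h (t / 2 ^ (n + 1)) + b / 2 * (t / 2 ^ n) ^ 2) := by gcongr
      have e2 : (2 : ℝ) ^ n * (2 * h (t / 2 ^ (n + 1)) + b / 2 * (t / 2 ^ n) ^ 2)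
          = 2 ^ (n + 1) * h (t / 2 ^ (n + 1)) + b * t ^ 2 * ((1 / 2) ^ (n + 1)) := by
        rw [one_div_pow, pow_succ]
        field_simp
      have e3 : ((1 : ℝ) / 2) ^ (n + 1) = (1 / 2) ^ n / 2 := by rw [pow_succ]; ring
      rw [e2] at h4
      rw [e3] at h4 ⊢
      nlinarith
  have lim1 : Filter.Tendsto (fun n : ℕ => t / 2 ^ n) Filter.atTop (nhds 0) := by
    have := (tendsto_pow_atTop_nhds_zero_of_lt_one (r := (1 / 2 : ℝ)) (by norm_num)
      (by norm_num)).const_mul t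
    rw [mul_zero] at this
    refine this.congr fun n => ?_
    rw [one_div_pow, mul_one_div]
  have lim2 := tendsto_pow_atTop_nhds_zero_of_lt_one (r := (1 / 2 : ℝ)) (by norm_num) (by norm_num)
  have lim3 : Filter.Tendsto (fun n : ℕ => Q * t ^ 2 * (1 / 2) ^ n + b * t ^ 2 * (1 - (1 / 2) ^ n))
      Filter.atTop (nhds (b * t ^ 2)) := by
    have := (lim2.const_mul (Q * t ^ 2)).add ((lim2.const_sub 1).const_mul (b * t ^ 2))
    simpa using this
  refine ge_of_tendsto lim3 ?_
  have ev : ∀ᶠ n : ℕ in Filter.atTop, |t / 2 ^ n| ≤ δ := by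
    have := lim1.abs
    rw [abs_zero] at this
    exact (this.eventually (gt_mem_nhds hδ)).mono fun n hn => hn.le
  filter_upwards [ev] with n hn
  refine (key n).trans ?_
  have h5 := h2 _ hn
  have h6 : (2 : ℝ) ^ n * h (t / 2 ^ n) ≤ 2 ^ n * (Q * (t / 2 ^ n) ^ 2) := by gcongr
  have e : (2 : ℝ) ^ n * (Q * (t / 2 ^ n) ^ 2) = Q * t ^ 2 * (1 / 2) ^ n := by
    rw [one_div_pow]; field_simp
  linarith

/-- If exponentials of a bounded variable satisfy a variance bound at all scales up to `Λ`, the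
variable has Gaussian-type exponential moments up to `Λ`. -/
lemma exp_moment_le {α : Type*} [MeasurableSpace α] {P : Measure α} [IsProbabilityMeasure P]
    {u : α → ℝ} (hu : BddMeas u) {b Λ : ℝ} (hb : b * Λ ^ 2 ≤ 2) (hb0 : 0 ≤ b)
    (h : ∀ μ, |μ| ≤ Λ / 2 → ∫ x, rexp (μ * u x) ^ 2 ∂P - (∫ x, rexp (μ * u x) ∂P) ^ 2
      ≤ b * (μ ^ 2 * ∫ x, rexp (μ * u x) ^ 2 ∂P)) {t : ℝ} (ht : |t| ≤ Λ) :
    ∫ x, rexp (t * (u x - ∫ y, u y ∂P)) ∂P ≤ rexp (b * t ^ 2) := by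
  set M := ∫ y, u y ∂P with hM
  have hH : ∀ s, Integrable (fun x => rexp (s * u x)) P := fun s =>
    (((BddMeas.const s).mul hu).exp).integrable _
  have hHpos : ∀ s, 0 < ∫ x, rexp (s * u x) ∂P := fun s =>
    integral_exp_pos (hH s)
  have key : log (∫ x, rexp (t * u x) ∂P) - t * M ≤ b * t ^ 2 := by
    obtain ⟨C, hC⟩ := hu.2
    have hC0 : 0 ≤ C ∨ IsEmpty α := by
      rcases isEmpty_or_nonempty α with h | ⟨⟨x⟩⟩
      · exact Or.inr h
      · exact Or.inl ((abs_nonneg _).trans (hC x))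
    refine halving_iteration (h := fun t => log (∫ x, rexp (t * u x) ∂P) - t * M) (Q := C ^ 2)
      (δ := 1 / (|C| + 1)) (by positivity) (fun s hs => ?_) (fun s hs => ?_) ht
    · have h1 := h (s / 2) (by rw [abs_div, abs_two]; linarith)
      have e : ∀ x, rexp (s / 2 * u x) ^ 2 = rexp (s * u x) := fun x => by
        rw [← Real.exp_nat_mul]; congr 1; push_cast; ring
      simp_rw [e] at h1
      have hs2 : s ^ 2 ≤ Λ ^ 2 := by
        rw [← sq_abs s]; gcongr
      have hx : b * (s / 2) ^ 2 ≤ 1 / 2 := by nlinarith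
      have h2 : (∫ x, rexp (s * u x) ∂P) * (1 - b * (s / 2) ^ 2)
          ≤ (∫ x, rexp (s / 2 * u x) ∂P) ^ 2 := by linarith
      have h3 := Real.log_le_log (mul_pos (hHpos s) (by linarith)) h2
      rw [Real.log_mul (hHpos s).ne' (by linarith), Real.log_pow] at h3
      push_cast at h3
      have h4 : -(2 * (b * (s / 2) ^ 2)) ≤ log (1 - b * (s / 2) ^ 2) := by
        have hx0 : 0 ≤ b * (s / 2) ^ 2 := by positivity
        have := Real.one_sub_inv_le_log_of_pos (show 0 < 1 - b * (s / 2) ^ 2 by linarith)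
        refine le_trans ?_ this
        have h5 : (1 - b * (s / 2) ^ 2)⁻¹ ≤ 1 + 2 * (b * (s / 2) ^ 2) := by
          rw [inv_le_iff_one_le_mul₀ (by linarith)]
          nlinarith
        linarith
      have h5 : b / 2 * s ^ 2 = 2 * (b * (s / 2) ^ 2) := by ring
      linarith
    · rcases hC0 with hC0 | hE
      swap
      · exact absurd (IsProbabilityMeasure.ne_zero P) (by simp [Measure.eq_zero_of_isEmpty])
      have hsC : |s| * C ≤ 1 := by
        rw [le_div_iff₀ (by positivity), abs_of_nonneg hC0] at hs
        nlinarith [abs_nonneg s]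
      have h1 : ∫ x, rexp (s * u x) ∂P ≤ ∫ x, (1 + s * u x + s ^ 2 * C ^ 2) ∂P := by
        refine MeasureTheory.integral_mono (hH s) (((integrable_const 1).add
          ((hu.integrable P).const_mul s)).add (integrable_const _)) fun x => ?_
        have hsu : |s * u x| ≤ 1 := by
          rw [abs_mul]; exact (mul_le_mul_of_nonneg_left (hC x) (abs_nonneg _)).trans hsC
        have h2 := Real.abs_exp_sub_one_sub_id_le hsu
        have h3 : (s * u x) ^ 2 ≤ s ^ 2 * C ^ 2 := by
          rw [mul_pow, ← sq_abs (u x)]; gcongr; exact hC x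
        have := (abs_le.1 h2).2
        change rexp (s * u x) ≤ 1 + s * u x + s ^ 2 * C ^ 2
        linarith
      have hsu := (hu.integrable P).const_mul s
      rw [integral_add (f := fun x => 1 + s * u x) ((integrable_const 1).add hsu)
        (integrable_const _), integral_add (integrable_const 1) hsu, integral_const_mul] at h1
      simp only [integral_const, probReal_univ, smul_eq_mul, one_mul] at h1
      have h2 := Real.log_le_sub_one_of_pos (hHpos s)
      linarith
  have e : ∀ x, rexp (t * (u x - M)) = rexp (t * u x) * rexp (-(t * M)) := fun x => by
    rw [← Real.exp_add]; congr 1; ring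
  simp_rw [e]
  rw [integral_mul_const, ← Real.exp_log (hHpos t), ← Real.exp_add]
  exact Real.exp_le_exp.2 (by linarith)

end

section

variable {m : ℕ} {f : Seminorm ℝ (Fin m → ℝ)} {R : ℝ}

/-- Mean square oscillation of `F` under a rotation by the angle `θ`. -/
noncomputable def rotOsc (F : (Fin m → ℝ) → ℝ) (θ : ℝ) : ℝ :=
  ∫ p : (Fin m → ℝ) × (Fin m → ℝ), (F p.1 - F (cos θ • p.1 + sin θ • p.2)) ^ 2
    ∂((gauss m).prod (gauss m))

lemma rotOsc_two_mul_le {F : (Fin m → ℝ) → ℝ} (hF : BddMeas F) (θ : ℝ) :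
    rotOsc F (2 * θ) ≤ 4 * rotOsc F θ := by
  have mF := hF.1
  have b1 : BddMeas (fun p : (Fin m → ℝ) × (Fin m → ℝ) =>
      (F p.1 - F (cos θ • p.1 + sin θ • p.2)) ^ 2) :=
    ((hF.comp (g := fun p : (Fin m → ℝ) × (Fin m → ℝ) => p.1) (by fun_prop)).sub
      (hF.comp (by fun_prop))).pow 2
  have b2 : BddMeas (fun p : (Fin m → ℝ) × (Fin m → ℝ) =>
      (F p.1 - F (cos θ • p.1 - sin θ • p.2)) ^ 2) :=
    ((hF.comp (g := fun p : (Fin m → ℝ) × (Fin m → ℝ) => p.1) (by fun_prop)).sub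
      (hF.comp (by fun_prop))).pow 2
  have b3 : BddMeas (fun p : (Fin m → ℝ) × (Fin m → ℝ) =>
      (F p.1 - F (cos (2 * θ) • p.1 + sin (2 * θ) • p.2)) ^ 2) :=
    ((hF.comp (g := fun p : (Fin m → ℝ) × (Fin m → ℝ) => p.1) (by fun_prop)).sub
      (hF.comp (by fun_prop))).pow 2
  have hcs : cos θ ^ 2 + sin θ ^ 2 = 1 := by rw [add_comm]; exact sin_sq_add_cos_sq θ
  have b2' : BddMeas (fun p : (Fin m → ℝ) × (Fin m → ℝ) =>
      (F (cos θ • p.1 + sin θ • p.2) - F (cos (2 * θ) • p.1 + sin (2 * θ) • p.2)) ^ 2) :=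
    ((hF.comp (g := fun p : (Fin m → ℝ) × (Fin m → ℝ) => cos θ • p.1 + sin θ • p.2)
      (by fun_prop)).sub (hF.comp (by fun_prop))).pow 2
  have e1 : ∫ p : (Fin m → ℝ) × (Fin m → ℝ), (F (cos θ • p.1 + sin θ • p.2)
        - F (cos (2 * θ) • p.1 + sin (2 * θ) • p.2)) ^ 2 ∂((gauss m).prod (gauss m))
      = ∫ p : (Fin m → ℝ) × (Fin m → ℝ), (F p.1 - F (cos θ • p.1 - sin θ • p.2)) ^ 2
        ∂((gauss m).prod (gauss m)) := by
    rw [← (rotInv_gauss (m := m)).integral_comp hcs b2.1]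
    congr 1 with p
    have e3 : cos θ • (cos θ • p.1 + sin θ • p.2) - sin θ • (sin θ • p.1 - cos θ • p.2)
        = cos (2 * θ) • p.1 + sin (2 * θ) • p.2 := by
      rw [cos_two_mul', sin_two_mul]; module
    rw [e3]
  have e2 : ∫ p : (Fin m → ℝ) × (Fin m → ℝ), (F p.1 - F (cos θ • p.1 - sin θ • p.2)) ^ 2
        ∂((gauss m).prod (gauss m)) = rotOsc F θ := by
    unfold rotOsc
    rw [← (rotInv_gauss (m := m)).integral_comp (c := 1) (s := 0) (by norm_num) b1.1]
    congr 1 with p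
    simp [sub_eq_add_neg]
  have sq_le : ∀ a b c : ℝ, (a - c) ^ 2 ≤ 2 * ((a - b) ^ 2 + (b - c) ^ 2) := fun a b c => by
    nlinarith [sq_nonneg (a - b - (b - c))]
  have h := b3.integral_mono (μ := (gauss m).prod (gauss m))
    ((BddMeas.const 2).mul (b1.add b2')) fun p => sq_le _ _ _
  refine h.trans ?_
  rw [integral_const_mul, integral_add (b1.integrable _) (b2'.integrable _), e1, e2]
  change 2 * (rotOsc F θ + rotOsc F θ) ≤ _
  linarith

lemma var_eq_rotOsc {F : (Fin m → ℝ) → ℝ} (hF : BddMeas F) :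
    2 * (∫ x, F x ^ 2 ∂gauss m - (∫ x, F x ∂gauss m) ^ 2) = rotOsc F (π / 2) := by
  unfold rotOsc
  have mF := hF.1
  have bx := hF.comp (g := fun p : (Fin m → ℝ) × (Fin m → ℝ) => p.1) (by fun_prop)
  have by' := hF.comp (g := fun p : (Fin m → ℝ) × (Fin m → ℝ) => p.2) (by fun_prop)
  simp only [cos_pi_div_two, sin_pi_div_two, zero_smul, one_smul, zero_add]
  have e : ∀ p : (Fin m → ℝ) × (Fin m → ℝ), (F p.1 - F p.2) ^ 2
      = (F p.1 ^ 2 + F p.2 ^ 2) - 2 * (F p.1 * F p.2) := fun p => by ring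
  simp_rw [e]
  rw [integral_sub (((bx.pow 2).add (by'.pow 2)).integrable _)
    (((bx.mul by').integrable _).const_mul 2), integral_add ((bx.pow 2).integrable _)
    ((by'.pow 2).integrable _), integral_const_mul, integral_prod_mul,
    integral_prod _ ((bx.pow 2).integrable _), integral_prod _ ((by'.pow 2).integrable _)]
  simp
  ring

lemma var_exp_trunc_le_const (hf : ∀ x, f x ≤ euclNorm x) (hR : 0 ≤ R) (μ : ℝ) :
    ∫ x, rexp (μ * trunc f R x) ^ 2 ∂gauss m - (∫ x, rexp (μ * trunc f R x) ∂gauss m) ^ 2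
      ≤ rexp (11 / 2) * π ^ 2 / 2 * (μ ^ 2 * ∫ x, rexp (μ * trunc f R x) ^ 2 ∂gauss m) := by
  have bF := bddMeas_exp_trunc (f := f) hR μ
  set F : (Fin m → ℝ) → ℝ := fun x => rexp (μ * trunc f R x) with hF
  have h1 : ∀ n : ℕ, rotOsc F (π / 2) ≤ 4 ^ n * rotOsc F (π / 2 / 2 ^ n) := by
    intro n
    induction n with
    | zero => simp
    | succ n ih =>
      refine ih.trans ?_
      have := rotOsc_two_mul_le bF (π / 2 / 2 ^ (n + 1))
      have e : 2 * (π / 2 / 2 ^ (n + 1)) = π / 2 / 2 ^ n := by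
        rw [pow_succ]; field_simp
      rw [e] at this
      rw [pow_succ (4 : ℝ), mul_assoc]
      gcongr
  obtain ⟨n, hn⟩ := pow_unbounded_of_one_lt (π / 2 * (R + 4 * |μ|)) (one_lt_two (α := ℝ))
  have h2n : (0 : ℝ) < 2 ^ n := by positivity
  set θ := π / 2 / 2 ^ n with hθ
  have hθ0 : 0 ≤ θ := by positivity
  have hθ1 : θ ≤ π / 2 := div_le_self (by positivity) (one_le_pow₀ (by norm_num))
  have hc : 0 ≤ cos θ := cos_nonneg_of_neg_pi_div_two_le_of_le (by linarith [pi_pos]) hθ1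
  have hs0 : 0 ≤ sin θ := sin_nonneg_of_nonneg_of_le_pi hθ0 (by linarith [pi_pos])
  have hs1 : sin θ ≤ θ := sin_le hθ0
  have hsq : √(1 - cos θ ^ 2) = sin θ := by
    rw [← sin_sq]; exact Real.sqrt_sq hs0
  have hb : θ * (R + 4 * |μ|) ≤ 1 := by
    rw [hθ, div_mul_eq_mul_div, div_le_one h2n]; exact hn.le
  have hμ := abs_nonneg μ
  have hen := energy_le hf hR (μ := μ) hc (cos_le_one θ)
    (by rw [hsq]; nlinarith) (by rw [hsq]; nlinarith)
  rw [hsq] at hen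
  have h2 := h1 n
  rw [← var_eq_rotOsc bF] at h2
  have h3 : (1 - cos θ ^ 2) ≤ θ ^ 2 := by
    rw [← sin_sq]; gcongr
  set Q := μ ^ 2 * ∫ x, F x ^ 2 ∂gauss m with hQ
  have hQ0 : 0 ≤ Q := mul_nonneg (sq_nonneg _) (integral_nonneg fun x => sq_nonneg _)
  have h4 : (4 : ℝ) ^ n * rotOsc F θ ≤ 4 ^ n * (4 * rexp (11 / 2) * Q * θ ^ 2) := by
    gcongr
    refine hen.trans ?_
    gcongr
  have h5 : (4 : ℝ) ^ n * (4 * rexp (11 / 2) * Q * θ ^ 2) = rexp (11 / 2) * π ^ 2 * Q := by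
    have : (4 : ℝ) ^ n = (2 ^ n) ^ 2 := by rw [← pow_mul, mul_comm, pow_mul]; norm_num
    rw [hθ, this]
    field_simp
    ring
  linarith

/-- Every truncated seminorm dominated by the Euclidean norm has exponential moments at a universal
scale. -/
theorem exists_exp_moment : ∃ Λ > (0 : ℝ), ∀ (m : ℕ) (f : Seminorm ℝ (Fin m → ℝ)) (R : ℝ),
    (∀ x, f x ≤ euclNorm x) → 0 ≤ R → ∀ t, |t| ≤ Λ →
      ∫ x, rexp (t * (trunc f R x - ∫ y, trunc f R y ∂gauss m)) ∂gauss m ≤ rexp 2 := by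
  set b := rexp (11 / 2) * π ^ 2 / 2 with hb
  have hb0 : 0 < b := by positivity
  have hΛ : b * √(2 / b) ^ 2 = 2 := by
    rw [Real.sq_sqrt (by positivity)]; field_simp
  refine ⟨√(2 / b), by positivity, fun m f R hf hR t ht => ?_⟩
  refine (exp_moment_le (bddMeas_trunc hR) hΛ.le hb0.le
    (fun μ _ => var_exp_trunc_le_const hf hR μ) ht).trans ?_
  apply Real.exp_le_exp.2
  rw [← hΛ, ← sq_abs t]
  gcongr

/-- Small influences improve the scale of the exponential moments. -/
theorem exp_moment_of_infl (hf : ∀ x, f x ≤ euclNorm x) (hR : 0 ≤ R) {τ K ℓ Λ : ℝ}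
    (hK : ∀ z, f z ≤ K * ‖z‖) (hK0 : 0 ≤ K)
    (hτ : ∀ i : Fin m, ∫ x, ∫ y, |trunc f R x - trunc f R (Function.update x i y)|
      ∂gaussianReal 0 1 ∂gauss m ≤ τ) (hτ0 : 0 ≤ τ) (hℓ : 0 < ℓ) (hΛ : varConst / ℓ * Λ ^ 2 ≤ 2)
    (h : 3 * K * √√(τ * (10082 * rexp ((4 * Λ + 1) ^ 2))) ≤ rexp (-ℓ)) {t : ℝ} (ht : |t| ≤ Λ) :
    ∫ x, rexp (t * (trunc f R x - ∫ y, trunc f R y ∂gauss m)) ∂gauss m ≤ rexp 2 := by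
  have hb0 : 0 ≤ varConst / ℓ := div_nonneg varConst_pos.le hℓ.le
  refine (exp_moment_le (bddMeas_trunc hR) hΛ hb0 (fun μ hμ => var_exp_trunc_le hf hR hℓ ?_)
    ht).trans ?_
  · refine (sum_infl_le hf hR μ hK hK0 hτ).trans ?_
    have h1 : √√(τ * (10082 * rexp ((8 * |μ| + 1) ^ 2)))
        ≤ √√(τ * (10082 * rexp ((4 * Λ + 1) ^ 2))) := by
      have : 8 * |μ| + 1 ≤ 4 * Λ + 1 := by linarith
      gcongr
    have h2 : 0 ≤ μ ^ 2 * ∫ x, rexp (μ * trunc f R x) ^ 2 ∂gauss m :=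
      mul_nonneg (sq_nonneg _) (integral_nonneg fun x => sq_nonneg _)
    calc _ = (3 * K * √√(τ * (10082 * rexp ((8 * |μ| + 1) ^ 2))))
          * (μ ^ 2 * ∫ x, rexp (μ * trunc f R x) ^ 2 ∂gauss m) := by ring
      _ ≤ rexp (-ℓ) * (μ ^ 2 * ∫ x, rexp (μ * trunc f R x) ^ 2 ∂gauss m) := by
          refine mul_le_mul_of_nonneg_right (le_trans ?_ h) h2
          gcongr
      _ = _ := by ring
  · apply Real.exp_le_exp.2
    refine le_trans ?_ hΛ
    rw [← sq_abs t]
    gcongr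

end

section

variable {m : ℕ} {f : Seminorm ℝ (Fin m → ℝ)} {R : ℝ}

lemma integrable_sq_line : Integrable (fun x : ℝ => x ^ 2) (gaussianReal 0 1) :=
  (memLp_id_gaussianReal 2).integrable_sq

lemma integral_sq_line : ∫ x : ℝ, x ^ 2 ∂gaussianReal 0 1 = 1 := by
  have h := variance_id_gaussianReal (μ := 0) (v := 1)
  rw [variance_eq_integral measurable_id.aemeasurable] at h
  simpa using h

lemma integrable_abs_line : Integrable (fun x : ℝ => |x|) (gaussianReal 0 1) :=
  ((memLp_id_gaussianReal 1).integrable le_rfl).abs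

lemma integral_abs_line_le : ∫ x : ℝ, |x| ∂gaussianReal 0 1 ≤ 1 := by
  have h : ∫ x : ℝ, |x| ∂gaussianReal 0 1 ≤ ∫ x : ℝ, (1 + x ^ 2) / 2 ∂gaussianReal 0 1 :=
    MeasureTheory.integral_mono integrable_abs_line
      (((integrable_const _).add integrable_sq_line).div_const 2) fun x => by
        change |x| ≤ (1 + x ^ 2) / 2
        nlinarith [sq_nonneg (|x| - 1), sq_abs x]
  rw [integral_div, integral_add (integrable_const _) integrable_sq_line, integral_sq_line] at h
  simp at h
  linarith

lemma measurePreserving_coord (i : Fin m) :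
    MeasurePreserving (fun x : Fin m → ℝ => x i) (gauss m) (gaussianReal 0 1) :=
  measurePreserving_eval (fun _ => gaussianReal 0 1) i

lemma seminorm_le_sum (f : Seminorm ℝ (Fin m → ℝ)) (x : Fin m → ℝ) :
    f x ≤ ∑ i, |x i| * f (Pi.single i 1) := by
  have e : x = ∑ i, x i • (Pi.single i 1 : Fin m → ℝ) := by
    funext j; simp [Finset.sum_apply, Pi.single_apply]
  conv_lhs => rw [e]
  refine (Finset.le_sum_of_subadditive f (map_zero f).le (map_add_le_add f) _ _).trans (Finset.sum_le_sum fun i _ => ?_)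
  rw [map_smul_eq_mul, Real.norm_eq_abs]

lemma integrable_abs_coord (i : Fin m) : Integrable (fun x : Fin m → ℝ => |x i|) (gauss m) :=
  (measurePreserving_coord i).integrable_comp_of_integrable integrable_abs_line

lemma integral_abs_coord_le (i : Fin m) : ∫ x : Fin m → ℝ, |x i| ∂gauss m ≤ 1 := by
  have : ∫ x : Fin m → ℝ, |x i| ∂gauss m = ∫ x : ℝ, |x| ∂gaussianReal 0 1 := by
    rw [← (measurePreserving_coord i).map_eq, integral_map
      (measurable_pi_apply i).aemeasurable (by fun_prop)]
  rw [this]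
  exact integral_abs_line_le

lemma integrable_seminorm (f : Seminorm ℝ (Fin m → ℝ)) : Integrable f (gauss m) :=
  integrable_of_le (integrable_finsetSum _ fun i _ => (integrable_abs_coord i).mul_const _)
    (seminorm_continuous f).measurable (fun x => apply_nonneg f x) (seminorm_le_sum f)

lemma integral_seminorm_le (h : ∀ i, f (Pi.single i 1) ≤ 1) : ∫ x, f x ∂gauss m ≤ m := by
  refine (MeasureTheory.integral_mono (integrable_seminorm f)
    (integrable_finsetSum _ fun i _ => (integrable_abs_coord i).mul_const _)
    (seminorm_le_sum f)).trans ?_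
  rw [integral_finsetSum _ fun i _ => (integrable_abs_coord i).mul_const _]
  simp_rw [integral_mul_const]
  calc _ ≤ ∑ i : Fin m, (1 : ℝ) * 1 := by
        gcongr with i
        · exact integral_abs_coord_le i
        · exact h i
    _ = m := by simp

lemma measurePreserving_update (i : Fin m) :
    MeasurePreserving (fun p : (Fin m → ℝ) × ℝ => Function.update p.1 i p.2)
      ((gauss m).prod (gaussianReal 0 1)) (gauss m) := by
  have hm : Measurable (fun p : (Fin m → ℝ) × ℝ => Function.update p.1 i p.2) := by fun_prop
  refine ⟨hm, ?_⟩
  ext S hS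
  have b : BddMeas (fun p : (Fin m → ℝ) × ℝ => S.indicator (fun _ => (1 : ℝ)) p.1) :=
    ⟨(measurable_const.indicator hS).comp measurable_fst, 1, fun p => by
      by_cases h : p.1 ∈ S <;> simp [h]⟩
  have b1 : BddMeas (S.indicator (fun _ => (1 : ℝ))) :=
    ⟨measurable_const.indicator hS, 1, fun p => by by_cases h : p ∈ S <;> simp [h]⟩
  have h1 := integral_prod_swap_coord i b
  have e1 : (fun p : (Fin m → ℝ) × ℝ => S.indicator (fun _ => (1 : ℝ)) (Function.update p.1 i p.2))
      = ((fun p : (Fin m → ℝ) × ℝ => Function.update p.1 i p.2) ⁻¹' S).indicator fun _ => 1 := by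
    funext p; rfl
  simp only at h1
  rw [e1, integral_indicator_const _ (hm hS), integral_prod _ (b.integrable _)] at h1
  simp only [integral_const, probReal_univ, smul_eq_mul, mul_one, one_mul] at h1
  rw [integral_indicator_const _ hS, smul_eq_mul, mul_one] at h1
  rw [Measure.map_apply hm hS]
  exact (measureReal_eq_measureReal_iff).1 h1

end

section

variable {m : ℕ} {R : ℝ}

lemma seminorm_mixed_diff (f : Seminorm ℝ (Fin m → ℝ)) (p s v : Fin m → ℝ) :
    f (p + (1 / 2 : ℝ) • (s + v)) + f (p - (1 / 2 : ℝ) • (s + v)) - f (p + (1 / 2 : ℝ) • (s - v))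
      - f (p - (1 / 2 : ℝ) • (s - v))
      ≤ (f (p + s) + f (p - s) + f (p + v) + f (p - v) - 4 * f p) / 2 := by
  have mid : ∀ a b : Fin m → ℝ, f ((1 / 2 : ℝ) • (a + b)) ≤ (f a + f b) / 2 := fun a b => by
    rw [map_smul_eq_mul, Real.norm_of_nonneg (by norm_num)]
    linarith [map_add_le_add f a b]
  have h1 := mid (p + s) (p + v)
  have h2 := mid (p - s) (p - v)
  have h3 := mid (p + (1 / 2 : ℝ) • (s - v)) (p - (1 / 2 : ℝ) • (s - v))
  have e1 : (1 / 2 : ℝ) • (p + s + (p + v)) = p + (1 / 2 : ℝ) • (s + v) := by module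
  have e2 : (1 / 2 : ℝ) • (p - s + (p - v)) = p - (1 / 2 : ℝ) • (s + v) := by module
  have e3 : (1 / 2 : ℝ) • (p + (1 / 2 : ℝ) • (s - v) + (p - (1 / 2 : ℝ) • (s - v))) = p := by module
  rw [e1] at h1
  rw [e2] at h2
  rw [e3] at h3
  linarith

section path

variable (f : Seminorm ℝ (Fin m → ℝ)) (π' : (Fin m → ℝ) →L[ℝ] (Fin m → ℝ)) (e : Fin m → ℝ)

lemma integrable_seminorm_affine (g : ℝ) :
    Integrable (fun x => f (π' x + g • e)) (gauss m) :=
  integrable_of_le ((integrable_seminorm (f.comp π'.toLinearMap)).add (integrable_const (|g| * f e)))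
    ((seminorm_continuous f).comp (by fun_prop)).measurable (fun x => apply_nonneg f _) fun x => by
      refine (map_add_le_add f _ _).trans ?_
      rw [map_smul_eq_mul, Real.norm_eq_abs]
      exact le_rfl

lemma measurePreserving_neg_gauss :
    MeasurePreserving (fun x : Fin m → ℝ => -x) (gauss m) (gauss m) := by
  have h := (rotation_fst (m := m) (c := -1) (s := 0) (by norm_num))
  refine ⟨measurable_neg, ?_⟩
  have e1 : (fun p : (Fin m → ℝ) × (Fin m → ℝ) => (-1 : ℝ) • p.1 + (0 : ℝ) • p.2)
      = (fun x => -x) ∘ Prod.fst := by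
    funext p; simp
  rw [e1] at h
  have h2 := h.map_eq
  rw [← Measure.map_map measurable_neg measurable_fst, measurePreserving_fst.map_eq] at h2
  exact h2

lemma integral_neg_gauss {u : (Fin m → ℝ) → ℝ} (hu : Measurable u) :
    ∫ x, u (-x) ∂gauss m = ∫ x, u x ∂gauss m := by
  conv_rhs => rw [← measurePreserving_neg_gauss.map_eq]
  rw [integral_map measurable_neg.aemeasurable hu.aestronglyMeasurable]

lemma measurable_seminorm_affine (g : ℝ) : Measurable (fun x => f (π' x + g • e)) :=
  ((seminorm_continuous f).comp (by fun_prop)).measurable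

lemma integral_affine_neg (g : ℝ) :
    ∫ x, f (π' x + (-g) • e) ∂gauss m = ∫ x, f (π' x + g • e) ∂gauss m := by
  rw [← integral_neg_gauss (measurable_seminorm_affine f π' e g)]
  congr 1 with x
  rw [← map_neg_eq_map f]
  congr 1
  rw [map_neg]; module

lemma integral_affine_ge (g : ℝ) :
    ∫ x, f (π' x) ∂gauss m ≤ ∫ x, f (π' x + g • e) ∂gauss m := by
  have h : ∫ x, f (π' x) ∂gauss m
      ≤ ∫ x, (f (π' x + g • e) + f (π' x + (-g) • e)) / 2 ∂gauss m := by
    refine MeasureTheory.integral_mono (integrable_seminorm (f.comp π'.toLinearMap))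
      (((integrable_seminorm_affine f π' e g).add
        (integrable_seminorm_affine f π' e (-g))).div_const 2) fun x => ?_
    have := map_add_le_add f (π' x + g • e) (π' x + (-g) • e)
    have e1 : π' x + g • e + (π' x + (-g) • e) = (2 : ℝ) • π' x := by module
    rw [e1, map_smul_eq_mul, Real.norm_of_nonneg (by norm_num)] at this
    change f (π' x) ≤ (f (π' x + g • e) + f (π' x + (-g) • e)) / 2
    linarith
  rw [integral_div, integral_add (integrable_seminorm_affine f π' e g)
    (integrable_seminorm_affine f π' e (-g)), integral_affine_neg] at h
  linarith

lemma integral_rotation_affine (a b : ℝ) :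
    ∫ p : (Fin m → ℝ) × (Fin m → ℝ), f (π' (a • p.1 + b • p.2)) ∂((gauss m).prod (gauss m))
      = √(a ^ 2 + b ^ 2) * ∫ x, f (π' x) ∂gauss m := by
  set r := √(a ^ 2 + b ^ 2) with hr
  have hr2 : r ^ 2 = a ^ 2 + b ^ 2 := Real.sq_sqrt (by positivity)
  by_cases h0 : r = 0
  · have : a ^ 2 + b ^ 2 = 0 := by rw [← hr2, h0]; norm_num
    have ha : a = 0 := by nlinarith [sq_nonneg a, sq_nonneg b]
    have hb : b = 0 := by nlinarith [sq_nonneg a, sq_nonneg b]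
    simp [h0, ha, hb]
  have h := rotation_fst (m := m) (c := a / r) (s := b / r) (by field_simp; linarith)
  have mf : Measurable (fun x => f (π' x)) := ((seminorm_continuous f).comp (by fun_prop)).measurable
  have e1 : ∫ x, f (π' x) ∂gauss m
      = ∫ p : (Fin m → ℝ) × (Fin m → ℝ), f (π' ((a / r) • p.1 + (b / r) • p.2))
        ∂((gauss m).prod (gauss m)) := by
    conv_lhs => rw [← h.map_eq]
    rw [integral_map h.measurable.aemeasurable mf.aestronglyMeasurable]
  rw [e1, ← integral_const_mul]
  congr 1 with p
  have : a • p.1 + b • p.2 = r • ((a / r) • p.1 + (b / r) • p.2) := by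
    rw [smul_add, smul_smul, smul_smul, mul_div_cancel₀ _ h0, mul_div_cancel₀ _ h0]
  rw [this, π'.map_smul, map_smul_eq_mul, Real.norm_of_nonneg (Real.sqrt_nonneg _)]

lemma integrable_rotation_affine (a b : ℝ) :
    Integrable (fun p : (Fin m → ℝ) × (Fin m → ℝ) => f (π' (a • p.1 + b • p.2)))
      ((gauss m).prod (gauss m)) := by
  have h := integrable_seminorm (f.comp π'.toLinearMap)
  refine integrable_of_le (((measurePreserving_fst (μ := gauss m) (ν := gauss m)).integrable_comp_of_integrable h).const_mul |a| |>.add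
    (((measurePreserving_snd (μ := gauss m) (ν := gauss m)).integrable_comp_of_integrable h).const_mul |b|))
    ((seminorm_continuous f).comp (by fun_prop)).measurable (fun x => apply_nonneg f _) fun p => ?_
  rw [map_add]
  refine (map_add_le_add f _ _).trans ?_
  rw [π'.map_smul, π'.map_smul, map_smul_eq_mul, map_smul_eq_mul, Real.norm_eq_abs, Real.norm_eq_abs]
  exact le_rfl

end path

end

section

variable {m : ℕ} {R : ℝ}

/-- The `L¹` oscillation of `F` along the Gaussian rotation by the angle `θ`. -/
noncomputable def rotOscOne (F : (Fin m → ℝ) → ℝ) (θ : ℝ) : ℝ :=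
  ∫ p : (Fin m → ℝ) × (Fin m → ℝ), |F p.1 - F (cos θ • p.1 + sin θ • p.2)|
    ∂((gauss m).prod (gauss m))

lemma rotOscOne_two_mul_eq {F : (Fin m → ℝ) → ℝ} (hF : BddMeas F) (θ : ℝ) :
    rotOscOne F (2 * θ) = ∫ p : (Fin m → ℝ) × (Fin m → ℝ),
      |F (cos θ • p.1 + sin θ • p.2) - F (cos θ • p.1 - sin θ • p.2)|
        ∂((gauss m).prod (gauss m)) := by
  have hcs : cos θ ^ 2 + sin θ ^ 2 = 1 := by rw [add_comm]; exact sin_sq_add_cos_sq θ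
  have b3 : BddMeas (fun p : (Fin m → ℝ) × (Fin m → ℝ) =>
      |F p.1 - F (cos (2 * θ) • p.1 + sin (2 * θ) • p.2)|) :=
    ((hF.comp (g := fun p : (Fin m → ℝ) × (Fin m → ℝ) => p.1) (by fun_prop)).sub
      (hF.comp (by fun_prop))).abs
  unfold rotOscOne
  rw [← (rotInv_gauss (m := m)).integral_comp hcs b3.1]
  congr 1 with p
  have e3 : cos (2 * θ) • (cos θ • p.1 + sin θ • p.2) + sin (2 * θ) • (sin θ • p.1 - cos θ • p.2)
      = cos θ • p.1 - sin θ • p.2 := by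
    have e4 : cos (2 * θ) * cos θ + sin (2 * θ) * sin θ = cos θ := by
      rw [← cos_sub]; congr 1; ring
    have e5 : sin (2 * θ) * cos θ - cos (2 * θ) * sin θ = sin θ := by
      rw [← sin_sub]; congr 1; ring
    calc _ = (cos (2 * θ) * cos θ + sin (2 * θ) * sin θ) • p.1
          - (sin (2 * θ) * cos θ - cos (2 * θ) * sin θ) • p.2 := by module
      _ = _ := by rw [e4, e5]
  rw [e3]

lemma rotOscOne_two_mul_le {F : (Fin m → ℝ) → ℝ} (hF : BddMeas F) (θ : ℝ) :
    rotOscOne F (2 * θ) ≤ 2 * rotOscOne F θ := by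
  have b1 : BddMeas (fun p : (Fin m → ℝ) × (Fin m → ℝ) =>
      |F p.1 - F (cos θ • p.1 + sin θ • p.2)|) :=
    ((hF.comp (g := fun p : (Fin m → ℝ) × (Fin m → ℝ) => p.1) (by fun_prop)).sub
      (hF.comp (by fun_prop))).abs
  have b2 : BddMeas (fun p : (Fin m → ℝ) × (Fin m → ℝ) =>
      |F p.1 - F (cos θ • p.1 - sin θ • p.2)|) :=
    ((hF.comp (g := fun p : (Fin m → ℝ) × (Fin m → ℝ) => p.1) (by fun_prop)).sub
      (hF.comp (by fun_prop))).abs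
  have b3 : BddMeas (fun p : (Fin m → ℝ) × (Fin m → ℝ) =>
      |F (cos θ • p.1 + sin θ • p.2) - F (cos θ • p.1 - sin θ • p.2)|) :=
    ((hF.comp (g := fun p : (Fin m → ℝ) × (Fin m → ℝ) => cos θ • p.1 + sin θ • p.2)
      (by fun_prop)).sub (hF.comp (by fun_prop))).abs
  have e2 : ∫ p : (Fin m → ℝ) × (Fin m → ℝ), |F p.1 - F (cos θ • p.1 - sin θ • p.2)|
        ∂((gauss m).prod (gauss m)) = rotOscOne F θ := by
    unfold rotOscOne
    rw [← (rotInv_gauss (m := m)).integral_comp (c := 1) (s := 0) (by norm_num) b1.1]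
    congr 1 with p
    simp [sub_eq_add_neg]
  rw [rotOscOne_two_mul_eq hF]
  refine (b3.integral_mono (μ := (gauss m).prod (gauss m)) (b1.add b2) fun p => ?_).trans ?_
  · rw [abs_sub_comm (F p.1)]
    exact abs_sub_le _ _ _
  · rw [integral_add (b1.integrable _) (b2.integrable _), e2]
    change rotOscOne F θ + rotOscOne F θ ≤ _
    linarith

lemma rotOscOne_pi {F : (Fin m → ℝ) → ℝ} (hF : BddMeas F) (hodd : ∀ x, F (-x) = -F x) :
    rotOscOne F π = 2 * ∫ x, |F x| ∂gauss m := by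
  unfold rotOscOne
  rw [integral_prod]
  · simp only [cos_pi, sin_pi, neg_smul, one_smul, zero_smul, add_zero, hodd, sub_neg_eq_add,
      ← two_mul, abs_mul, abs_two, integral_const, probReal_univ, integral_const_mul]
  · exact (((hF.comp (g := fun p : (Fin m → ℝ) × (Fin m → ℝ) => p.1) (by fun_prop)).sub
      (hF.comp (by fun_prop))).abs).integrable _

lemma rotOscOne_pi_le {F : (Fin m → ℝ) → ℝ} (hF : BddMeas F) (n : ℕ) :
    rotOscOne F π ≤ 2 ^ n * rotOscOne F (2 * (π / 2 ^ (n + 1))) := by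
  induction n with
  | zero => apply le_of_eq; rw [pow_zero, one_mul]; congr 1; ring
  | succ n ih =>
    refine ih.trans ?_
    have := rotOscOne_two_mul_le hF (2 * (π / 2 ^ (n + 2)))
    have e : 2 * (2 * (π / 2 ^ (n + 2))) = 2 * (π / 2 ^ (n + 1)) := by
      rw [pow_succ _ (n + 1)]; field_simp
    rw [e] at this
    rw [pow_succ (2 : ℝ) n, mul_assoc]
    exact mul_le_mul_of_nonneg_left this (by positivity)

lemma integral_comb {Ω : Type*} [MeasurableSpace Ω] {μ : Measure Ω} [IsProbabilityMeasure μ]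
    {u₁ u₂ u₃ u₄ u₅ : Ω → ℝ} {c d : ℝ} (h₁ : Integrable u₁ μ) (h₂ : Integrable u₂ μ)
    (h₃ : Integrable u₃ μ) (h₄ : Integrable u₄ μ) (h₅ : Integrable u₅ μ) :
    ∫ x, (1 / 2 * ((c * u₁ x + c * u₂ x) + (u₃ x + u₄ x) - (4 * c) * u₅ x) + d) ∂μ
      = 1 / 2 * ((c * ∫ x, u₁ x ∂μ + c * ∫ x, u₂ x ∂μ) + (∫ x, u₃ x ∂μ + ∫ x, u₄ x ∂μ)
        - (4 * c) * ∫ x, u₅ x ∂μ) + d := by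
  have a₁ : Integrable (fun x => c * u₁ x + c * u₂ x) μ := (h₁.const_mul c).add (h₂.const_mul c)
  have a₂ : Integrable (fun x => u₃ x + u₄ x) μ := h₃.add h₄
  have a₃ : Integrable (fun x => (c * u₁ x + c * u₂ x) + (u₃ x + u₄ x)) μ := a₁.add a₂
  have a₄ : Integrable (fun x => 1 / 2 * ((c * u₁ x + c * u₂ x) + (u₃ x + u₄ x)
    - (4 * c) * u₅ x)) μ := (a₃.sub (h₅.const_mul (4 * c))).const_mul (1 / 2)
  rw [integral_add a₄ (integrable_const _), integral_const_mul, integral_sub a₃ (h₅.const_mul _),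
    integral_add a₁ a₂, integral_add (h₁.const_mul c) (h₂.const_mul c), integral_add h₃ h₄,
    integral_const_mul, integral_const_mul, integral_const_mul]
  simp

section path

variable (f : Seminorm ℝ (Fin m → ℝ)) (π' : (Fin m → ℝ) →L[ℝ] (Fin m → ℝ)) (e : Fin m → ℝ)

lemma bddMeas_central_diff (g : ℝ) :
    BddMeas (fun x => f (π' x + (g / 2) • e) - f (π' x + (-(g / 2)) • e)) := by
  refine ⟨(measurable_seminorm_affine f π' e _).sub (measurable_seminorm_affine f π' e _),
    |g| * f e, fun x => ?_⟩
  refine (abs_sub_map_le_sub f _ _).trans (le_of_eq ?_)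
  have : π' x + (g / 2) • e - (π' x + (-(g / 2)) • e) = g • e := by module
  rw [this, map_smul_eq_mul, Real.norm_eq_abs]

lemma rotOscOne_central_diff_le (g : ℝ) {θ : ℝ} (h0 : 0 ≤ θ) (h1 : θ ≤ π / 2) :
    rotOscOne (fun x => f (π' x + (g / 2) • e) - f (π' x + (-(g / 2)) • e)) (2 * θ)
      ≤ (∫ x, f (π' x + g • e) ∂gauss m - ∫ x, f (π' x) ∂gauss m)
        + θ ^ 2 / 2 * (|g| * f e) + 2 * θ ^ 2 * ∫ x, f (π' x) ∂gauss m := by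
  rw [rotOscOne_two_mul_eq (bddMeas_central_diff f π' e g)]
  set c := cos θ with hc
  set s := sin θ with hs
  have hc0 : 0 ≤ c := cos_nonneg_of_neg_pi_div_two_le_of_le (by linarith [pi_pos]) h1
  have hc1 : c ≤ 1 := cos_le_one θ
  have hc2 : 1 - c ≤ θ ^ 2 / 2 := by linarith [one_sub_sq_div_two_le_cos (x := θ)]
  have hs2 : s ^ 2 ≤ θ ^ 2 := by
    have a : 0 ≤ s := sin_nonneg_of_nonneg_of_le_pi h0 (by linarith [pi_pos])
    have b : s ≤ θ := sin_le h0
    gcongr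
  have hcs : c ^ 2 + s ^ 2 = 1 := by rw [add_comm]; exact sin_sq_add_cos_sq θ
  have hfe : 0 ≤ f e := apply_nonneg f e
  set κ0 := ∫ x, f (π' x) ∂gauss m with hκ0
  have hκ00 : 0 ≤ κ0 := integral_nonneg fun x => apply_nonneg f _
  set κ := ∫ x, f (π' x + g • e) ∂gauss m with hκ
  have hκκ : κ0 ≤ κ := integral_affine_ge f π' e g
  let μ2 := (gauss m).prod (gauss m)
  have fstI : ∀ {u : (Fin m → ℝ) → ℝ}, Integrable u (gauss m) →
      Integrable (fun p : (Fin m → ℝ) × (Fin m → ℝ) => u p.1) μ2 := fun hu =>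
    (measurePreserving_fst (μ := gauss m) (ν := gauss m)).integrable_comp_of_integrable hu
  have fstE : ∀ {u : (Fin m → ℝ) → ℝ}, Integrable u (gauss m) →
      ∫ p : (Fin m → ℝ) × (Fin m → ℝ), u p.1 ∂μ2 = ∫ x, u x ∂gauss m := fun hu => by
    rw [integral_prod _ (fstI hu)]; simp
  have i1 := fstI (integrable_seminorm_affine f π' e g)
  have i2 := fstI (integrable_seminorm_affine f π' e (-g))
  have i3 := integrable_rotation_affine f π' c (2 * s)
  have i4 := integrable_rotation_affine f π' c (-(2 * s))
  have i6 : Integrable (fun x => f (π' x)) (gauss m) := integrable_seminorm (f.comp π'.toLinearMap)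
  have i5 := fstI i6
  have key : ∀ p : (Fin m → ℝ) × (Fin m → ℝ),
      |(f (π' (c • p.1 + s • p.2) + (g / 2) • e) - f (π' (c • p.1 + s • p.2) + (-(g / 2)) • e))
        - (f (π' (c • p.1 - s • p.2) + (g / 2) • e)
          - f (π' (c • p.1 - s • p.2) + (-(g / 2)) • e))|
      ≤ 1 / 2 * ((c * f (π' p.1 + g • e) + c * f (π' p.1 + (-g) • e))
          + (f (π' (c • p.1 + (2 * s) • p.2)) + f (π' (c • p.1 + (-(2 * s)) • p.2)))
          - (4 * c) * f (π' p.1)) + (1 - c) * (|g| * f e) := by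
    intro p
    have aux : ∀ g' : ℝ, |g'| = |g| → f (c • π' p.1 + g' • e)
        ≤ c * f (π' p.1 + g' • e) + (1 - c) * (|g| * f e) := fun g' hg' => by
      have : c • π' p.1 + g' • e = c • (π' p.1 + g' • e) + ((1 - c) * g') • e := by module
      rw [this]
      refine (map_add_le_add f _ _).trans (le_of_eq ?_)
      rw [map_smul_eq_mul, map_smul_eq_mul, Real.norm_of_nonneg hc0, Real.norm_eq_abs, abs_mul,
        abs_of_nonneg (sub_nonneg.2 hc1), hg', mul_assoc]
    have a1 := aux g rfl
    have a2 := aux (-g) (abs_neg g)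
    have m1 := seminorm_mixed_diff f (c • π' p.1) (g • e) ((2 * s) • π' p.2)
    have m2 := seminorm_mixed_diff f (c • π' p.1) (g • e) ((-(2 * s)) • π' p.2)
    have q1 : π' (c • p.1 + s • p.2) = c • π' p.1 + s • π' p.2 := by
      rw [map_add, π'.map_smul, π'.map_smul]
    have q2 : π' (c • p.1 - s • p.2) = c • π' p.1 - s • π' p.2 := by
      rw [map_sub, π'.map_smul, π'.map_smul]
    have q3 : π' (c • p.1 + (2 * s) • p.2) = c • π' p.1 + (2 * s) • π' p.2 := by
      rw [map_add, π'.map_smul, π'.map_smul]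
    have q4 : π' (c • p.1 + (-(2 * s)) • p.2) = c • π' p.1 + (-(2 * s)) • π' p.2 := by
      rw [map_add, π'.map_smul, π'.map_smul]
    have q5 : f (c • π' p.1) = c * f (π' p.1) := by
      rw [map_smul_eq_mul, Real.norm_of_nonneg hc0]
    rw [q1, q2, q3, q4]
    rw [q5] at m1 m2
    have t1 : c • π' p.1 + (1 / 2 : ℝ) • (g • e + (2 * s) • π' p.2)
      = c • π' p.1 + s • π' p.2 + (g / 2) • e := by module
    have t2 : c • π' p.1 - (1 / 2 : ℝ) • (g • e + (2 * s) • π' p.2)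
      = c • π' p.1 - s • π' p.2 + (-(g / 2)) • e := by module
    have t3 : c • π' p.1 + (1 / 2 : ℝ) • (g • e - (2 * s) • π' p.2)
      = c • π' p.1 - s • π' p.2 + (g / 2) • e := by module
    have t4 : c • π' p.1 - (1 / 2 : ℝ) • (g • e - (2 * s) • π' p.2)
      = c • π' p.1 + s • π' p.2 + (-(g / 2)) • e := by module
    have t5 : c • π' p.1 + (1 / 2 : ℝ) • (g • e + (-(2 * s)) • π' p.2)
      = c • π' p.1 - s • π' p.2 + (g / 2) • e := by module
    have t6 : c • π' p.1 - (1 / 2 : ℝ) • (g • e + (-(2 * s)) • π' p.2)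
      = c • π' p.1 + s • π' p.2 + (-(g / 2)) • e := by module
    have t7 : c • π' p.1 + (1 / 2 : ℝ) • (g • e - (-(2 * s)) • π' p.2)
      = c • π' p.1 + s • π' p.2 + (g / 2) • e := by module
    have t8 : c • π' p.1 - (1 / 2 : ℝ) • (g • e - (-(2 * s)) • π' p.2)
      = c • π' p.1 - s • π' p.2 + (-(g / 2)) • e := by module
    have u1 : c • π' p.1 - g • e = c • π' p.1 + (-g) • e := by module
    have u2 : c • π' p.1 - (2 * s) • π' p.2 = c • π' p.1 + (-(2 * s)) • π' p.2 := by module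
    have u3 : c • π' p.1 - (-(2 * s)) • π' p.2 = c • π' p.1 + (2 * s) • π' p.2 := by module
    rw [t1, t2, t3, t4, u1, u2] at m1
    rw [t5, t6, t7, t8, u1, u3] at m2
    rw [abs_le]
    constructor <;> linarith
  have hInt : Integrable (fun p : (Fin m → ℝ) × (Fin m → ℝ) =>
      1 / 2 * ((c * f (π' p.1 + g • e) + c * f (π' p.1 + (-g) • e))
          + (f (π' (c • p.1 + (2 * s) • p.2)) + f (π' (c • p.1 + (-(2 * s)) • p.2)))
          - (4 * c) * f (π' p.1)) + (1 - c) * (|g| * f e)) μ2 :=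
    ((((((i1.const_mul c).add (i2.const_mul c)).add (i3.add i4)).sub
      (i5.const_mul (4 * c))).const_mul (1 / 2)).add (integrable_const _))
  have b3 := bddMeas_central_diff f π' e g
  refine (MeasureTheory.integral_mono (BddMeas.integrable
    ((b3.comp (g := fun p : (Fin m → ℝ) × (Fin m → ℝ) => c • p.1 + s • p.2)
      (by fun_prop)).sub (b3.comp (g := fun p : (Fin m → ℝ) × (Fin m → ℝ) => c • p.1 - s • p.2)
        (by fun_prop))).abs μ2) hInt key).trans ?_
  have E : ∫ p : (Fin m → ℝ) × (Fin m → ℝ),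
      (1 / 2 * ((c * f (π' p.1 + g • e) + c * f (π' p.1 + (-g) • e))
          + (f (π' (c • p.1 + (2 * s) • p.2)) + f (π' (c • p.1 + (-(2 * s)) • p.2)))
          - (4 * c) * f (π' p.1)) + (1 - c) * (|g| * f e)) ∂μ2
      = 1 / 2 * (c * κ + c * κ + (√(c ^ 2 + (2 * s) ^ 2) * κ0 + √(c ^ 2 + (2 * s) ^ 2) * κ0)
          - 4 * c * κ0) + (1 - c) * (|g| * f e) := by
    rw [integral_comb i1 i2 i3 i4 i5, integral_rotation_affine, integral_rotation_affine,
      neg_sq, fstE (integrable_seminorm_affine f π' e g),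
      fstE (integrable_seminorm_affine f π' e (-g)), fstE i6, integral_affine_neg]
  rw [E]
  have hr : √(c ^ 2 + (2 * s) ^ 2) ≤ 1 + 3 / 2 * s ^ 2 := by
    rw [Real.sqrt_le_left (by positivity)]
    nlinarith [sq_nonneg s, sq_nonneg (s ^ 2)]
  have n1 : c * (κ - κ0) ≤ κ - κ0 := by nlinarith
  have n2 : (1 - c) * (|g| * f e) ≤ θ ^ 2 / 2 * (|g| * f e) := by gcongr
  have n3 : (√(c ^ 2 + (2 * s) ^ 2) - c) * κ0 ≤ 2 * θ ^ 2 * κ0 := by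
    gcongr; linarith
  linarith

lemma integral_abs_central_diff_le (g : ℝ) (n : ℕ) (he : f e ≤ 1) :
    ∫ x, |f (π' x + (g / 2) • e) - f (π' x + (-(g / 2)) • e)| ∂gauss m
      ≤ 2 ^ n * (∫ x, f (π' x + g • e) ∂gauss m - ∫ x, f (π' x) ∂gauss m) / 2
        + (|g| + 4 * ∫ x, f (π' x) ∂gauss m) / 2 ^ n := by
  have b := bddMeas_central_diff f π' e g
  have h1 := rotOscOne_pi_le b n
  rw [rotOscOne_pi b] at h1
  · have h2 := rotOscOne_central_diff_le f π' e g (θ := π / 2 ^ (n + 1)) (by positivity) (by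
      rw [pow_succ]
      gcongr
      linarith [one_le_pow₀ (M₀ := ℝ) (a := 2) (n := n) (by norm_num)])
    set κ0 := ∫ x, f (π' x) ∂gauss m with hκ0
    have hκ00 : 0 ≤ κ0 := integral_nonneg fun x => apply_nonneg f _
    set N : ℝ := 2 ^ n with hN
    have hNp : 0 < N := by positivity
    have hθ : (π / 2 ^ (n + 1)) ^ 2 ≤ 4 / N ^ 2 := by
      rw [pow_succ 2 n, ← hN, div_pow, mul_pow, div_le_div_iff₀ (by positivity) (by positivity)]
      have : π ^ 2 ≤ 16 := by nlinarith [pi_le_four, pi_pos]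
      nlinarith [sq_nonneg N]
    have h3 : N * ((π / 2 ^ (n + 1)) ^ 2 / 2 * (|g| * f e) + 2 * (π / 2 ^ (n + 1)) ^ 2 * κ0)
        ≤ N * (4 / N ^ 2 / 2 * (|g| * 1) + 2 * (4 / N ^ 2) * κ0) := by gcongr
    have h4 : N * (4 / N ^ 2 / 2 * (|g| * 1) + 2 * (4 / N ^ 2) * κ0)
        = 2 * ((|g| + 4 * κ0) / N) := by field_simp; ring
    have h5 := mul_le_mul_of_nonneg_left h2 hNp.le
    linarith
  · intro x
    rw [← map_neg_eq_map f (π' (-x) + _), ← map_neg_eq_map f (π' (-x) + (-(g / 2)) • e), neg_sub]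
    congr 2 <;> (rw [map_neg]; module)

lemma abs_sub_le_central_diff (g : ℝ) (x : Fin m → ℝ) :
    |f (x + g • e) - f x| ≤ |f (x + (g / 2) • e) - f (x + (-(g / 2)) • e)|
      + (f (x + g • e) + f (x + (-g) • e) - 2 * f x) := by
  have cv : ∀ a b : Fin m → ℝ, f ((2 / 3 : ℝ) • a + (1 / 3 : ℝ) • b) ≤ 2 / 3 * f a + 1 / 3 * f b :=
    fun a b => by
      refine (map_add_le_add f _ _).trans (le_of_eq ?_)
      rw [map_smul_eq_mul, map_smul_eq_mul, Real.norm_of_nonneg (by norm_num),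
        Real.norm_of_nonneg (by norm_num)]
  have h1 := cv (x + g • e) (x + (-(g / 2)) • e)
  have h2 := cv (x + (-(g / 2)) • e) (x + g • e)
  have h3 := cv (x + (g / 2) • e) (x + (-g) • e)
  have h4 := cv (x + (-g) • e) (x + (g / 2) • e)
  have e1 : (2 / 3 : ℝ) • (x + g • e) + (1 / 3 : ℝ) • (x + (-(g / 2)) • e) = x + (g / 2) • e := by
    module
  have e2 : (2 / 3 : ℝ) • (x + (-(g / 2)) • e) + (1 / 3 : ℝ) • (x + g • e) = x := by module
  have e3 : (2 / 3 : ℝ) • (x + (g / 2) • e) + (1 / 3 : ℝ) • (x + (-g) • e) = x := by module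
  have e4 : (2 / 3 : ℝ) • (x + (-g) • e) + (1 / 3 : ℝ) • (x + (g / 2) • e) = x + (-(g / 2)) • e := by
    module
  rw [e1] at h1
  rw [e2] at h2
  rw [e3] at h3
  rw [e4] at h4
  have hd : 0 ≤ f (x + g • e) + f (x + (-g) • e) - 2 * f x := by
    have := map_add_le_add f (x + g • e) (x + (-g) • e)
    have e5 : x + g • e + (x + (-g) • e) = (2 : ℝ) • x := by module
    rw [e5, map_smul_eq_mul, Real.norm_of_nonneg (by norm_num)] at this
    linarith
  rw [abs_le]
  constructor
  · linarith [neg_abs_le (f (x + (g / 2) • e) - f (x + (-(g / 2)) • e))]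
  · linarith [le_abs_self (f (x + (g / 2) • e) - f (x + (-(g / 2)) • e))]

lemma integral_abs_sub_affine_le (g : ℝ) (n : ℕ) (he : f e ≤ 1) :
    ∫ x, |f (π' x + g • e) - f (π' x)| ∂gauss m
      ≤ (2 ^ n / 2 + 2) * (∫ x, f (π' x + g • e) ∂gauss m - ∫ x, f (π' x) ∂gauss m)
        + (|g| + 4 * ∫ x, f (π' x) ∂gauss m) / 2 ^ n := by
  have i0 := integrable_seminorm (f.comp π'.toLinearMap)
  have i1 := integrable_seminorm_affine f π' e g
  have i2 := integrable_seminorm_affine f π' e (-g)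
  have b := ((bddMeas_central_diff f π' e g).abs).integrable (gauss m)
  have i3 : Integrable (fun x => f (π' x + g • e) + f (π' x + (-g) • e)) (gauss m) := i1.add i2
  have i4 : Integrable (fun x => f (π' x + g • e) + f (π' x + (-g) • e) - 2 * f (π' x)) (gauss m) :=
    i3.sub (i0.const_mul 2)
  have h : ∫ x, |f (π' x + g • e) - f (π' x)| ∂gauss m
      ≤ ∫ x, (|f (π' x + (g / 2) • e) - f (π' x + (-(g / 2)) • e)|
        + (f (π' x + g • e) + f (π' x + (-g) • e) - 2 * f (π' x))) ∂gauss m :=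
    MeasureTheory.integral_mono (i1.sub i0).abs (b.add i4) fun x => abs_sub_le_central_diff f e g (π' x)
  refine h.trans ?_
  have i5 : Integrable (fun x => 2 * f (π' x)) (gauss m) := i0.const_mul 2
  rw [integral_add b i4, integral_sub i3 i5,
    integral_add i1 i2, integral_affine_neg, integral_const_mul]
  have := integral_abs_central_diff_le f π' e g n he
  linarith

end path

end

section

variable {m : ℕ} {R : ℝ}

/-- The linear map that sets the `i`-th coordinate to zero. -/
noncomputable def dropCoord (i : Fin m) : (Fin m → ℝ) →L[ℝ] (Fin m → ℝ) :=
  ContinuousLinearMap.pi fun j => if j = i then 0 else ContinuousLinearMap.proj j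

lemma dropCoord_apply (i : Fin m) (x : Fin m → ℝ) : dropCoord i x = Function.update x i 0 := by
  funext j
  by_cases h : j = i
  · subst h; simp [dropCoord]
  · simp [dropCoord, h]

lemma update_eq_dropCoord_add (i : Fin m) (x : Fin m → ℝ) (g : ℝ) :
    Function.update x i g = dropCoord i x + g • (Pi.single i 1 : Fin m → ℝ) := by
  rw [dropCoord_apply]
  funext j
  by_cases h : j = i
  · subst h; simp
  · simp [h]

lemma integral_eq_update (i : Fin m) {u : (Fin m → ℝ) → ℝ} (hu : Measurable u)
    (hi : Integrable u (gauss m)) :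
    ∫ x, u x ∂gauss m = ∫ g, ∫ x, u (Function.update x i g) ∂gauss m ∂gaussianReal 0 1 := by
  have h := measurePreserving_update (m := m) i
  have e1 : ∫ x, u x ∂gauss m = ∫ p : (Fin m → ℝ) × ℝ, u (Function.update p.1 i p.2)
      ∂((gauss m).prod (gaussianReal 0 1)) := by
    conv_lhs => rw [← h.map_eq]
    rw [integral_map h.measurable.aemeasurable hu.aestronglyMeasurable]
  rw [e1, integral_prod_symm]
  exact h.integrable_comp_of_integrable hi

lemma integrable_update_section (i : Fin m) {u : (Fin m → ℝ) → ℝ}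
    (hi : Integrable u (gauss m)) :
    Integrable (fun g => ∫ x, u (Function.update x i g) ∂gauss m) (gaussianReal 0 1) :=
  ((measurePreserving_update (m := m) i).integrable_comp_of_integrable hi).integral_prod_right

lemma integral_abs_sub_drop_le (f : Seminorm ℝ (Fin m → ℝ)) (i : Fin m) (n : ℕ)
    (he : f (Pi.single i 1) ≤ 1) :
    ∫ x, |f x - f (Function.update x i 0)| ∂gauss m
      ≤ (2 ^ n / 2 + 2) * (∫ x, f x ∂gauss m - ∫ x, f (Function.update x i 0) ∂gauss m)
        + (1 + 4 * ∫ x, f (Function.update x i 0) ∂gauss m) / 2 ^ n := by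
  have mf := (seminorm_continuous f).measurable
  have i0 : Integrable (fun x => f (Function.update x i 0)) (gauss m) := by
    have := integrable_seminorm (f.comp (dropCoord i).toLinearMap)
    refine this.congr (Filter.Eventually.of_forall fun x => ?_)
    simp [dropCoord_apply]
  have i1 : Integrable (fun x => |f x - f (Function.update x i 0)|) (gauss m) :=
    ((integrable_seminorm f).sub i0).abs
  rw [integral_eq_update i (by fun_prop) i1, integral_eq_update i mf (integrable_seminorm f)]
  simp only [Function.update_idem]
  have h : ∀ g : ℝ, ∫ x, |f (Function.update x i g) - f (Function.update x i 0)| ∂gauss m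
      ≤ (2 ^ n / 2 + 2) * (∫ x, f (Function.update x i g) ∂gauss m
        - ∫ x, f (Function.update x i 0) ∂gauss m)
        + (|g| + 4 * ∫ x, f (Function.update x i 0) ∂gauss m) / 2 ^ n := fun g => by
    have := integral_abs_sub_affine_le f (dropCoord i) (Pi.single i 1) g n he
    simp only [← update_eq_dropCoord_add] at this
    simp only [dropCoord_apply] at this
    exact this
  have j1 := integrable_update_section i i1
  simp only [Function.update_idem] at j1
  have j2 := integrable_update_section i (integrable_seminorm f)
  have j3 : Integrable (fun g : ℝ => (2 ^ n / 2 + 2) * (∫ x, f (Function.update x i g) ∂gauss m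
        - ∫ x, f (Function.update x i 0) ∂gauss m)) (gaussianReal 0 1) :=
    (j2.sub (integrable_const _)).const_mul _
  have j4 : Integrable (fun g : ℝ => (|g| + 4 * ∫ x, f (Function.update x i 0) ∂gauss m) / 2 ^ n)
      (gaussianReal 0 1) := (integrable_abs_line.add (integrable_const _)).div_const _
  refine (MeasureTheory.integral_mono j1 (j3.add j4) h).trans ?_
  rw [integral_add' j3 j4, integral_const_mul, integral_sub j2 (integrable_const _), integral_div,
    integral_add integrable_abs_line (integrable_const _)]
  simp only [integral_const, probReal_univ, smul_eq_mul, one_mul]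
  gcongr
  exact integral_abs_line_le

lemma integral_update_zero_le (f : Seminorm ℝ (Fin m → ℝ)) (i : Fin m) :
    ∫ x, f (Function.update x i 0) ∂gauss m ≤ ∫ x, f x ∂gauss m := by
  rw [integral_eq_update i (seminorm_continuous f).measurable (integrable_seminorm f)]
  have h : ∀ g : ℝ, ∫ x, f (Function.update x i 0) ∂gauss m
      ≤ ∫ x, f (Function.update x i g) ∂gauss m := fun g => by
    have := integral_affine_ge f (dropCoord i) (Pi.single i 1) g
    simp only [← update_eq_dropCoord_add] at this
    simp only [dropCoord_apply] at this
    exact this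
  have := MeasureTheory.integral_mono (integrable_const _)
    (integrable_update_section i (integrable_seminorm f)) h
  simpa using this

/-- The `L¹` influence of a coordinate on a seminorm is controlled by the loss in the mean caused by
dropping that coordinate. -/
lemma influence_le_drop (f : Seminorm ℝ (Fin m → ℝ)) (i : Fin m) (n : ℕ)
    (he : f (Pi.single i 1) ≤ 1) :
    ∫ x, ∫ y, |f x - f (Function.update x i y)| ∂gaussianReal 0 1 ∂gauss m
      ≤ 5 * 2 ^ n * (∫ x, f x ∂gauss m - ∫ x, f (Function.update x i 0) ∂gauss m)
        + (2 + 8 * ∫ x, f x ∂gauss m) / 2 ^ n := by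
  have mf := (seminorm_continuous f).measurable
  have i0 : Integrable (fun x => f (Function.update x i 0)) (gauss m) := by
    have := integrable_seminorm (f.comp (dropCoord i).toLinearMap)
    refine this.congr (Filter.Eventually.of_forall fun x => ?_)
    simp [dropCoord_apply]
  have i1 : Integrable (fun x => |f x - f (Function.update x i 0)|) (gauss m) :=
    ((integrable_seminorm f).sub i0).abs
  have hP := measurePreserving_update (m := m) i
  let μ2 := (gauss m).prod (gaussianReal 0 1)
  have k1 : Integrable (fun p : (Fin m → ℝ) × ℝ => |f p.1 - f (Function.update p.1 i 0)|) μ2 :=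
    (measurePreserving_fst (μ := gauss m) (ν := gaussianReal 0 1)).integrable_comp_of_integrable i1
  have k2 : Integrable (fun p : (Fin m → ℝ) × ℝ => |f (Function.update p.1 i p.2)
      - f (Function.update p.1 i 0)|) μ2 := by
    have := hP.integrable_comp_of_integrable i1
    refine this.congr (Filter.Eventually.of_forall fun p => ?_)
    simp
  have k3 : Integrable (fun p : (Fin m → ℝ) × ℝ => |f p.1 - f (Function.update p.1 i p.2)|) μ2 :=
    (((measurePreserving_fst (μ := gauss m) (ν := gaussianReal 0 1)).integrable_comp_of_integrable
      (integrable_seminorm f)).sub (hP.integrable_comp_of_integrable (integrable_seminorm f))).abs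
  have hd := integral_update_zero_le f i
  have hd0 : 0 ≤ ∫ x, f (Function.update x i 0) ∂gauss m := integral_nonneg fun x => apply_nonneg f _
  have h0 := integral_abs_sub_drop_le f i n he
  have s1 : ∫ p : (Fin m → ℝ) × ℝ, |f p.1 - f (Function.update p.1 i 0)| ∂μ2
      = ∫ x, |f x - f (Function.update x i 0)| ∂gauss m := by
    rw [integral_prod _ k1]; simp
  have s2 : ∫ p : (Fin m → ℝ) × ℝ, |f (Function.update p.1 i p.2)
      - f (Function.update p.1 i 0)| ∂μ2 = ∫ x, |f x - f (Function.update x i 0)| ∂gauss m := by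
    conv_rhs => rw [← hP.map_eq]
    rw [integral_map hP.measurable.aemeasurable (by fun_prop)]
    simp [μ2]
  have h : ∫ x, ∫ y, |f x - f (Function.update x i y)| ∂gaussianReal 0 1 ∂gauss m
      ≤ 2 * ∫ x, |f x - f (Function.update x i 0)| ∂gauss m := by
    rw [← integral_prod (f := fun p : (Fin m → ℝ) × ℝ => |f p.1 - f (Function.update p.1 i p.2)|) k3]
    refine (MeasureTheory.integral_mono k3 (k1.add k2) fun p => ?_).trans ?_
    · change |f p.1 - f (Function.update p.1 i p.2)| ≤ |f p.1 - f (Function.update p.1 i 0)|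
        + |f (Function.update p.1 i p.2) - f (Function.update p.1 i 0)|
      rw [abs_sub_comm (f (Function.update p.1 i p.2))]
      exact abs_sub_le _ _ _
    · rw [integral_add' k1 k2, s1, s2, two_mul]
  refine h.trans ?_
  have hN : (1 : ℝ) ≤ 2 ^ n := one_le_pow₀ (by norm_num)
  set D := ∫ x, f x ∂gauss m - ∫ x, f (Function.update x i 0) ∂gauss m with hD
  have hD0 : 0 ≤ D := sub_nonneg.2 hd
  have a1 : 2 * ((2 ^ n / 2 + 2) * D) ≤ 5 * 2 ^ n * D := by nlinarith
  have a2 : 2 * ((1 + 4 * ∫ x, f (Function.update x i 0) ∂gauss m) / 2 ^ n)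
      ≤ (2 + 8 * ∫ x, f x ∂gauss m) / 2 ^ n := by
    rw [← mul_div_assoc]
    gcongr
    linarith
  linarith

lemma influence_trunc_le (f : Seminorm ℝ (Fin m → ℝ)) (i : Fin m) (n : ℕ)
    (he : f (Pi.single i 1) ≤ 1) (hR : 0 ≤ R) :
    ∫ x, ∫ y, |trunc f R x - trunc f R (Function.update x i y)| ∂gaussianReal 0 1 ∂gauss m
      ≤ 5 * 2 ^ n * (∫ x, f x ∂gauss m - ∫ x, f (Function.update x i 0) ∂gauss m)
        + (2 + 8 * ∫ x, f x ∂gauss m) / 2 ^ n := by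
  refine le_trans ?_ (influence_le_drop f i n he)
  have mf := (seminorm_continuous f).measurable
  have hP := measurePreserving_update (m := m) i
  let μ2 := (gauss m).prod (gaussianReal 0 1)
  have k3 : Integrable (fun p : (Fin m → ℝ) × ℝ => |f p.1 - f (Function.update p.1 i p.2)|) μ2 :=
    (((measurePreserving_fst (μ := gauss m) (ν := gaussianReal 0 1)).integrable_comp_of_integrable
      (integrable_seminorm f)).sub (hP.integrable_comp_of_integrable (integrable_seminorm f))).abs
  have b := bddMeas_trunc (f := f) hR
  have k4 := (((b.comp (g := fun p : (Fin m → ℝ) × ℝ => p.1) (by fun_prop)).sub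
    (b.comp hP.measurable)).abs).integrable μ2
  have := MeasureTheory.integral_mono k4 k3 fun p =>
    (abs_min_sub_min_le_max (f p.1) R (f (Function.update p.1 i p.2)) R).trans
      (le_of_eq (by simp))
  rwa [integral_prod _ k4, integral_prod _ k3] at this

end

section

variable {m : ℕ} {f : Seminorm ℝ (Fin m → ℝ)} {R : ℝ}

lemma tail_of_exp_moment {ψ : (Fin m → ℝ) → ℝ} (hψ : BddMeas ψ) {M Λ : ℝ} (hΛ : 0 ≤ Λ)
    (h : ∀ t, |t| ≤ Λ → ∫ x, rexp (t * (ψ x - M)) ∂gauss m ≤ rexp 2) (s : ℝ) :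
    (gauss m).real {x | s ≤ |ψ x - M|} ≤ 2 * rexp (2 - Λ * s) := by
  have b : ∀ t : ℝ, Integrable (fun x => rexp (t * (ψ x - M))) (gauss m) := fun t =>
    (((BddMeas.const t).mul (hψ.sub (BddMeas.const M))).exp).integrable _
  have h1 := measure_ge_le_exp_mul_mgf (μ := gauss m) (X := fun x => ψ x - M) s hΛ (b Λ)
  have h2 := measure_le_le_exp_mul_mgf (μ := gauss m) (X := fun x => ψ x - M) (-s)
    (neg_nonpos.2 hΛ) (b (-Λ))
  have g1 := h Λ (abs_of_nonneg hΛ).le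
  have g2 := h (-Λ) (by rw [abs_neg, abs_of_nonneg hΛ])
  have hsub : {x | s ≤ |ψ x - M|} ⊆ {x | s ≤ ψ x - M} ∪ {x | ψ x - M ≤ -s} := fun x hx => by
    rcases le_abs.1 (show s ≤ |ψ x - M| from hx) with h | h
    · exact Or.inl h
    · exact Or.inr (show ψ x - M ≤ -s by linarith)
  have e1 : rexp (-Λ * s) * rexp 2 = rexp (2 - Λ * s) := by rw [← Real.exp_add]; ring_nf
  have e2 : rexp (- -Λ * -s) * rexp 2 = rexp (2 - Λ * s) := by rw [← Real.exp_add]; ring_nf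
  calc _ ≤ _ := measureReal_mono hsub
    _ ≤ _ := measureReal_union_le _ _
    _ ≤ rexp (-Λ * s) * rexp 2 + rexp (- -Λ * -s) * rexp 2 := by
        refine add_le_add (h1.trans ?_) (h2.trans ?_)
        · exact mul_le_mul_of_nonneg_left g1 (Real.exp_pos _).le
        · exact mul_le_mul_of_nonneg_left g2 (Real.exp_pos _).le
    _ = _ := by rw [e1, e2]; ring

lemma integral_trunc_le (hR : 0 ≤ R) : ∫ x, trunc f R x ∂gauss m ≤ ∫ x, f x ∂gauss m :=
  MeasureTheory.integral_mono ((bddMeas_trunc hR).integrable _) (integrable_seminorm f)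
    fun _ => min_le_left _ _

lemma tail_seminorm_le (h1 : ∀ i, f (Pi.single i 1) ≤ 1) {Λ ε : ℝ} (hΛ : 0 ≤ Λ)
    (h : ∀ t, |t| ≤ Λ → ∫ x, rexp (t * (trunc f (2 * m) x - ∫ y, trunc f (2 * m) y ∂gauss m))
      ∂gauss m ≤ rexp 2) (hε : ε ≤ 1 / 2) (hM : 0 < ∫ y, trunc f (2 * m) y ∂gauss m) :
    (gauss m).real {x | ε * (∫ y, trunc f (2 * m) y ∂gauss m)
        ≤ |f x - ∫ y, trunc f (2 * m) y ∂gauss m|}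
      ≤ 2 * rexp (2 - Λ * (ε * ∫ y, trunc f (2 * m) y ∂gauss m)) := by
  have hR : (0 : ℝ) ≤ 2 * m := by positivity
  refine le_trans (measureReal_mono fun x hx => ?_)
    (tail_of_exp_moment (bddMeas_trunc (f := f) hR) hΛ h _)
  set M := ∫ y, trunc f (2 * m) y ∂gauss m with hMdef
  have hMm : M ≤ m := (integral_trunc_le hR).trans (integral_seminorm_le h1)
  change ε * M ≤ |trunc f (2 * m) x - M|
  change ε * M ≤ |f x - M| at hx
  by_contra hlt
  rw [not_le] at hlt
  have h3 : trunc f (2 * m) x < 2 * m := by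
    have := (abs_lt.1 hlt).2
    nlinarith
  have h4 : trunc f (2 * m) x = f x := by
    unfold trunc at h3 ⊢
    exact min_eq_left (le_of_lt (by simpa using h3))
  rw [h4] at hlt
  linarith

/-- The vector obtained by changing the signs of the coordinates according to `η`. -/
def flip (η : Fin m → Bool) (x : Fin m → ℝ) : Fin m → ℝ := fun i => if η i then x i else -x i

lemma measurePreserving_flip (η : Fin m → Bool) :
    MeasurePreserving (flip η) (gauss m) (gauss m) := by
  refine measurePreserving_pi (fun _ => gaussianReal 0 1) (fun _ => gaussianReal 0 1)
    (f := fun i (y : ℝ) => if η i then y else -y) fun i => ?_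
  by_cases h : η i
  · simp only [h, if_true]; exact MeasurePreserving.id _
  · simp only [h]
    refine ⟨measurable_neg, ?_⟩
    have := gaussianReal_map_neg (μ := 0) (v := 1)
    simpa using this

lemma integral_flip {u : (Fin m → ℝ) → ℝ} (hu : Measurable u) (η : Fin m → Bool) :
    ∫ x, u (flip η x) ∂gauss m = ∫ x, u x ∂gauss m := by
  conv_rhs => rw [← (measurePreserving_flip η).map_eq]
  rw [integral_map (measurePreserving_flip η).measurable.aemeasurable hu.aestronglyMeasurable]

lemma sum_integral_flip {u : (Fin m → ℝ) → ℝ} (hu : Measurable u) (hi : Integrable u (gauss m)) :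
    ∫ x, ∑ η : Fin m → Bool, u (flip η x) ∂gauss m = 2 ^ m * ∫ x, u x ∂gauss m := by
  have h : ∀ η ∈ (Finset.univ : Finset (Fin m → Bool)),
      Integrable (fun x => u (flip η x)) (gauss m) :=
    fun η _ => (measurePreserving_flip η).integrable_comp_of_integrable hi
  rw [integral_finsetSum _ h]
  simp [integral_flip hu]

lemma gaussian_tail_lower {t : ℝ} (ht : 0 ≤ t) :
    rexp (-(t + 1) ^ 2 / 2) / 3 ≤ (gaussianReal 0 1).real {x | t ≤ |x|} := by
  have h : rexp (-(t + 1) ^ 2 / 2) / 3 ≤ (gaussianReal 0 1).real (Set.Icc t (t + 1)) := by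
    rw [Measure.real, gaussianReal_apply_eq_integral _ (by norm_num), ENNReal.toReal_ofReal]
    · have hd : ∀ x ∈ Set.Icc t (t + 1), rexp (-(t + 1) ^ 2 / 2) / 3 ≤ gaussianPDFReal 0 1 x := by
        intro x hx
        unfold gaussianPDFReal
        simp only [sub_zero, NNReal.coe_one, mul_one]
        have h3 : √(2 * π) ≤ 3 := by
          rw [Real.sqrt_le_left (by norm_num)]; nlinarith [pi_lt_d2]
        have h4 : (3 : ℝ)⁻¹ ≤ (√(2 * π))⁻¹ := by gcongr
        have h5 : rexp (-(t + 1) ^ 2 / 2) ≤ rexp (-x ^ 2 / 2) := by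
          apply Real.exp_le_exp.2
          have : x ^ 2 ≤ (t + 1) ^ 2 := by
            have := hx.1; have := hx.2; gcongr; linarith
          linarith
        rw [div_eq_inv_mul]
        gcongr
      have := MeasureTheory.setIntegral_mono_on (μ := volume) (s := Set.Icc t (t + 1))
        (f := fun _ => rexp (-(t + 1) ^ 2 / 2) / 3) (g := gaussianPDFReal 0 1)
        (by simp) (integrable_gaussianPDFReal 0 1).integrableOn measurableSet_Icc hd
      simpa using this
    · exact setIntegral_nonneg measurableSet_Icc fun x _ => gaussianPDFReal_nonneg _ _ _
  refine h.trans (measureReal_mono fun x hx => ?_)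
  exact hx.1.trans (le_abs_self x)

lemma integral_abs_line_ge : 1 / 30 ≤ ∫ x : ℝ, |x| ∂gaussianReal 0 1 := by
  have h1 := gaussian_tail_lower (t := 1) (by norm_num)
  have h2 := mul_meas_ge_le_integral_of_nonneg (μ := gaussianReal 0 1) (f := fun x : ℝ => |x|)
    (Filter.Eventually.of_forall fun x => abs_nonneg x) integrable_abs_line 1
  rw [one_mul] at h2
  refine le_trans ?_ (h1.trans h2)
  have h3 : rexp 2 ≤ 10 := by
    have := Real.exp_one_lt_d9
    have e : rexp 2 = rexp 1 ^ 2 := by rw [← Real.exp_nat_mul]; norm_num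
    rw [e]; nlinarith [Real.exp_pos 1]
  have e : (-(1 + 1 : ℝ) ^ 2 / 2) = -2 := by norm_num
  rw [e, Real.exp_neg, div_le_div_iff₀ (by norm_num) (by norm_num)]
  have : (10 : ℝ)⁻¹ ≤ (rexp 2)⁻¹ := by gcongr
  linarith

end

section

variable {m : ℕ} {f : Seminorm ℝ (Fin m → ℝ)} {R : ℝ}

/-- Change all signs except the `i`-th one. -/
def flipOthers (i : Fin m) (η : Fin m → Bool) : Fin m → Bool := fun j => if j = i then η j else !η j

lemma flipOthers_involutive (i : Fin m) : Function.Involutive (flipOthers i) := by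
  intro η; funext j; unfold flipOthers; by_cases h : j = i <;> simp [h]

lemma flip_add_flipOthers (i : Fin m) (η : Fin m → Bool) (x : Fin m → ℝ) :
    flip η x + flip (flipOthers i η) x = (2 * flip η x i) • (Pi.single i 1 : Fin m → ℝ) := by
  funext j
  by_cases h : j = i
  · subst h; simp only [flip, flipOthers, if_true, Pi.add_apply, Pi.smul_apply, smul_eq_mul,
      Pi.single_eq_same]; ring
  · simp only [flip, flipOthers, h, if_false, Pi.add_apply, Pi.smul_apply, smul_eq_mul,
      Pi.single_apply]
    cases η j <;> simp

lemma abs_flip (η : Fin m → Bool) (x : Fin m → ℝ) (i : Fin m) : |flip η x i| = |x i| := by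
  unfold flip; split_ifs <;> simp

lemma sum_trunc_flip_ge (hR : 0 ≤ R) {i : Fin m} (hi : 1 / 4 ≤ f (Pi.single i 1)) {t : ℝ}
    {x : Fin m → ℝ} (hx : t ≤ |x i|) :
    2 ^ m * (min (t / 4) R / 2) ≤ ∑ η : Fin m → Bool, trunc f R (flip η x) := by
  have h1 : ∑ η : Fin m → Bool, trunc f R (flip η x)
      = ∑ η : Fin m → Bool, trunc f R (flip (flipOthers i η) x) :=
    (Equiv.sum_comp (flipOthers_involutive i).toPerm (fun η => trunc f R (flip η x))).symm
  have h2 : ∀ η : Fin m → Bool, min (t / 4) R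
      ≤ trunc f R (flip η x) + trunc f R (flip (flipOthers i η) x) := fun η => by
    have a := map_add_le_add f (flip η x) (flip (flipOthers i η) x)
    rw [flip_add_flipOthers, map_smul_eq_mul, Real.norm_eq_abs, abs_mul, abs_two, abs_flip] at a
    have b : t / 2 ≤ 2 * |x i| * f (Pi.single i 1) := by nlinarith [abs_nonneg (x i)]
    have p1 := trunc_nonneg (f := f) hR (flip η x)
    have p2 := trunc_nonneg (f := f) hR (flip (flipOthers i η) x)
    rcases le_or_gt (t / 4) (f (flip η x)) with h | h
    · have : min (t / 4) R ≤ trunc f R (flip η x) := min_le_min_right R h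
      linarith
    · have : min (t / 4) R ≤ trunc f R (flip (flipOthers i η) x) :=
        min_le_min_right R (by linarith)
      linarith
  have h3 : ∑ _η : Fin m → Bool, min (t / 4) R
      ≤ ∑ η : Fin m → Bool, trunc f R (flip η x)
        + ∑ η : Fin m → Bool, trunc f R (flip (flipOthers i η) x) := by
    rw [← Finset.sum_add_distrib]
    exact Finset.sum_le_sum fun η _ => h2 η
  rw [← h1] at h3
  simp only [Finset.sum_const, Finset.card_univ, Fintype.card_fun, Fintype.card_bool,
    Fintype.card_fin, nsmul_eq_mul, Nat.cast_pow, Nat.cast_ofNat] at h3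
  linarith

lemma prob_max_ge (A : Finset (Fin m)) {t p : ℝ}
    (hp : p ≤ (gaussianReal 0 1).real {x | t ≤ |x|}) (h : 1 ≤ p * A.card) :
    1 / 2 ≤ (gauss m).real {x | ∃ i ∈ A, t ≤ |x i|} := by
  classical
  have ms : MeasurableSet {x : ℝ | t ≤ |x|} := measurableSet_le measurable_const (by fun_prop)
  have hm : MeasurableSet {x : Fin m → ℝ | ∃ i ∈ A, t ≤ |x i|} := by
    have : {x : Fin m → ℝ | ∃ i ∈ A, t ≤ |x i|} = ⋃ i ∈ A, {x | t ≤ |x i|} := by ext; simp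
    rw [this]
    exact Finset.measurableSet_biUnion _ fun i _ => measurableSet_le measurable_const (by fun_prop)
  have hc : {x : Fin m → ℝ | ∃ i ∈ A, t ≤ |x i|}ᶜ
      = Set.pi Set.univ fun i => if i ∈ A then {x : ℝ | t ≤ |x|}ᶜ else Set.univ := by
    ext x
    simp only [Set.mem_compl_iff, Set.mem_ofPred_eq, not_exists, not_and, Set.mem_pi, Set.mem_univ,
      true_implies]
    refine forall_congr' fun i => ?_
    by_cases hi : i ∈ A <;> simp [hi]
  set q := (gaussianReal 0 1).real {x | t ≤ |x|} with hq
  have hq1 : (gaussianReal 0 1).real {x | t ≤ |x|}ᶜ = 1 - q := by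
    rw [probReal_compl_eq_one_sub ms]
  have e : (gauss m).real {x : Fin m → ℝ | ∃ i ∈ A, t ≤ |x i|}ᶜ = (1 - q) ^ A.card := by
    rw [hc, Measure.real]
    unfold gauss
    rw [Measure.pi_pi, ENNReal.toReal_prod]
    have : ∀ i, ((gaussianReal 0 1) (if i ∈ A then {x : ℝ | t ≤ |x|}ᶜ else Set.univ)).toReal
        = if i ∈ A then 1 - q else 1 := fun i => by
      by_cases hi : i ∈ A
      · simp only [hi, if_true]; exact hq1
      · simp [hi]
    simp only [this]
    rw [Finset.prod_ite_mem]
    simp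
  rw [probReal_compl_eq_one_sub hm] at e
  have hq1' : q ≤ 1 := measureReal_le_one
  have h5 : (1 - q) ^ A.card ≤ rexp (-1) := by
    calc (1 - q) ^ A.card ≤ rexp (-q) ^ A.card := by
          gcongr
          linarith [Real.add_one_le_exp (-q)]
      _ = rexp (A.card * -q) := by rw [Real.exp_nat_mul]
      _ ≤ rexp (-1) := by
          apply Real.exp_le_exp.2
          have : p * A.card ≤ q * A.card := by gcongr
          linarith
  have h6 : rexp (-1) ≤ 1 / 2 := by
    rw [Real.exp_neg, one_div]
    gcongr
    linarith [Real.exp_one_gt_d9]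
  linarith

lemma integral_trunc_ge (hR : 0 ≤ R) (A : Finset (Fin m))
    (hA : ∀ i ∈ A, 1 / 4 ≤ f (Pi.single i 1)) {t : ℝ} (ht : 0 ≤ t)
    (h : 1 ≤ rexp (-(t + 1) ^ 2 / 2) / 3 * A.card) :
    min (t / 4) R / 4 ≤ ∫ x, trunc f R x ∂gauss m := by
  have h1 := prob_max_ge A (gaussian_tail_lower ht) h
  have b := bddMeas_trunc (f := f) hR
  have h2 := sum_integral_flip b.measurable (b.integrable (gauss m))
  have hi : Integrable (fun x => ∑ η : Fin m → Bool, trunc f R (flip η x)) (gauss m) :=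
    integrable_finsetSum _ fun η _ =>
      (measurePreserving_flip η).integrable_comp_of_integrable (b.integrable (gauss m))
  have h3 := mul_meas_ge_le_integral_of_nonneg (μ := gauss m)
    (f := fun x => ∑ η : Fin m → Bool, trunc f R (flip η x))
    (Filter.Eventually.of_forall fun x => Finset.sum_nonneg fun η _ => trunc_nonneg hR _) hi
    (2 ^ m * (min (t / 4) R / 2))
  rw [h2] at h3
  have h4 : (gauss m).real {x | ∃ i ∈ A, t ≤ |x i|} ≤ (gauss m).real
      {x | 2 ^ m * (min (t / 4) R / 2) ≤ ∑ η : Fin m → Bool, trunc f R (flip η x)} :=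
    measureReal_mono fun x ⟨i, hi, hx⟩ => sum_trunc_flip_ge hR (hA i hi) hx
  have h5 : 0 ≤ min (t / 4) R := le_min (by positivity) hR
  have h6 : 2 ^ m * (min (t / 4) R / 2) * (1 / 2) ≤ 2 ^ m * ∫ x, trunc f R x ∂gauss m := by
    refine le_trans ?_ h3
    gcongr
    exact h1.trans h4
  have h7 : (0 : ℝ) < 2 ^ m := by positivity
  have h8 : 2 ^ m * (min (t / 4) R / 4) ≤ 2 ^ m * ∫ x, trunc f R x ∂gauss m := by linarith
  exact le_of_mul_le_mul_left h8 h7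

lemma integral_seminorm_sub_le (hf : ∀ x, f x ≤ euclNorm x) (hm : 0 < m) :
    ∫ x, f x ∂gauss m - 1 ≤ ∫ x, trunc f (2 * m) x ∂gauss m := by
  have hR : (0 : ℝ) ≤ 2 * m := by positivity
  have hm' : (0 : ℝ) < m := by exact_mod_cast hm
  have hsq : ∀ i : Fin m, Integrable (fun x : Fin m → ℝ => x i ^ 2) (gauss m) := fun i =>
    (measurePreserving_coord i).integrable_comp_of_integrable integrable_sq_line
  have hs : Integrable (fun x : Fin m → ℝ => (∑ i, x i ^ 2) / m) (gauss m) :=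
    (integrable_finsetSum _ fun i _ => hsq i).div_const _
  have e1 : ∀ i : Fin m, ∫ x : Fin m → ℝ, x i ^ 2 ∂gauss m = 1 := fun i => by
    have : ∫ x : Fin m → ℝ, x i ^ 2 ∂gauss m = ∫ x : ℝ, x ^ 2 ∂gaussianReal 0 1 := by
      rw [← (measurePreserving_coord i).map_eq, integral_map
        (measurable_pi_apply i).aemeasurable (by fun_prop)]
    rw [this, integral_sq_line]
  have b := (bddMeas_trunc (f := f) hR).integrable (gauss m)
  have h : ∀ x, f x ≤ trunc f (2 * m) x + (∑ i, x i ^ 2) / m := fun x => by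
    unfold trunc
    rcases le_total (f x) (2 * m) with h | h
    · rw [min_eq_left h]
      have : 0 ≤ (∑ i, x i ^ 2) / m := by positivity
      linarith
    · have h1 : f x ^ 2 ≤ ∑ i, x i ^ 2 := by
        rw [← sq_euclNorm]
        have := hf x
        have := apply_nonneg f x
        gcongr
      have h2 : f x ≤ (∑ i, x i ^ 2) / m := by
        rw [le_div_iff₀ hm']
        nlinarith [apply_nonneg f x]
      have : 0 ≤ min (f x) (2 * m) := le_min (apply_nonneg f x) hR
      linarith
  have := MeasureTheory.integral_mono (integrable_seminorm f) (b.add hs) h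
  rw [integral_add' b hs, integral_div, integral_finsetSum _ fun i _ => hsq i] at this
  simp only [e1, Finset.sum_const, Finset.card_univ, Fintype.card_fin, nsmul_eq_mul, mul_one,
    div_self hm'.ne'] at this
  linarith

end

section

variable {m : ℕ} {f : Seminorm ℝ (Fin m → ℝ)} {R : ℝ}

/-- The real sign attached to a Boolean. -/
def sgn (b : Bool) : ℝ := if b then 1 else -1

lemma ciSup_add_abs_le {T : Type*} [Nonempty T] {a b : T → ℝ} {C : ℝ} (ha : ∀ t, |a t| ≤ C)
    (hb : ∀ t, |b t| ≤ C) :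
    (⨆ t, (a t + |b t|)) + (⨆ t, (a t - |b t|)) ≤ (⨆ t, (a t + b t)) + ⨆ t, (a t - b t) := by
  have b1 : BddAbove (Set.range fun t => a t + b t) := ⟨C + C, by
    rintro _ ⟨t, rfl⟩
    exact add_le_add ((le_abs_self _).trans (ha t)) ((le_abs_self _).trans (hb t))⟩
  have b2 : BddAbove (Set.range fun t => a t - b t) := ⟨C + C, by
    rintro _ ⟨t, rfl⟩
    have := neg_abs_le (b t)
    have := hb t
    have := (le_abs_self _).trans (ha t)
    change a t - b t ≤ C + C
    linarith⟩
  refine ciSup_add_ciSup_le fun t s => ?_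
  have t1 := le_ciSup b1 t
  have t2 := le_ciSup b2 t
  have s1 := le_ciSup b1 s
  have s2 := le_ciSup b2 s
  have e1 := le_abs_self (b s)
  have e2 := neg_abs_le (b s)
  rcases abs_cases (b t) with ⟨h, _⟩ | ⟨h, _⟩ <;> rw [h] <;> linarith

lemma sum_ciSup_abs_le {T : Type*} [Nonempty T] {q : ℕ} {u : T → Fin q → ℝ} {C : ℝ}
    (hu : ∀ t p, |u t p| ≤ C) :
    ∑ η : Fin q → Bool, ⨆ t, ∑ p, sgn (η p) * |u t p|
      ≤ ∑ η : Fin q → Bool, ⨆ t, ∑ p, sgn (η p) * u t p := by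
  classical
  have sg : ∀ b : Bool, |sgn b| = 1 := fun b => by cases b <;> simp [sgn]
  suffices H : ∀ B : Finset (Fin q), ∑ η : Fin q → Bool,
      ⨆ t, ∑ p, sgn (η p) * (if p ∈ B then |u t p| else u t p)
        ≤ ∑ η : Fin q → Bool, ⨆ t, ∑ p, sgn (η p) * u t p by
    simpa using H Finset.univ
  intro B
  induction B using Finset.induction_on with
  | empty => simp
  | insert p B hp ih =>
    refine le_trans ?_ ih
    have inv : Function.Involutive (fun η : Fin q → Bool => Function.update η p (!η p)) := by
      intro η; simp
    set X : (Fin q → Bool) → ℝ :=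
      fun η => ⨆ t, ∑ i, sgn (η i) * (if i ∈ insert p B then |u t i| else u t i) with hX
    set Y : (Fin q → Bool) → ℝ :=
      fun η => ⨆ t, ∑ i, sgn (η i) * (if i ∈ B then |u t i| else u t i) with hY
    have hXs : ∑ η, X η = ∑ η, X (Function.update η p (!η p)) :=
      (Equiv.sum_comp inv.toPerm X).symm
    have hYs : ∑ η, Y η = ∑ η, Y (Function.update η p (!η p)) :=
      (Equiv.sum_comp inv.toPerm Y).symm
    have key : ∀ η, X η + X (Function.update η p (!η p)) ≤ Y η + Y (Function.update η p (!η p)) := by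
      intro η
      let a : T → ℝ := fun t =>
        ∑ i ∈ Finset.univ.erase p, sgn (η i) * (if i ∈ B then |u t i| else u t i)
      have ha : ∀ t, |a t| ≤ q * C := fun t => by
        refine (Finset.abs_sum_le_sum_abs _ _).trans ?_
        have h1 : ∀ i ∈ (Finset.univ : Finset (Fin q)),
            |sgn (η i) * (if i ∈ B then |u t i| else u t i)| ≤ C := fun i _ => by
          rw [abs_mul, sg, one_mul]
          split_ifs
          · rw [abs_abs]; exact hu t i
          · exact hu t i
        refine (Finset.sum_le_sum_of_subset_of_nonneg (Finset.erase_subset p _)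
          fun i _ _ => abs_nonneg _).trans ?_
        simpa using Finset.sum_le_card_nsmul _ _ _ h1
      have hC : 0 ≤ C := (abs_nonneg _).trans (hu (Classical.arbitrary T) p)
      have hq : (1 : ℝ) ≤ q := by exact_mod_cast (Fin.pos p)
      have hb : ∀ t, |u t p| ≤ q * C := fun t => (hu t p).trans (by nlinarith)
      have eX : ∀ η' : Fin q → Bool, (∀ i ≠ p, η' i = η i) →
          X η' = ⨆ t, (a t + sgn (η' p) * |u t p|) := fun η' h => by
        refine iSup_congr fun t => ?_
        rw [← Finset.sum_erase_add _ _ (Finset.mem_univ p)]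
        simp only [Finset.mem_insert_self, if_true]
        congr 1
        refine Finset.sum_congr rfl fun i hi => ?_
        have hne := Finset.ne_of_mem_erase hi
        simp [h i hne, hne]
      have eY : ∀ η' : Fin q → Bool, (∀ i ≠ p, η' i = η i) →
          Y η' = ⨆ t, (a t + sgn (η' p) * u t p) := fun η' h => by
        refine iSup_congr fun t => ?_
        rw [← Finset.sum_erase_add _ _ (Finset.mem_univ p)]
        simp only [hp, if_false]
        congr 1
        refine Finset.sum_congr rfl fun i hi => ?_
        have hne := Finset.ne_of_mem_erase hi
        simp [h i hne]
      have hne : ∀ i ≠ p, (Function.update η p (!η p)) i = η i := fun i hi => by simp [hi]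
      rw [eX η fun _ _ => rfl, eX _ hne, eY η fun _ _ => rfl, eY _ hne, Function.update_self]
      have main := ciSup_add_abs_le (a := a) (b := fun t => u t p) ha hb
      simp only [sub_eq_add_neg] at main
      cases hη : η p
      · simp only [sgn, Bool.not_false, if_true, neg_mul, one_mul, Bool.false_eq_true, if_false]
        linarith
      · simp only [sgn, Bool.not_true, if_true, neg_mul, one_mul, Bool.false_eq_true, if_false]
        linarith
    have := Finset.sum_le_sum fun η (_ : η ∈ Finset.univ) => key η
    rw [Finset.sum_add_distrib, Finset.sum_add_distrib, ← hXs, ← hYs] at this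
    linarith

lemma sum_mul_extend {q : ℕ} {u : Fin q → Fin m} (hu : Function.Injective u) (a : Fin m → ℝ)
    (c : Fin q → ℝ) : ∑ i, a i * Function.extend u c 0 i = ∑ p, a (u p) * c p := by
  refine (Fintype.sum_of_injective u hu _ _ (fun i hi => ?_) fun p => ?_).symm
  · rw [Function.extend_apply' _ _ _ (by simpa using hi)]; simp
  · rw [hu.extend_apply]

lemma measurable_extend {q : ℕ} {u : Fin q → Fin m} (hu : Function.Injective u)
    {c : (Fin m → ℝ) → Fin q → ℝ} (hc : Measurable c) :
    Measurable (fun x => Function.extend u (c x) (0 : Fin m → ℝ)) := by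
  refine measurable_pi_iff.2 fun i => ?_
  by_cases h : ∃ p, u p = i
  · obtain ⟨p, rfl⟩ := h
    simp only [hu.extend_apply]
    exact (measurable_pi_apply p).comp hc
  · simp only [Function.extend_apply' _ _ _ h]
    exact measurable_const

lemma integrable_extend {q : ℕ} {u : Fin q → Fin m} (hu : Function.Injective u)
    (f : Seminorm ℝ (Fin m → ℝ)) {c : (Fin m → ℝ) → Fin q → ℝ} (hc : Measurable c)
    (hcb : ∀ x p, |c x p| ≤ |x (u p)|) :
    Integrable (fun x => f (Function.extend u (c x) 0)) (gauss m) := by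
  refine integrable_of_le (integrable_finsetSum Finset.univ fun i _ =>
    (integrable_abs_coord i).mul_const (f (Pi.single i 1)))
    ((seminorm_continuous f).measurable.comp (measurable_extend hu hc))
    (fun x => apply_nonneg f _) fun x => (seminorm_le_sum f _).trans (Finset.sum_le_sum fun i _ => ?_)
  refine mul_le_mul_of_nonneg_right ?_ (apply_nonneg f _)
  by_cases h : ∃ p, u p = i
  · obtain ⟨p, rfl⟩ := h
    rw [hu.extend_apply]; exact hcb x p
  · rw [Function.extend_apply' _ _ _ h]; simp

lemma sum_sign_le {q : ℕ} {u : Fin q → Fin m} (hu : Function.Injective u)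
    (f : Seminorm ℝ (Fin m → ℝ)) :
    ∑ η : Fin q → Bool, f (Function.extend u (fun p => sgn (η p)) 0)
      ≤ 2 ^ q * (30 * ∫ x, f x ∂gauss m) := by
  have sg : ∀ b : Bool, |sgn b| = 1 := fun b => by cases b <;> simp [sgn]
  have i1 : ∀ η : Fin q → Bool, Integrable
      (fun x => f (Function.extend u (fun p => sgn (η p) * |x (u p)|) 0)) (gauss m) := fun η =>
    integrable_extend hu f (by fun_prop) fun x p => by rw [abs_mul, sg, abs_abs, one_mul]
  have i2 : ∀ η : Fin q → Bool, Integrable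
      (fun x => f (Function.extend u (fun p => sgn (η p) * x (u p)) 0)) (gauss m) := fun η =>
    integrable_extend hu f (by fun_prop) fun x p => by rw [abs_mul, sg, one_mul]
  have h1 : ∀ η : Fin q → Bool, f (Function.extend u (fun p => sgn (η p)) 0)
      ≤ 30 * ∫ x, f (Function.extend u (fun p => sgn (η p) * |x (u p)|) 0) ∂gauss m := fun η => by
    obtain ⟨a, ha1, ha2⟩ := exists_norming f (Function.extend u (fun p => sgn (η p)) 0)
    have h2 := MeasureTheory.integral_mono (μ := gauss m)
      (f := fun x => ∑ p, a (u p) * (sgn (η p) * |x (u p)|))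
      (integrable_finsetSum _ fun p _ => ((integrable_abs_coord (u p)).const_mul _).const_mul _)
      (i1 η) fun x => by
        have := ha1 (Function.extend u (fun p => sgn (η p) * |x (u p)|) 0)
        rw [sum_mul_extend hu] at this
        exact this
    have e0 : ∀ i : Fin m, ∫ x : Fin m → ℝ, |x i| ∂gauss m = ∫ x : ℝ, |x| ∂gaussianReal 0 1 :=
      fun i => by
        rw [← (measurePreserving_coord i).map_eq, integral_map
          (measurable_pi_apply i).aemeasurable (by fun_prop)]
    rw [integral_finsetSum _ fun p _ =>
      ((integrable_abs_coord (u p)).const_mul _).const_mul _] at h2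
    simp only [integral_const_mul, e0] at h2
    rw [sum_mul_extend hu] at ha2
    have h3 : ∑ p, a (u p) * (sgn (η p) * ∫ x : ℝ, |x| ∂gaussianReal 0 1)
        = f (Function.extend u (fun p => sgn (η p)) 0) * ∫ x : ℝ, |x| ∂gaussianReal 0 1 := by
      rw [← ha2, Finset.sum_mul]
      exact Finset.sum_congr rfl fun p _ => by ring
    rw [h3] at h2
    have := integral_abs_line_ge
    have := apply_nonneg f (Function.extend u (fun p => sgn (η p)) 0)
    nlinarith
  have h4 : ∀ x : Fin m → ℝ, ∑ η : Fin q → Bool, f (Function.extend u (fun p => sgn (η p) * |x (u p)|) 0)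
      = ∑ η : Fin q → Bool, f (Function.extend u (fun p => sgn (η p) * x (u p)) 0) := fun x => by
    have inv : Function.Involutive
        (fun (η : Fin q → Bool) p => if 0 ≤ x (u p) then η p else !η p) := by
      intro η; funext p; by_cases h : 0 ≤ x (u p) <;> simp [h]
    rw [← Equiv.sum_comp inv.toPerm (fun η : Fin q → Bool =>
      f (Function.extend u (fun p => sgn (η p) * x (u p)) 0))]
    refine Finset.sum_congr rfl fun η _ => ?_
    congr 2
    funext p
    change sgn (η p) * |x (u p)| = sgn (if 0 ≤ x (u p) then η p else !η p) * x (u p)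
    by_cases h : 0 ≤ x (u p)
    · rw [if_pos h, abs_of_nonneg h]
    · rw [if_neg h, abs_of_neg (not_le.1 h)]
      cases η p <;> simp [sgn]
  have h5 : ∀ η : Fin q → Bool,
      ∫ x, f (Function.extend u (fun p => sgn (η p) * x (u p)) 0) ∂gauss m ≤ ∫ x, f x ∂gauss m := by
    intro η
    set η1 : Fin m → Bool := Function.extend u η fun _ => true with hη1
    set η2 : Fin m → Bool := Function.extend u η fun _ => false with hη2
    have e : ∀ x : Fin m → ℝ, Function.extend u (fun p => sgn (η p) * x (u p)) 0
        = (1 / 2 : ℝ) • (flip η1 x + flip η2 x) := fun x => by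
      funext i
      by_cases h : ∃ p, u p = i
      · obtain ⟨p, rfl⟩ := h
        rw [hu.extend_apply]
        simp only [Pi.smul_apply, Pi.add_apply, flip, hη1, hη2, hu.extend_apply, smul_eq_mul, sgn]
        cases η p <;> simp <;> ring
      · rw [Function.extend_apply' _ _ _ h]
        simp [flip, hη1, hη2, Function.extend_apply' _ _ _ h]
    have j : ∀ η : Fin m → Bool, Integrable (fun x => f (flip η x)) (gauss m) := fun η =>
      (measurePreserving_flip η).integrable_comp_of_integrable (integrable_seminorm f)
    have h6 := MeasureTheory.integral_mono (i2 η) (((j η1).add (j η2)).const_mul (1 / 2)) fun x => by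
      change f (Function.extend u (fun p => sgn (η p) * x (u p)) 0)
        ≤ 1 / 2 * (f (flip η1 x) + f (flip η2 x))
      rw [e, map_smul_eq_mul, Real.norm_of_nonneg (by norm_num)]
      gcongr
      exact map_add_le_add f _ _
    refine h6.trans (le_of_eq ?_)
    rw [integral_const_mul, integral_add' (j η1) (j η2),
      integral_flip (seminorm_continuous f).measurable,
      integral_flip (seminorm_continuous f).measurable]
    ring
  calc _ ≤ ∑ η : Fin q → Bool,
        30 * ∫ x, f (Function.extend u (fun p => sgn (η p) * |x (u p)|) 0) ∂gauss m :=
        Finset.sum_le_sum fun η _ => h1 η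
    _ = 30 * ∑ η : Fin q → Bool,
        ∫ x, f (Function.extend u (fun p => sgn (η p) * x (u p)) 0) ∂gauss m := by
        rw [← Finset.mul_sum, ← integral_finsetSum _ fun η _ => i1 η,
          ← integral_finsetSum _ fun η _ => i2 η]
        simp only [h4]
    _ ≤ 30 * ∑ _η : Fin q → Bool, ∫ x, f x ∂gauss m := by
        exact mul_le_mul_of_nonneg_left (Finset.sum_le_sum fun η _ => h5 η) (by norm_num)
    _ = _ := by simp; ring

end

section

variable {m : ℕ}

/-- Every functional dominated by `f` has `ℓ¹`-norm at most `S` on the coordinates in `A`. -/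
def AbsSumLE (f : Seminorm ℝ (Fin m → ℝ)) (A : Finset (Fin m)) (S : ℝ) : Prop :=
  ∀ φ : Fin m → ℝ, (∀ z, ∑ i, φ i * z i ≤ f z) → ∑ i ∈ A, |φ i| ≤ S

lemma abs_coord_le_of_dual {f : Seminorm ℝ (Fin m → ℝ)} {φ : Fin m → ℝ}
    (h : ∀ z, ∑ i, φ i * z i ≤ f z) (i : Fin m) : |φ i| ≤ f (Pi.single i 1) := by
  rw [abs_le]
  have h1 := h (Pi.single i 1)
  have h2 := h (-Pi.single i 1)
  rw [map_neg_eq_map] at h2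
  simp [Pi.single_apply] at h1 h2
  constructor <;> linarith

lemma sum_ciSup_dual_le {q : ℕ} {u : Fin q → Fin m} (hu : Function.Injective u)
    (f : Seminorm ℝ (Fin m → ℝ)) :
    ∑ η : Fin q → Bool, ⨆ φ : {φ : Fin m → ℝ // ∀ z, ∑ i, φ i * z i ≤ f z},
      ∑ p, sgn (η p) * |φ.1 (u p)| ≤ 2 ^ q * (30 * ∫ x, f x ∂gauss m) := by
  obtain ⟨φ0, hφ0, -⟩ := exists_norming f 0
  have : Nonempty {φ : Fin m → ℝ // ∀ z, ∑ i, φ i * z i ≤ f z} := ⟨⟨φ0, hφ0⟩⟩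
  refine (sum_ciSup_abs_le (C := ∑ i, f (Pi.single i 1))
    (u := fun (φ : {φ : Fin m → ℝ // ∀ z, ∑ i, φ i * z i ≤ f z}) p => φ.1 (u p)) fun φ p => ?_).trans
    ((Finset.sum_le_sum fun η _ => ?_).trans (sum_sign_le hu f))
  · exact (abs_coord_le_of_dual φ.2 _).trans (Finset.single_le_sum
      (f := fun i => f (Pi.single i 1)) (fun i _ => apply_nonneg f _) (Finset.mem_univ _))
  · refine ciSup_le fun φ => ?_
    refine le_trans (le_of_eq ?_) (φ.2 _)
    rw [sum_mul_extend hu]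
    exact Finset.sum_congr rfl fun p _ => mul_comm _ _

lemma exists_half_subset {f : Seminorm ℝ (Fin m → ℝ)} {A : Finset (Fin m)} {S : ℝ} {q : ℕ}
    (hA : A.card = 2 * q) (h : AbsSumLE f A S) :
    ∃ A' ⊆ A, A'.card = q ∧ AbsSumLE f A' (S / 2 + 30 * ∫ x, f x ∂gauss m) := by
  classical
  obtain ⟨B, hBA, hB⟩ := Finset.exists_subset_card_eq (s := A) (n := q) (by omega)
  have hC : (A \ B).card = q := by rw [Finset.card_sdiff_of_subset hBA]; omega
  set u : Fin q → Fin m := ⇑(B.orderEmbOfFin hB) with hu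
  set v : Fin q → Fin m := ⇑((A \ B).orderEmbOfFin hC) with hv
  have ui : Function.Injective u := (B.orderEmbOfFin hB).injective
  have vi : Function.Injective v := ((A \ B).orderEmbOfFin hC).injective
  have um : ∀ p, u p ∈ B := fun p => Finset.orderEmbOfFin_mem _ hB p
  have vm : ∀ p, v p ∈ A \ B := fun p => Finset.orderEmbOfFin_mem _ hC p
  have su : ∀ g : Fin m → ℝ, ∑ i ∈ B, g i = ∑ p, g (u p) := fun g => by
    have : B = Finset.univ.image u := (Finset.eq_of_subset_of_card_le
      (Finset.image_subset_iff.2 fun p _ => um p)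
      (by rw [Finset.card_image_of_injective _ ui]; simp [hB])).symm
    rw [this, Finset.sum_image fun _ _ _ _ h => ui h]
  have sv : ∀ g : Fin m → ℝ, ∑ i ∈ A \ B, g i = ∑ p, g (v p) := fun g => by
    have : A \ B = Finset.univ.image v := (Finset.eq_of_subset_of_card_le
      (Finset.image_subset_iff.2 fun p _ => vm p)
      (by rw [Finset.card_image_of_injective _ vi]; simp [hC])).symm
    rw [this, Finset.sum_image fun _ _ _ _ h => vi h]
  have hne : ∀ p p', u p ≠ v p' := fun p p' e => by
    have := vm p'
    rw [← e] at this
    exact (Finset.mem_sdiff.1 this).2 (um p)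
  set s : (Fin q → Bool) → Fin q → Fin m := fun η p => if η p then u p else v p with hs
  have si : ∀ η, Function.Injective (s η) := by
    intro η p p' e
    simp only [hs] at e
    split_ifs at e
    · exact ui e
    · exact absurd e (hne _ _)
    · exact absurd e.symm (hne _ _)
    · exact vi e
  set X : (Fin q → Bool) → ℝ := fun η =>
    ⨆ φ : {φ : Fin m → ℝ // ∀ z, ∑ i, φ i * z i ≤ f z}, ∑ p, sgn (η p) * |φ.1 (u p)| with hX
  set Y : (Fin q → Bool) → ℝ := fun η =>
    ⨆ φ : {φ : Fin m → ℝ // ∀ z, ∑ i, φ i * z i ≤ f z}, ∑ p, sgn (η p) * |φ.1 (v p)| with hY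
  have sX := sum_ciSup_dual_le ui f
  have sY := sum_ciSup_dual_le vi f
  rw [← hX] at sX
  rw [← hY] at sY
  have inv : Function.Involutive (fun (η : Fin q → Bool) p => !η p) := fun η => by simp
  have sY' : ∑ η : Fin q → Bool, Y (fun p => !η p) ≤ 2 ^ q * (30 * ∫ x, f x ∂gauss m) := by
    rwa [← Equiv.sum_comp inv.toPerm Y] at sY
  have sg : ∀ b : Bool, |sgn b| = 1 := fun b => by cases b <;> simp [sgn]
  have bdd : ∀ (w : Fin q → Fin m) (η : Fin q → Bool), BddAbove (Set.range
      fun φ : {φ : Fin m → ℝ // ∀ z, ∑ i, φ i * z i ≤ f z} =>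
        ∑ p, sgn (η p) * |φ.1 (w p)|) := fun w η =>
    ⟨∑ p, f (Pi.single (w p) 1), by
      rintro _ ⟨φ, rfl⟩
      refine Finset.sum_le_sum fun p _ => ?_
      refine (le_abs_self _).trans ?_
      rw [abs_mul, sg, one_mul, abs_abs]
      exact abs_coord_le_of_dual φ.2 _⟩
  obtain ⟨η, -, hη⟩ := Finset.exists_le_of_sum_le (s := (Finset.univ : Finset (Fin q → Bool)))
    (f := fun η : Fin q → Bool => X η + Y (fun p => !η p)) (g := fun _ => 60 * ∫ x, f x ∂gauss m)
    Finset.univ_nonempty (by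
      rw [Finset.sum_add_distrib]
      simp
      linarith)
  refine ⟨Finset.univ.image (s η), ?_, ?_, ?_⟩
  · refine Finset.image_subset_iff.2 fun p _ => ?_
    simp only [hs]
    split_ifs
    · exact hBA (um p)
    · exact (Finset.mem_sdiff.1 (vm p)).1
  · rw [Finset.card_image_of_injective _ (si η)]; simp
  · intro φ hφ
    rw [Finset.sum_image fun _ _ _ _ h => si η h]
    have h1 := le_ciSup (bdd u η) ⟨φ, hφ⟩
    have h2 := le_ciSup (bdd v fun p => !η p) ⟨φ, hφ⟩
    have h3 := h φ hφ
    rw [← Finset.sum_sdiff hBA, su, sv] at h3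
    have h4 : ∑ p, |φ (s η p)| = (∑ p, |φ (v p)| + ∑ p, |φ (u p)|) / 2
        + (∑ p, sgn (η p) * |φ (u p)| + ∑ p, sgn (!η p) * |φ (v p)|) / 2 := by
      rw [← Finset.sum_add_distrib, ← Finset.sum_add_distrib, Finset.sum_div, Finset.sum_div,
        ← Finset.sum_add_distrib]
      refine Finset.sum_congr rfl fun p _ => ?_
      simp only [hs, sgn]
      cases η p <;> simp <;> ring
    rw [h4]
    simp only [hX, hY] at hη
    simp only at h1 h2
    linarith

lemma exists_subset_absSumLE {f : Seminorm ℝ (Fin m → ℝ)} {q : ℕ} (b : ℕ) :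
    ∀ {A : Finset (Fin m)} {S : ℝ}, A.card = q * 2 ^ b → AbsSumLE f A S →
    ∃ A' ⊆ A, A'.card = q ∧
      AbsSumLE f A' (S / 2 ^ b + 60 * (∫ x, f x ∂gauss m) * (1 - 1 / 2 ^ b)) := by
  induction b with
  | zero =>
    intro A S hA h
    exact ⟨A, subset_rfl, by simpa using hA, fun φ hφ => (h φ hφ).trans (by simp)⟩
  | succ b ih =>
    intro A S hA h
    obtain ⟨A1, h1, h2, h3⟩ := exists_half_subset (q := q * 2 ^ b) (by rw [hA]; ring) h
    obtain ⟨A2, h4, h5, h6⟩ := ih h2 h3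
    refine ⟨A2, h4.trans h1, h5, fun φ hφ => (h6 φ hφ).trans (le_of_eq ?_)⟩
    rw [pow_succ]
    field_simp
    ring

lemma absSumLE_univ {f : Seminorm ℝ (Fin m → ℝ)} (hf : ∀ x, f x ≤ euclNorm x) :
    AbsSumLE f Finset.univ (√m) := by
  intro φ hφ
  have h := sum_sq_le_one fun z => (hφ z).trans (hf z)
  refine Real.le_sqrt_of_sq_le ?_
  have := sq_sum_le_card_mul_sum_sq (s := Finset.univ) (f := fun i => |φ i|)
  simp only [sq_abs, Finset.card_univ, Fintype.card_fin] at this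
  have hm : (0:ℝ) ≤ m := Nat.cast_nonneg m
  nlinarith

end

section

variable {m : ℕ}

/-- The coordinate projection onto the coordinates in `A`. -/
def coordProj (A : Finset (Fin m)) : (Fin m → ℝ) →ₗ[ℝ] (Fin m → ℝ) where
  toFun z i := if i ∈ A then z i else 0
  map_add' x y := by ext i; by_cases h : i ∈ A <;> simp [h]
  map_smul' c x := by ext i; by_cases h : i ∈ A <;> simp [h]

lemma coordProj_apply (A : Finset (Fin m)) (z : Fin m → ℝ) (i : Fin m) :
    coordProj A z i = if i ∈ A then z i else 0 := rfl

lemma coordProj_univ (z : Fin m → ℝ) : coordProj Finset.univ z = z := by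
  ext i; simp [coordProj_apply]

lemma coordProj_update (A : Finset (Fin m)) (z : Fin m → ℝ) (i : Fin m) :
    coordProj A (Function.update z i 0) = coordProj (A.erase i) z := by
  ext j
  by_cases h : j = i
  · subst h; simp [coordProj_apply]
  · simp [coordProj_apply, h]

lemma coordProj_single (A : Finset (Fin m)) (i : Fin m) :
    coordProj A (Pi.single i 1) = if i ∈ A then Pi.single i 1 else 0 := by
  ext j
  by_cases h : j = i
  · subst h; by_cases hj : j ∈ A <;> simp [coordProj_apply, hj]
  · by_cases hj : i ∈ A <;> simp [coordProj_apply, h, hj]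

lemma integral_coordProj_le (f : Seminorm ℝ (Fin m → ℝ)) (A : Finset (Fin m)) :
    ∫ x, f.comp (coordProj A) x ∂gauss m ≤ ∫ x, f x ∂gauss m := by
  set η : Fin m → Bool := fun i => decide (i ∈ A) with hη
  have e : ∀ x : Fin m → ℝ, coordProj A x = (1 / 2 : ℝ) • (x + flip η x) := fun x => by
    funext i
    by_cases h : i ∈ A
    · simp [coordProj_apply, flip, hη, h]; ring
    · simp [coordProj_apply, flip, hη, h]
  have j : Integrable (fun x => f (flip η x)) (gauss m) :=
    (measurePreserving_flip η).integrable_comp_of_integrable (integrable_seminorm f)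
  have h6 := MeasureTheory.integral_mono (integrable_seminorm (f.comp (coordProj A)))
    (((integrable_seminorm f).add j).const_mul (1 / 2)) fun x => by
      change f (coordProj A x) ≤ 1 / 2 * (f x + f (flip η x))
      rw [e, map_smul_eq_mul, Real.norm_of_nonneg (by norm_num)]
      gcongr
      exact map_add_le_add f _ _
  refine h6.trans (le_of_eq ?_)
  rw [integral_const_mul, integral_add' (integrable_seminorm f) j,
    integral_flip (seminorm_continuous f).measurable]
  ring

lemma comp_coordProj_le_euclNorm {f : Seminorm ℝ (Fin m → ℝ)} (hf : ∀ x, f x ≤ euclNorm x)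
    (A : Finset (Fin m)) (x : Fin m → ℝ) : f.comp (coordProj A) x ≤ euclNorm x := by
  refine (hf _).trans (Real.sqrt_le_sqrt (Finset.sum_le_sum fun i _ => ?_))
  rw [coordProj_apply]
  split_ifs
  · exact le_rfl
  · simpa using sq_nonneg (x i)

lemma comp_coordProj_le_norm {f : Seminorm ℝ (Fin m → ℝ)} {A : Finset (Fin m)} {S : ℝ}
    (h : AbsSumLE f A S) (z : Fin m → ℝ) : f.comp (coordProj A) z ≤ S * ‖z‖ := by
  obtain ⟨φ, h1, h2⟩ := exists_norming f (coordProj A z)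
  change f (coordProj A z) ≤ _
  rw [← h2]
  calc ∑ i, φ i * coordProj A z i ≤ ∑ i, if i ∈ A then |φ i| * ‖z‖ else 0 := by
        refine Finset.sum_le_sum fun i _ => ?_
        rw [coordProj_apply]
        split_ifs
        · refine (le_abs_self _).trans ?_
          rw [abs_mul]
          exact mul_le_mul_of_nonneg_left (norm_le_pi_norm z i) (abs_nonneg _)
        · simp
    _ = (∑ i ∈ A, |φ i|) * ‖z‖ := by
        rw [Finset.sum_ite_mem, Finset.univ_inter, Finset.sum_mul]
    _ ≤ _ := mul_le_mul_of_nonneg_right (h φ h1) (norm_nonneg _)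

lemma AbsSumLE.mono {f : Seminorm ℝ (Fin m → ℝ)} {A B : Finset (Fin m)} {S : ℝ} (hAB : A ⊆ B)
    (h : AbsSumLE f B S) : AbsSumLE f A S := fun φ hφ =>
  (Finset.sum_le_sum_of_subset_of_nonneg hAB fun _ _ _ => abs_nonneg _).trans (h φ hφ)

/-- A large set of coordinates none of which contributes much to the mean of `f`. -/
lemma exists_subset_drop_le (f : Seminorm ℝ (Fin m → ℝ)) (A₀ : Finset (Fin m)) {τ : ℝ}
    (hτ : 0 ≤ τ) :
    ∃ A ⊆ A₀, τ * (A₀.card - A.card) ≤ ∫ x, f x ∂gauss m ∧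
      ∀ i, ∫ x, f.comp (coordProj A) x ∂gauss m
        - ∫ x, f.comp (coordProj A) (Function.update x i 0) ∂gauss m ≤ τ := by
  obtain ⟨A, hA, hmin⟩ := A₀.powerset.exists_min_image
    (fun A => ∫ x, f.comp (coordProj A) x ∂gauss m - τ * A.card) ⟨A₀, by simp⟩
  rw [Finset.mem_powerset] at hA
  refine ⟨A, hA, ?_, fun i => ?_⟩
  · have h1 := hmin A₀ (by simp)
    have h2 := integral_coordProj_le f A₀
    have h3 : 0 ≤ ∫ x, f.comp (coordProj A) x ∂gauss m := integral_nonneg fun x => apply_nonneg _ x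
    nlinarith
  · have e : ∀ x : Fin m → ℝ, f.comp (coordProj A) (Function.update x i 0)
        = f.comp (coordProj (A.erase i)) x := fun x => by
      change f (coordProj A _) = f (coordProj _ _)
      rw [coordProj_update]
    simp only [e]
    by_cases hi : i ∈ A
    · have h1 := hmin (A.erase i) (Finset.mem_powerset.2 ((Finset.erase_subset _ _).trans hA))
      rw [Finset.card_erase_of_mem hi, Nat.cast_sub (Finset.card_pos.2 ⟨i, hi⟩)] at h1
      push_cast at h1
      linarith
    · rw [Finset.erase_eq_of_notMem hi, sub_self]; exact hτ

end

lemma euclNorm_single {m : ℕ} (i : Fin m) : euclNorm (Pi.single i 1 : Fin m → ℝ) = 1 := by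
  simp [euclNorm, Pi.single_apply]

lemma influence_const_le {s : ℕ} (hs : 26 ≤ s) {Λ : ℝ}
    (hΛ : Λ ^ 2 ≤ s / 50) :
    3 * (61 * 2 ^ s) * √√(15 / 2 ^ (7 * s) * (10082 * exp ((4 * Λ + 1) ^ 2)))
      ≤ exp (-(s / 100 : ℝ)) := by
  have e2 : exp 2 ≤ 8 := by
    have h := exp_one_lt_d9
    have : exp 2 = exp 1 ^ 2 := by rw [← exp_nat_mul]; norm_num
    rw [this]; nlinarith [exp_pos 1]
  have h1 : exp ((4 * Λ + 1) ^ 2) ≤ 8 * exp (64 * (s / 100)) := by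
    calc exp ((4 * Λ + 1) ^ 2) ≤ exp (2 + 64 * (s / 100)) := by
          apply exp_le_exp.2; nlinarith [sq_nonneg (4 * Λ - 1)]
      _ ≤ _ := by rw [exp_add]; gcongr
  have h2 : exp (68 * (s / 100 : ℝ)) ≤ 2 ^ s := by
    have : (2:ℝ) ^ s = exp (s * log 2) := by
      rw [mul_comm, ← rpow_def_of_pos (by norm_num), rpow_natCast]
    rw [this]
    apply exp_le_exp.2
    have := log_two_gt_d9
    have hs0 : (0:ℝ) ≤ s := Nat.cast_nonneg s
    nlinarith
  have h3 : (2:ℝ) ^ 52 ≤ 2 ^ (2 * s) := pow_le_pow_right₀ (by norm_num) (by omega)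
  have h4 : 3 * (61 * 2 ^ s) * √√(15 / 2 ^ (7 * s) * (10082 * exp ((4 * Λ + 1) ^ 2)))
      = √√((3 * (61 * 2 ^ s)) ^ 4 * (15 / 2 ^ (7 * s) * (10082 * exp ((4 * Λ + 1) ^ 2)))) := by
    have h5 : (0:ℝ) ≤ 3 * (61 * 2 ^ s) := by positivity
    set a : ℝ := 3 * (61 * 2 ^ s)
    rw [show a ^ 4 = (a ^ 2) ^ 2 by ring, Real.sqrt_mul (sq_nonneg (a ^ 2)), Real.sqrt_sq (sq_nonneg a),
      Real.sqrt_mul (sq_nonneg a), Real.sqrt_sq h5]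
  rw [h4]
  refine Real.sqrt_le_iff.2 ⟨(exp_pos _).le, Real.sqrt_le_iff.2 ⟨by positivity, ?_⟩⟩
  have h5 : (exp (-(s / 100 : ℝ)) ^ 2) ^ 2 * exp (68 * (s / 100 : ℝ)) = exp (64 * (s / 100)) := by
    rw [← exp_nat_mul, ← exp_nat_mul, ← exp_add]
    congr 1
    push_cast; ring
  set E := (exp (-(s / 100 : ℝ)) ^ 2) ^ 2 with hE
  have hE0 : 0 < E := by positivity
  have p7 : (2:ℝ) ^ (7 * s) = (2 ^ s) ^ 4 * (2 ^ s * 2 ^ (2 * s)) := by ring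
  set D : ℝ := 2 ^ s with hD
  have hD0 : 0 < D := by positivity
  set W : ℝ := 2 ^ (2 * s) with hW
  have hW0 : 0 < W := by positivity
  rw [p7]
  calc (3 * (61 * D)) ^ 4 * (15 / (D ^ 4 * (D * W)) * (10082 * exp ((4 * Λ + 1) ^ 2)))
      ≤ (3 * (61 * D)) ^ 4 * (15 / (D ^ 4 * (D * W)) * (10082 * (8 * (E * D)))) := by
        gcongr
        refine h1.trans ?_
        rw [← h5]
        gcongr
    _ = (3 * 61) ^ 4 * 15 * 10082 * 8 / W * E := by field_simp
    _ ≤ 1 * E := by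
        gcongr
        rw [div_le_one hW0]
        refine le_trans ?_ h3
        norm_num
    _ = E := one_mul _

lemma norm_influence_case {s : ℕ} (hs : 26 ≤ s) (f : Seminorm ℝ (Fin (2 ^ (64 * s)) → ℝ))
    (hf : ∀ x, f x ≤ euclNorm x) (he : ∀ i, 1 / 4 ≤ f (Pi.single i 1))
    (hE : ∫ x, f x ∂gauss _ ≤ 2 ^ s) :
    ∃ A : Finset (Fin (2 ^ (64 * s))), ∃ M : ℝ, 0 < M ∧ ∀ ε : ℝ, 0 ≤ ε → ε ≤ 1 / 2 →
      (gauss _).real {x | ε * M ≤ |f.comp (coordProj A) x - M|}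
        ≤ 2 * exp (2 - 1 / (16 * √(50 * varConst)) * ε * s) := by
  have hs0 : (0:ℝ) ≤ s := Nat.cast_nonneg s
  have hE0 : 0 ≤ ∫ x, f x ∂gauss _ := integral_nonneg fun x => apply_nonneg f x
  obtain ⟨A₀, -, hcard, hA₀⟩ := exists_subset_absSumLE (f := f) (q := 2 ^ (32 * s)) (32 * s)
    (A := Finset.univ) (by simp; ring) (absSumLE_univ hf)
  have hS : √((2 ^ (64 * s) : ℕ) : ℝ) / 2 ^ (32 * s)
      + 60 * (∫ x, f x ∂gauss _) * (1 - 1 / 2 ^ (32 * s)) ≤ 61 * 2 ^ s := by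
    have e1 : √((2 ^ (64 * s) : ℕ) : ℝ) = 2 ^ (32 * s) := by
      push_cast
      rw [show (2:ℝ) ^ (64 * s) = (2 ^ (32 * s)) ^ 2 by ring, Real.sqrt_sq (by positivity)]
    rw [e1, div_self (by positivity)]
    have h1 : (1:ℝ) ≤ 2 ^ s := one_le_pow₀ (by norm_num)
    have h2 : (1 - 1 / 2 ^ (32 * s) : ℝ) ≤ 1 := by
      have : (0:ℝ) < 1 / 2 ^ (32 * s) := by positivity
      linarith
    have h3 := mul_le_mul_of_nonneg_left h2 (by positivity : 0 ≤ 60 * ∫ x, f x ∂gauss _)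
    linarith
  obtain ⟨A, hAA, hAc, hdrop⟩ := exists_subset_drop_le f A₀ (τ := 1 / 2 ^ (16 * s)) (by positivity)
  have hAS : AbsSumLE f A (61 * 2 ^ s) := fun φ hφ => ((hA₀.mono hAA) φ hφ).trans hS
  set h := f.comp (coordProj A) with hh
  have hnn : ∀ x, h x ≤ euclNorm x := comp_coordProj_le_euclNorm hf A
  have h1 : ∀ i, h (Pi.single i 1) ≤ 1 := fun i => (hnn _).trans_eq (euclNorm_single i)
  have hA4 : ∀ i ∈ A, 1 / 4 ≤ h (Pi.single i 1) := fun i hi => by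
    change _ ≤ f (coordProj A (Pi.single i 1))
    rw [coordProj_single, if_pos hi]; exact he i
  have hEh : ∫ x, h x ∂gauss _ ≤ 2 ^ s := (integral_coordProj_le f A).trans hE
  set R : ℝ := 2 * ((2 ^ (64 * s) : ℕ) : ℝ) with hR
  have hR0 : 0 ≤ R := by positivity
  -- the chosen set is large
  have hAcard : (2:ℝ) ^ (32 * s) / 2 ≤ A.card := by
    rw [hcard] at hAc
    have h2 : (1 / 2 ^ (16 * s) : ℝ) * ((2:ℝ) ^ (32 * s) - A.card) ≤ 2 ^ s := by
      have := hAc.trans hE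
      push_cast at this; exact this
    rw [one_div, inv_mul_le_iff₀ (by positivity), ← pow_add] at h2
    have h3 : (2:ℝ) ^ (16 * s + s) ≤ 2 ^ (32 * s) / 2 := by
      rw [le_div_iff₀ (by norm_num), ← pow_succ]
      exact pow_le_pow_right₀ (by norm_num) (by omega)
    linarith
  have hM : √s / 16 ≤ ∫ x, trunc h R x ∂gauss _ := by
    have h2 := integral_trunc_ge (f := h) hR0 A hA4 (Real.sqrt_nonneg s) (by
      have h3 : exp ((√s + 1) ^ 2 / 2) ≤ 2 ^ (4 * s) := by
        have : (2:ℝ) ^ (4 * s) = exp ((4 * s : ℕ) * log 2) := by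
          rw [exp_nat_mul, exp_log (by norm_num)]
        rw [this]
        apply exp_le_exp.2
        have h4 := Real.sq_sqrt hs0
        have := log_two_gt_d9
        have h5 : (26:ℝ) ≤ s := by exact_mod_cast hs
        push_cast
        nlinarith [sq_nonneg (√s - 1)]
      have h4 : (2:ℝ) ^ (4 * s) * 6 ≤ 2 ^ (32 * s) := by
        calc (2:ℝ) ^ (4 * s) * 6 ≤ 2 ^ (4 * s) * 2 ^ (28 * s) := by
              gcongr
              calc (6:ℝ) ≤ 2 ^ 3 := by norm_num
                _ ≤ _ := pow_le_pow_right₀ (by norm_num) (by omega)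
          _ = _ := by rw [← pow_add]; congr 1; ring
      rw [neg_div, exp_neg]
      have h5 := exp_pos ((√s + 1) ^ 2 / 2)
      rw [div_mul_eq_mul_div, le_div_iff₀ (by norm_num), ← div_eq_inv_mul, le_div_iff₀ h5]
      linarith)
    refine le_trans ?_ h2
    rw [min_eq_left]
    · linarith
    · have h3 : √s ≤ s := by
        rw [Real.sqrt_le_left hs0]
        have : (26:ℝ) ≤ s := by exact_mod_cast hs
        nlinarith
      have h4 : (s:ℝ) ≤ ((2 ^ (64 * s) : ℕ) : ℝ) := by
        have : s ≤ 2 ^ (64 * s) := (Nat.le_mul_of_pos_left s (by norm_num)).trans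
          (Nat.lt_two_pow_self).le
        exact_mod_cast this
      rw [hR]; linarith
  have hinfl : ∀ i, ∫ x, ∫ y, |trunc h R x - trunc h R (Function.update x i y)|
      ∂gaussianReal 0 1 ∂gauss _ ≤ 15 / 2 ^ (7 * s) := fun i => by
    refine (influence_trunc_le h i (8 * s) (h1 i) hR0).trans ?_
    have h2 : 5 * 2 ^ (8 * s) * (∫ x, h x ∂gauss _ - ∫ x, h (Function.update x i 0) ∂gauss _)
        ≤ 5 * 2 ^ (8 * s) * (1 / 2 ^ (16 * s)) := by gcongr; exact hdrop i
    have h3 : (2 + 8 * ∫ x, h x ∂gauss _) / 2 ^ (8 * s) ≤ (2 + 8 * 2 ^ s) / 2 ^ (8 * s) := by gcongr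
    refine (add_le_add h2 h3).trans ?_
    have h4 : (1:ℝ) ≤ 2 ^ s := one_le_pow₀ (by norm_num)
    have e1 : (2:ℝ) ^ (8 * s) = (2 ^ s) ^ 8 := by ring
    have e2 : (2:ℝ) ^ (16 * s) = (2 ^ s) ^ 16 := by ring
    have e3 : (2:ℝ) ^ (7 * s) = (2 ^ s) ^ 7 := by ring
    rw [e1, e2, e3]
    set D : ℝ := 2 ^ s
    have hD : 0 < D := by positivity
    have e4 : 5 * D ^ 8 * (1 / D ^ 16) + (2 + 8 * D) / D ^ 8 = (7 + 8 * D) / D ^ 8 := by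
      field_simp; ring
    rw [e4, div_le_div_iff₀ (by positivity) (by positivity)]
    have : (7 + 8 * D) * D ^ 7 ≤ (15 * D) * D ^ 7 := by gcongr; linarith
    linarith [this]
  set Λ := √(s / (50 * varConst)) with hΛ
  have v1 := one_le_varConst
  have hΛ2 : Λ ^ 2 = s / (50 * varConst) := Real.sq_sqrt (by positivity)
  have hs1 : (26:ℝ) ≤ s := by exact_mod_cast hs
  have hmom : ∀ t, |t| ≤ Λ →
      ∫ x, exp (t * (trunc h R x - ∫ y, trunc h R y ∂gauss _)) ∂gauss _ ≤ exp 2 := fun t ht =>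
    exp_moment_of_infl (K := 61 * 2 ^ s) (ℓ := s / 100) hnn hR0 (comp_coordProj_le_norm hAS)
      (by positivity) hinfl (by positivity) (by positivity)
      (by rw [hΛ2]; field_simp; norm_num)
      (influence_const_le hs (by
        rw [hΛ2]
        apply div_le_div_of_nonneg_left hs0 (by norm_num); linarith)) ht
  have hMpos : 0 < ∫ x, trunc h R x ∂gauss _ := lt_of_lt_of_le (by positivity) hM
  refine ⟨A, _, hMpos, fun ε h0 hε => ?_⟩
  refine (tail_seminorm_le h1 (Real.sqrt_nonneg _) hmom hε hMpos).trans ?_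
  gcongr 2 * exp (2 - ?_)
  have h2 : 1 / (16 * √(50 * varConst)) * s = Λ * (√s / 16) := by
    rw [hΛ, Real.sqrt_div' _ (by positivity)]
    have : √(50 * varConst) ≠ 0 := (Real.sqrt_pos.2 (by positivity)).ne'
    field_simp
    exact (Real.sq_sqrt hs0).symm
  calc 1 / (16 * √(50 * varConst)) * ε * s = ε * (1 / (16 * √(50 * varConst)) * s) := by ring
    _ = Λ * (ε * (√s / 16)) := by rw [h2]; ring
    _ ≤ _ := by gcongr

theorem exists_concentrated_projection : ∃ c > (0:ℝ), ∀ s : ℕ, 26 ≤ s →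
    ∀ f : Seminorm ℝ (Fin (2 ^ (64 * s)) → ℝ), (∀ x, f x ≤ euclNorm x) →
    (∀ i, 1 / 4 ≤ f (Pi.single i 1)) →
    ∃ A : Finset (Fin (2 ^ (64 * s))), ∃ M : ℝ, 0 < M ∧ ∀ ε : ℝ, 0 ≤ ε → ε ≤ 1 / 2 →
      (gauss _).real {x | ε * M ≤ |f.comp (coordProj A) x - M|} ≤ 2 * exp (2 - c * ε * s) := by
  obtain ⟨Λ, hΛ, hmom⟩ := exists_exp_moment
  have v1 := one_le_varConst
  have hc' : 0 < 1 / (16 * √(50 * varConst)) := by positivity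
  refine ⟨min Λ (1 / (16 * √(50 * varConst))), lt_min hΛ hc', fun s hs f hf he => ?_⟩
  have hs0 : (0:ℝ) ≤ s := Nat.cast_nonneg s
  rcases le_total (∫ x, f x ∂gauss _) (2 ^ s) with hE | hE
  · obtain ⟨A, M, hM, h⟩ := norm_influence_case hs f hf he hE
    refine ⟨A, M, hM, fun ε h0 hε => (h ε h0 hε).trans ?_⟩
    gcongr
    exact min_le_right _ _
  · have hfu : f.comp (coordProj Finset.univ) = f := by
      ext x
      change f (coordProj _ x) = f x
      rw [coordProj_univ]
    have hM := integral_seminorm_sub_le hf (by positivity)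
    have h2 : (s:ℝ) + 1 ≤ 2 ^ s := by
      have : s + 1 ≤ 2 ^ s := Nat.lt_two_pow_self
      exact_mod_cast this
    have hMs : (s:ℝ) ≤ ∫ x, trunc f (2 * ((2 ^ (64 * s) : ℕ) : ℝ)) x ∂gauss _ := by linarith
    have hs1 : (26:ℝ) ≤ s := by exact_mod_cast hs
    refine ⟨Finset.univ, ∫ x, trunc f (2 * ((2 ^ (64 * s) : ℕ) : ℝ)) x ∂gauss _,
      by linarith, fun ε h0 hε => ?_⟩
    rw [hfu]
    refine (tail_seminorm_le (fun i => (hf _).trans_eq (euclNorm_single i)) hΛ.le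
      (hmom _ f _ hf (by positivity)) hε (by linarith)).trans ?_
    gcongr 2 * exp (2 - ?_)
    rw [mul_assoc]
    gcongr
    exact min_le_left _ _

section MaximalDeterminant

variable {V : Type*} [NormedAddCommGroup V] [InnerProductSpace ℝ V] [FiniteDimensional ℝ V]

lemma exists_max_det (p : Seminorm ℝ V) (hpc : Continuous p) (hp : ∀ x, p x = 0 → x = 0) :
    ∃ T : V →ₗ[ℝ] V, (∀ x, p (T x) ≤ ‖x‖) ∧ LinearMap.det T ≠ 0 ∧
      ∀ S : V →ₗ[ℝ] V, (∀ x, p (S x) ≤ ‖x‖) → |LinearMap.det S| ≤ |LinearMap.det T| := by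
  obtain ⟨C, hC0, hC⟩ : ∃ C > 0, ∀ x, p x ≤ C * ‖x‖ := Seminorm.bound_of_continuous_normedSpace p hpc
  have low : ∃ c > 0, ∀ x, c * ‖x‖ ≤ p x := by
    rcases subsingleton_or_nontrivial V with h | h
    · exact ⟨1, one_pos, fun x => by simp [Subsingleton.elim x 0]⟩
    · have := FiniteDimensional.proper ℝ V
      obtain ⟨x0, hx0, hmin⟩ := (isCompact_sphere (0 : V) 1).exists_isMinOn
        (NormedSpace.sphere_nonempty.2 zero_le_one) hpc.continuousOn
      have hx1 : ‖x0‖ = 1 := by simpa using hx0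
      have hpos : 0 < p x0 := (apply_nonneg p x0).lt_of_ne' fun h => by
        rw [hp x0 h, norm_zero] at hx1; exact zero_ne_one hx1
      refine ⟨p x0, hpos, fun x => ?_⟩
      by_cases hx : x = 0
      · simp [hx]
      have hn : 0 < ‖x‖ := norm_pos_iff.2 hx
      have h1 : p x0 ≤ p (‖x‖⁻¹ • x) := hmin (by
        simp [norm_smul, hn.ne'])
      rw [map_smul_eq_mul, norm_inv, norm_norm, inv_mul_eq_div, le_div_iff₀ hn] at h1
      exact h1
  obtain ⟨c, hc0, hc⟩ := low
  have : ProperSpace (V →L[ℝ] V) := FiniteDimensional.proper ℝ _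
  set K : Set (V →L[ℝ] V) := {T | ∀ x, p (T x) ≤ ‖x‖} with hK
  have hKc : IsCompact K := by
    refine Metric.isCompact_of_isClosed_isBounded ?_ ?_
    · rw [hK, Set.ofPred_forall]
      refine isClosed_iInter fun x => isClosed_le (hpc.comp ?_) continuous_const
      exact (ContinuousLinearMap.apply ℝ V x).continuous
    · refine (Metric.isBounded_iff_subset_closedBall 0).2 ⟨c⁻¹, fun T hT => ?_⟩
      rw [mem_closedBall_zero_iff]
      refine T.opNorm_le_bound (by positivity) fun x => ?_
      rw [inv_mul_eq_div, le_div_iff₀ hc0, mul_comm]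
      exact (hc _).trans (hT x)
  have hne : (C⁻¹ • ContinuousLinearMap.id ℝ V) ∈ K := fun x => by
    change p (C⁻¹ • x) ≤ _
    rw [map_smul_eq_mul, norm_inv, Real.norm_of_nonneg hC0.le, inv_mul_le_iff₀ hC0]
    exact hC x
  obtain ⟨T, hT, hmax⟩ := hKc.exists_isMaxOn ⟨_, hne⟩
    (ContinuousLinearMap.continuous_det.abs.continuousOn (s := K))
  have hm : ∀ S : V →ₗ[ℝ] V, (∀ x, p (S x) ≤ ‖x‖) →
      |LinearMap.det S| ≤ |LinearMap.det (T : V →ₗ[ℝ] V)| := fun S hS =>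
    hmax (show LinearMap.toContinuousLinearMap S ∈ K from hS)
  refine ⟨T, hT, fun h0 => ?_, hm⟩
  have h1 := hm (C⁻¹ • LinearMap.id) hne
  rw [h0, LinearMap.det_smul, LinearMap.det_id, abs_zero, mul_one] at h1
  exact absurd h1 (not_le.2 (abs_pos.2 (pow_ne_zero _ (inv_ne_zero hC0.ne'))))

lemma exists_orthonormalBasis_of_max_det {n : ℕ} (hn : Module.finrank ℝ V = n) (p : Seminorm ℝ V)
    {T : V →ₗ[ℝ] V} (hT : ∀ x, p (T x) ≤ ‖x‖) (h0 : LinearMap.det T ≠ 0)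
    (hmax : ∀ S : V →ₗ[ℝ] V, (∀ x, p (S x) ≤ ‖x‖) → |LinearMap.det S| ≤ |LinearMap.det T|)
    (j : ℕ) (hj : 2 * j ≤ n) :
    ∃ b : OrthonormalBasis (Fin n) ℝ V, ∀ i : Fin n, (i : ℕ) < j → 1 / 4 ≤ p (T (b i)) := by
  induction j with
  | zero => exact ⟨(stdOrthonormalBasis ℝ V).reindex (finCongr hn), fun i hi => absurd hi (by simp)⟩
  | succ j ih =>
    obtain ⟨b, hb⟩ := ih (by omega)
    have key : ∃ v : V, ‖v‖ = 1 ∧ (∀ i : Fin n, (i : ℕ) < j → inner ℝ (b i) v = 0) ∧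
        1 / 4 ≤ p (T v) := by
      by_contra! hcon
      have hW : ∀ w : V, (∀ i : Fin n, (i : ℕ) < j → inner ℝ (b i) w = 0) →
          p (T w) ≤ 1 / 4 * ‖w‖ := fun w hw => by
        by_cases hw0 : w = 0
        · simp [hw0]
        have hn0 : 0 < ‖w‖ := norm_pos_iff.2 hw0
        have h1 := hcon (‖w‖⁻¹ • w) (by simp [norm_smul, hn0.ne']) fun i hi => by
          rw [inner_smul_right, hw i hi, mul_zero]
        rw [map_smul, map_smul_eq_mul, norm_inv, norm_norm, inv_mul_eq_div, div_lt_iff₀ hn0] at h1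
        exact h1.le
      set d : Fin n → ℝ := fun i => if (i : ℕ) < j then 3 / 5 else 16 / 5 with hd
      set D : V →ₗ[ℝ] V := b.toBasis.constr ℝ fun i => d i • b i with hD
      have hDb : ∀ i, D (b i) = d i • b i := fun i => by
        have := b.toBasis.constr_basis ℝ (fun i => d i • b i) i
        rwa [b.coe_toBasis] at this
      have hdet : LinearMap.det D = ∏ i, d i := by
        rw [← LinearMap.det_toMatrix b.toBasis, ← Matrix.det_diagonal]
        congr 1
        ext k l
        rw [LinearMap.toMatrix_apply, b.coe_toBasis, hDb, b.coe_toBasis_repr_apply, map_smul,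
          b.repr_self]
        by_cases hkl : k = l
        · subst hkl; simp
        · simp [hkl]
      have hdet1 : 1 < LinearMap.det D := by
        rw [hdet]
        have hp : ∏ i, d i = (3 / 5) ^ j * (16 / 5) ^ (n - j) := by
          rw [hd, Finset.prod_ite, Finset.prod_const, Finset.prod_const]
          have c1 : (Finset.univ.filter fun i : Fin n => (i : ℕ) < j).card = j := by
            rw [Fin.card_filter_val_lt]; omega
          have c2 := Finset.card_filter_add_card_filter_not (s := (Finset.univ : Finset (Fin n)))
            (fun i : Fin n => (i : ℕ) < j)
          rw [c1, Finset.card_univ, Fintype.card_fin] at c2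
          rw [c1, show (Finset.univ.filter fun i : Fin n => ¬ (i : ℕ) < j).card = n - j by omega]
        rw [hp, show n - j = j + (n - 2 * j - 1 + 1) by omega, pow_add, ← mul_assoc, ← mul_pow]
        refine one_lt_mul_of_le_of_lt (one_le_pow₀ (by norm_num))
          (one_lt_pow₀ (by norm_num) (by omega))
      have hS : ∀ x, p ((T ∘ₗ D) x) ≤ ‖x‖ := fun x => by
        set y := ∑ i : Fin n, (if (i : ℕ) < j then inner ℝ (b i) x else 0) • b i with hy
        set w := ∑ i : Fin n, (if (i : ℕ) < j then 0 else inner ℝ (b i) x) • b i with hw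
        have hx : x = y + w := by
          rw [hy, hw, ← Finset.sum_add_distrib]
          conv_lhs => rw [← b.sum_repr' x]
          refine Finset.sum_congr rfl fun i _ => ?_
          split_ifs <;> simp
        have hDx : D x = (3 / 5 : ℝ) • y + (16 / 5 : ℝ) • w := by
          conv_lhs => rw [← b.sum_repr' x]
          rw [map_sum, hy, hw, Finset.smul_sum, Finset.smul_sum, ← Finset.sum_add_distrib]
          refine Finset.sum_congr rfl fun i _ => ?_
          rw [map_smul, hDb]
          simp only [hd]
          split_ifs <;> simp [smul_smul, mul_comm]
        have hwi : ∀ i : Fin n, (i : ℕ) < j → inner ℝ (b i) w = 0 := fun i hi => by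
          rw [hw, b.orthonormal.inner_right_fintype, if_pos hi]
        have hyw : inner ℝ y w = 0 := by
          rw [hy, sum_inner]
          refine Finset.sum_eq_zero fun i _ => ?_
          split_ifs with hi
          · rw [inner_smul_left, hwi i hi, mul_zero]
          · simp
        have hnorm : ‖x‖ ^ 2 = ‖y‖ ^ 2 + ‖w‖ ^ 2 := by
          rw [hx, pow_two, pow_two, pow_two]
          exact norm_add_sq_eq_norm_sq_add_norm_sq_of_inner_eq_zero y w hyw
        change p (T (D x)) ≤ _
        rw [hDx, map_add, map_smul, map_smul]
        have h1 : p ((3 / 5 : ℝ) • T y + (16 / 5 : ℝ) • T w) ≤ 3 / 5 * ‖y‖ + 16 / 5 * (1 / 4 * ‖w‖) := by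
          refine (map_add_le_add p _ _).trans ?_
          rw [map_smul_eq_mul, map_smul_eq_mul, Real.norm_of_nonneg (by norm_num),
            Real.norm_of_nonneg (by norm_num)]
          gcongr
          · exact hT y
          · exact hW w hwi
        refine h1.trans (abs_le_of_sq_le_sq' ?_ (norm_nonneg x)).2
        rw [hnorm]
        nlinarith [sq_nonneg (4 * ‖y‖ - 3 * ‖w‖)]
      have h2 := hmax _ hS
      rw [LinearMap.det_comp, abs_mul, abs_of_pos (zero_lt_one.trans hdet1)] at h2
      have h3 := abs_pos.2 h0
      nlinarith
    obtain ⟨v, hv1, hv2, hv3⟩ := key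
    set jj : Fin n := ⟨j, by omega⟩ with hjj
    have ho : Orthonormal ℝ ((Set.Iic jj).domRestrict (Function.update (b : Fin n → V) jj v)) := by
      rw [orthonormal_iff_ite]
      rintro ⟨k, hk⟩ ⟨l, hl⟩
      simp only [Subtype.mk.injEq]
      change inner ℝ (Function.update (b : Fin n → V) jj v k)
        (Function.update (b : Fin n → V) jj v l) = _
      have lt : ∀ k : Fin n, k ∈ Set.Iic jj → k ≠ jj → (k : ℕ) < j := fun k hk hne => by
        have : k < jj := lt_of_le_of_ne hk hne
        exact this
      by_cases h1 : k = jj <;> by_cases h2 : l = jj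
      · rw [h1, h2, Function.update_self, real_inner_self_eq_norm_sq, hv1]; simp
      · rw [h1, Function.update_self, Function.update_of_ne h2, real_inner_comm, hv2 l (lt l hl h2),
          if_neg (Ne.symm h2)]
      · rw [h2, Function.update_self, Function.update_of_ne h1, hv2 k (lt k hk h1), if_neg h1]
      · rw [Function.update_of_ne h1, Function.update_of_ne h2]
        exact orthonormal_iff_ite.1 b.orthonormal k l
    obtain ⟨b', hb'⟩ := ho.exists_orthonormalBasis_extension_of_card_eq (by simp [hn])
    refine ⟨b', fun i hi => ?_⟩
    have hi' : i ≤ jj := by rw [Fin.le_def, hjj]; simp only; omega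
    rw [hb' i hi']
    by_cases h : i = jj
    · rw [h, Function.update_self]; exact hv3
    · rw [Function.update_of_ne h]
      refine hb i ?_
      have : i < jj := lt_of_le_of_ne hi' h
      exact this

end MaximalDeterminant

lemma exists_position {n : ℕ} (N : Seminorm ℝ (Fin n → ℝ)) (hN : ∀ x, N x = 0 → x = 0) {m : ℕ}
    (hm : 2 * m ≤ n) :
    ∃ L : (Fin m → ℝ) →ₗ[ℝ] (Fin n → ℝ), Function.Injective L ∧ (∀ x, N (L x) ≤ euclNorm x) ∧
      ∀ i, 1 / 4 ≤ N (L (Pi.single i 1)) := by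
  set e := WithLp.linearEquiv 2 ℝ (Fin n → ℝ) with he
  set p : Seminorm ℝ (EuclideanSpace ℝ (Fin n)) := N.comp e.toLinearMap with hp
  have hpc : Continuous p := (seminorm_continuous N).comp (PiLp.continuous_ofLp 2 _)
  obtain ⟨T, h1, h2, h3⟩ := exists_max_det p hpc fun x hx => by
    have := hN (e x) hx
    simpa using this
  obtain ⟨b, hb⟩ := exists_orthonormalBasis_of_max_det (n := n) (by simp) p h1 h2 h3 m hm
  set c : Fin m → EuclideanSpace ℝ (Fin n) := fun i => b (Fin.castLE (by omega) i) with hc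
  have ho : Orthonormal ℝ c := b.orthonormal.comp _ (Fin.castLE_injective _)
  have hTi : Function.Injective T := LinearMap.ker_eq_bot.1 (not_not.1 fun h =>
    h2 (LinearMap.det_eq_zero_iff_ker_ne_bot.2 h))
  refine ⟨e.toLinearMap ∘ₗ T ∘ₗ Fintype.linearCombination ℝ c, ?_, fun x => ?_, fun i => ?_⟩
  · exact e.injective.comp (hTi.comp
      (linearIndependent_iff_injective_fintypeLinearCombination.1 ho.linearIndependent))
  · refine (h1 (Fintype.linearCombination ℝ c x)).trans_eq ?_
    rw [Fintype.linearCombination_apply, euclNorm, eq_comm, Real.sqrt_eq_iff_mul_self_eq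
      (Finset.sum_nonneg fun i _ => sq_nonneg _) (norm_nonneg _), ← real_inner_self_eq_norm_mul_norm,
      ho.inner_sum]
    simp [pow_two]
  · change _ ≤ p (T (Fintype.linearCombination ℝ c _))
    rw [Fintype.linearCombination_apply_single, one_smul]
    exact hb _ i.2

section Net

variable {V : Type*} [NormedAddCommGroup V] [InnerProductSpace ℝ V] [FiniteDimensional ℝ V]

lemma card_le_of_separated {s : Finset V} {e : ℝ} (he : 0 < e) (hs : ∀ c ∈ s, ‖c‖ = 1)
    (h : ∀ c ∈ s, ∀ d ∈ s, c ≠ d → e ≤ ‖c - d‖) :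
    (s.card : ℝ) ≤ (1 + 2 / e) ^ Module.finrank ℝ V := by
  borelize V
  let μ : Measure V := Measure.addHaar
  set δ : ℝ := e / 2 with hδ
  set ρ : ℝ := 1 + e / 2 with hρ
  have δpos : 0 < δ := by positivity
  have ρpos : 0 < ρ := by positivity
  set A := ⋃ c ∈ s, Metric.ball (c : V) δ with hA
  have D : Set.Pairwise (s : Set V) (Function.onFun Disjoint fun c => Metric.ball (c : V) δ) := by
    rintro c hc d hd hcd
    apply Metric.ball_disjoint_ball
    rw [dist_eq_norm, hδ, add_halves]
    exact h c hc d hd hcd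
  have A_subset : A ⊆ Metric.ball (0 : V) ρ := by
    refine Set.iUnion₂_subset fun x hx => ?_
    apply Metric.ball_subset_ball'
    rw [dist_zero_right, hs x hx, hδ, hρ, add_comm]
  have I : (s.card : ENNReal) * ENNReal.ofReal (δ ^ Module.finrank ℝ V) * μ (Metric.ball 0 1) ≤
      ENNReal.ofReal (ρ ^ Module.finrank ℝ V) * μ (Metric.ball 0 1) :=
    calc
      (s.card : ENNReal) * ENNReal.ofReal (δ ^ Module.finrank ℝ V) * μ (Metric.ball 0 1) = μ A := by
        rw [hA, measure_biUnion_finset D fun c _ => measurableSet_ball]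
        simp only [μ.addHaar_ball_of_pos _ δpos]
        simp only [Finset.sum_const, nsmul_eq_mul, mul_assoc]
      _ ≤ μ (Metric.ball (0 : V) ρ) := measure_mono A_subset
      _ = ENNReal.ofReal (ρ ^ Module.finrank ℝ V) * μ (Metric.ball 0 1) := by
        simp only [μ.addHaar_ball_of_pos _ ρpos]
  have J : (s.card : ENNReal) * ENNReal.ofReal (δ ^ Module.finrank ℝ V)
      ≤ ENNReal.ofReal (ρ ^ Module.finrank ℝ V) :=
    (ENNReal.mul_le_mul_iff_left (Metric.measure_ball_pos _ _ zero_lt_one).ne'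
      measure_ball_lt_top.ne).1 I
  have K := ENNReal.toReal_le_of_le_ofReal (pow_nonneg ρpos.le _) J
  rw [ENNReal.toReal_mul, ENNReal.toReal_natCast, ENNReal.toReal_ofReal (by positivity),
    ← le_div_iff₀ (by positivity), ← div_pow] at K
  refine K.trans_eq ?_
  congr 1
  rw [hρ, hδ]
  field_simp
  ring

lemma exists_net {e : ℝ} (he : 0 < e) :
    ∃ s : Finset V, (∀ c ∈ s, ‖c‖ = 1) ∧ (∀ x : V, ‖x‖ = 1 → ∃ c ∈ s, ‖x - c‖ < e) ∧
      (s.card : ℝ) ≤ (1 + 2 / e) ^ Module.finrank ℝ V := by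
  classical
  set P : Finset V → Prop := fun s => (∀ c ∈ s, ‖c‖ = 1) ∧
    ∀ c ∈ s, ∀ d ∈ s, c ≠ d → e ≤ ‖c - d‖ with hP
  have hb : BddAbove {q | ∃ s : Finset V, P s ∧ s.card = q} :=
    ⟨⌊(1 + 2 / e) ^ Module.finrank ℝ V⌋₊, by
      rintro _ ⟨s, hs, rfl⟩
      exact Nat.le_floor (card_le_of_separated he hs.1 hs.2)⟩
  have hne : {q | ∃ s : Finset V, P s ∧ s.card = q}.Nonempty := ⟨0, ∅, by simp [hP], by simp⟩
  obtain ⟨s, hs, hcard⟩ := Nat.sSup_mem hne hb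
  refine ⟨s, hs.1, fun x hx => ?_, card_le_of_separated he hs.1 hs.2⟩
  by_contra! hcon
  have hxs : x ∉ s := fun h => by
    have := hcon x h
    rw [sub_self, norm_zero] at this
    linarith
  have hins : P (insert x s) := by
    refine ⟨fun c hc => ?_, fun c hc d hd hcd => ?_⟩
    · rcases Finset.mem_insert.1 hc with rfl | hc
      · exact hx
      · exact hs.1 c hc
    · rcases Finset.mem_insert.1 hc with h1 | h1 <;> rcases Finset.mem_insert.1 hd with h2 | h2
      · exact absurd (h1.trans h2.symm) hcd
      · exact h1 ▸ hcon d h2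
      · rw [norm_sub_rev]; exact h2 ▸ hcon c h1
      · exact hs.2 c h1 d h2 hcd
  have := le_csSup hb ⟨_, hins, rfl⟩
  rw [Finset.card_insert_of_notMem hxs, ← hcard] at this
  omega

lemma seminorm_bounds_of_net {g : Seminorm ℝ V} (hg : Continuous g) {s : Finset V} {ε M : ℝ}
    (h0 : 0 < ε) (h1 : ε < 1 / 2) (hM : 0 < M) (hnet : ∀ x : V, ‖x‖ = 1 → ∃ c ∈ s, ‖x - c‖ < ε / 4)
    (h : ∀ c ∈ s, |g c - M| < ε / 4 * M) (x : V) :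
    (1 - ε) * M * ‖x‖ ≤ g x ∧ g x ≤ (1 + ε) * M * ‖x‖ := by
  rcases subsingleton_or_nontrivial V with hV | hV
  · simp [Subsingleton.elim x 0]
  have := FiniteDimensional.proper ℝ V
  obtain ⟨x0, hx0, hmax⟩ := (isCompact_sphere (0 : V) 1).exists_isMaxOn
    (NormedSpace.sphere_nonempty.2 zero_le_one) hg.continuousOn
  have hx1 : ‖x0‖ = 1 := by simpa using hx0
  have hB : ∀ z, g z ≤ g x0 * ‖z‖ := fun z => by
    by_cases hz : z = 0
    · simp [hz]
    have hn : 0 < ‖z‖ := norm_pos_iff.2 hz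
    have h1 : g (‖z‖⁻¹ • z) ≤ g x0 := hmax (by simp [norm_smul, hn.ne'])
    rwa [map_smul_eq_mul, norm_inv, norm_norm, inv_mul_eq_div, div_le_iff₀ hn] at h1
  have hB0 := apply_nonneg g x0
  have up : ∀ z, ‖z‖ = 1 → g z ≤ (1 + ε / 4) * M + g x0 * (ε / 4) ∧
      (1 - ε / 4) * M - g x0 * (ε / 4) ≤ g z := fun z hz => by
    obtain ⟨c, hc, hzc⟩ := hnet z hz
    have h2 := abs_lt.1 (h c hc)
    have h3 := (hB (z - c)).trans (mul_le_mul_of_nonneg_left hzc.le hB0)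
    have h4 := abs_le.1 (abs_sub_map_le_sub g z c)
    constructor <;> nlinarith
  have hx0M : g x0 ≤ (1 + ε) * M := by
    have := (up x0 hx1).1
    nlinarith [mul_pos h0 hM, mul_pos (mul_pos h0 hM) (sub_pos.2 h1)]
  refine ⟨?_, (hB x).trans (mul_le_mul_of_nonneg_right hx0M (norm_nonneg x))⟩
  by_cases hx : x = 0
  · simp [hx]
  have hn : 0 < ‖x‖ := norm_pos_iff.2 hx
  have h2 := (up (‖x‖⁻¹ • x) (by simp [norm_smul, hn.ne'])).2
  rw [map_smul_eq_mul, norm_inv, norm_norm, inv_mul_eq_div, le_div_iff₀ hn] at h2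
  refine le_trans (mul_le_mul_of_nonneg_right ?_ hn.le) h2
  nlinarith [mul_pos h0 hM, mul_pos (mul_pos h0 hM) (sub_pos.2 h1)]

end Net

lemma map_inner_gauss {k : ℕ} {x : Fin k → ℝ} (hx : ∑ i, x i ^ 2 = 1) :
    MeasurePreserving (fun g : Fin k → ℝ => ∑ i, x i * g i) (gauss k) (gaussianReal 0 1) := by
  have hm : Measurable (fun g : Fin k → ℝ => ∑ i, x i * g i) := by fun_prop
  refine ⟨hm, ?_⟩
  have := Measure.isProbabilityMeasure_map (μ := gauss k) hm.aemeasurable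
  refine Measure.ext_of_charFun ?_
  ext t
  rw [charFun_gaussianReal, charFun_apply_real, integral_map hm.aemeasurable (by fun_prop)]
  have e : ∀ g : Fin k → ℝ, Complex.exp (t * (∑ i, x i * g i : ℝ) * Complex.I)
      = ∏ i, Complex.exp ((t * x i : ℝ) * (g i : ℝ) * Complex.I) := fun g => by
    rw [← Complex.exp_sum]
    congr 1
    push_cast
    rw [Finset.mul_sum, Finset.sum_mul]
    exact Finset.sum_congr rfl fun i _ => by ring
  simp only [e]
  rw [integral_fintype_prod_eq_prod (f := fun i (y : ℝ) =>
    Complex.exp ((t * x i : ℝ) * (y : ℝ) * Complex.I))]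
  simp only [← charFun_apply_real, charFun_gaussianReal]
  rw [← Complex.exp_sum]
  congr 1
  have hx' : ∑ i, (x i : ℂ) ^ 2 = 1 := by exact_mod_cast hx
  simp only [Complex.ofReal_zero, mul_zero, zero_mul, zero_sub, NNReal.coe_one, Complex.ofReal_one,
    one_mul, Finset.sum_neg_distrib, Complex.ofReal_mul, mul_pow]
  rw [← Finset.sum_div, ← Finset.mul_sum, hx', mul_one]

/-- A Gaussian matrix acts well on every point of a small set of unit vectors simultaneously. -/
lemma exists_matrix_of_card_lt {m k : ℕ} (s : Finset (EuclideanSpace ℝ (Fin k)))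
    (hs : ∀ c ∈ s, ‖c‖ = 1) (h : Seminorm ℝ (Fin m → ℝ)) {r M δ : ℝ}
    (hδ : (gauss m).real {x | r ≤ |h x - M|} ≤ δ) (hc : s.card * δ < 1) :
    ∃ L : EuclideanSpace ℝ (Fin k) →ₗ[ℝ] (Fin m → ℝ), ∀ c ∈ s, |h (L c) - M| < r := by
  set μ : Measure (Fin m → Fin k → ℝ) := Measure.pi fun _ => gauss k with hμ
  set F : EuclideanSpace ℝ (Fin k) → (Fin m → Fin k → ℝ) → Fin m → ℝ :=
    fun c G j => ∑ i, c i * G j i with hF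
  have hmp : ∀ c ∈ s, MeasurePreserving (F c) μ (gauss m) := fun c hc => by
    have h1 : ∑ i, c i ^ 2 = 1 := by
      have := EuclideanSpace.real_norm_sq_eq c
      rw [hs c hc] at this
      linarith
    exact measurePreserving_pi _ _ fun _ => map_inner_gauss h1
  have hms : MeasurableSet {x | r ≤ |h x - M|} := measurableSet_le measurable_const
    (((seminorm_continuous h).measurable.sub_const M).abs)
  have hbad : μ.real (⋃ c ∈ s, F c ⁻¹' {x | r ≤ |h x - M|}) < 1 := by
    refine lt_of_le_of_lt (measureReal_biUnion_finset_le s _) ?_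
    refine lt_of_le_of_lt (Finset.sum_le_card_nsmul s _ δ fun c hc => ?_) (by simpa using hc)
    rw [(hmp c hc).measureReal_preimage hms.nullMeasurableSet]
    exact hδ
  obtain ⟨G, hG⟩ : ∃ G, G ∉ ⋃ c ∈ s, F c ⁻¹' {x | r ≤ |h x - M|} := by
    by_contra! hcon
    rw [Set.eq_univ_of_forall hcon, probReal_univ] at hbad
    exact lt_irrefl _ hbad
  refine ⟨{ toFun := fun c => F c G, map_add' := fun c d => ?_, map_smul' := fun a c => ?_ },
    fun c hc => ?_⟩
  · ext j; simp [hF, add_mul, Finset.sum_add_distrib]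
  · ext j; simp [hF, Finset.mul_sum, mul_assoc]
  · simp only [Set.mem_iUnion, not_exists] at hG
    exact not_le.1 (hG c hc)

lemma exists_convex_eq {x y μ : ℝ} (h1 : y ≤ μ) (h2 : μ ≤ x) :
    ∃ p q : ℝ, p * p + q * q = 1 ∧ p * p * x + q * q * y = μ := by
  rcases eq_or_lt_of_le (h1.trans h2) with h | h
  · exact ⟨1, 0, by norm_num, by linarith⟩
  have hd : 0 < x - y := sub_pos.2 h
  refine ⟨√((μ - y) / (x - y)), √((x - μ) / (x - y)), ?_, ?_⟩ <;>
    rw [Real.mul_self_sqrt (div_nonneg (by linarith) hd.le),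
      Real.mul_self_sqrt (div_nonneg (by linarith) hd.le)] <;> field_simp <;> ring

lemma exists_isometric_section {n r : ℕ}
    (S : EuclideanSpace ℝ (Fin (2 * r)) →ₗ[ℝ] EuclideanSpace ℝ (Fin n))
    (hS : Function.Injective S) :
    ∃ a > 0, ∃ F : Submodule ℝ (EuclideanSpace ℝ (Fin (2 * r))),
      Module.finrank ℝ F = r ∧ ∀ x ∈ F, ‖S x‖ = a * ‖x‖ := by
  rcases Nat.eq_zero_or_pos r with rfl | hr
  · refine ⟨1, one_pos, ⊥, by simp, fun x hx => ?_⟩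
    rw [(Submodule.mem_bot ℝ).1 hx]
    simp
  have hT : (LinearMap.adjoint S ∘ₗ S).IsSymmetric := fun x y => by
    simp [LinearMap.adjoint_inner_left, LinearMap.adjoint_inner_right]
  have hk : Module.finrank ℝ (EuclideanSpace ℝ (Fin (2 * r))) = 2 * r := by simp
  set v := hT.eigenvectorBasis hk with hv
  set l := hT.eigenvalues hk with hl
  have hanti : Antitone l := hT.eigenvalues_antitone hk
  have hvi : ∀ i j, inner ℝ (v i) (v j) = if i = j then (1 : ℝ) else 0 :=
    orthonormal_iff_ite.1 v.orthonormal
  have hSv : ∀ i j, inner ℝ (S (v i)) (S (v j)) = if i = j then l j else (0 : ℝ) := fun i j => by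
    have h1 : (LinearMap.adjoint S ∘ₗ S) (v j) = l j • v j :=
      hT.apply_eigenvectorBasis hk j
    rw [← LinearMap.adjoint_inner_right S]
    change inner ℝ (v i) ((LinearMap.adjoint S ∘ₗ S) (v j)) = _
    rw [h1, inner_smul_right, hvi]
    simp
  let a : Fin r → Fin (2 * r) := fun i => ⟨i, by omega⟩
  let b : Fin r → Fin (2 * r) := fun i => ⟨2 * r - 1 - i, by omega⟩
  have haa : ∀ i j, a i = a j ↔ i = j := fun i j => by simp only [a, Fin.ext_iff]
  have hbb : ∀ i j, b i = b j ↔ i = j := fun i j => by simp only [b, Fin.ext_iff]; omega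
  have hab : ∀ i j, a i ≠ b j := fun i j => by simp only [a, b, ne_eq, Fin.ext_iff]; omega
  set m : Fin (2 * r) := ⟨r, by omega⟩ with hm
  have hpos : 0 < l m := by
    have h1 := hSv m m
    rw [if_pos rfl, real_inner_self_eq_norm_sq] at h1
    rw [← h1]
    refine pow_pos (norm_pos_iff.2 fun h => ?_) 2
    have := hvi m m
    rw [(map_eq_zero_iff S hS).1 h] at this
    simp at this
  choose p q hpq hpl using fun i : Fin r => exists_convex_eq
    (hanti (show m ≤ b i by simp only [hm, b, Fin.le_def]; omega))
    (hanti (show a i ≤ m by simp only [hm, a, Fin.le_def]; omega))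
  set w : Fin r → EuclideanSpace ℝ (Fin (2 * r)) := fun i => p i • v (a i) + q i • v (b i) with hw
  have hwi : ∀ i j, inner ℝ (w i) (w j) = if i = j then (1 : ℝ) else 0 := fun i j => by
    simp only [hw, inner_add_left, inner_add_right, inner_smul_left, inner_smul_right, hvi, haa,
      hbb, hab, (hab _ _).symm, if_false]
    split_ifs with h
    · subst h
      simpa using hpq i
    · simp
  have hwS : ∀ i j, inner ℝ (S (w i)) (S (w j)) = l m * inner ℝ (w i) (w j) := fun i j => by
    rw [hwi]
    simp only [hw, map_add, map_smul, inner_add_left, inner_add_right, inner_smul_left,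
      inner_smul_right, hSv, haa, hbb, hab, (hab _ _).symm, if_false]
    split_ifs with h
    · subst h
      have := hpl i
      simp
      linarith
    · simp
  have hon : Orthonormal ℝ w := orthonormal_iff_ite.2 hwi
  refine ⟨√(l m), Real.sqrt_pos.2 hpos, Submodule.span ℝ (Set.range w), ?_, fun x hx => ?_⟩
  · rw [finrank_span_eq_card hon.linearIndependent, Fintype.card_fin]
  have key : ∀ y ∈ Submodule.span ℝ (Set.range w), ∀ z ∈ Submodule.span ℝ (Set.range w),
      inner ℝ (S y) (S z) = l m * inner ℝ y z := by
    intro y hy z hz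
    induction hy using Submodule.span_induction with
    | mem y hy =>
      obtain ⟨i, rfl⟩ := hy
      induction hz using Submodule.span_induction with
      | mem z hz =>
        obtain ⟨j, rfl⟩ := hz
        exact hwS i j
      | zero => simp
      | add y z _ _ h1 h2 => simp only [map_add, inner_add_right, h1, h2]; ring
      | smul t y _ h1 => simp only [map_smul, inner_smul_right, h1]; ring
    | zero => simp
    | add y z _ _ h1 h2 => simp only [map_add, inner_add_left, h1, h2]; ring
    | smul t y _ h1 => simp only [map_smul, inner_smul_left, h1]; simp; ring
  have h2 := key x hx x hx
  rw [real_inner_self_eq_norm_sq, real_inner_self_eq_norm_sq] at h2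
  rw [← Real.sqrt_sq (norm_nonneg (S x)), h2, Real.sqrt_mul hpos.le, Real.sqrt_sq (norm_nonneg x)]

lemma norm_toLp_eq_euclNorm {n : ℕ} (x : Fin n → ℝ) : ‖WithLp.toLp 2 x‖ = euclNorm x := by
  rw [EuclideanSpace.norm_eq]
  simp [euclNorm]

lemma exists_euclNorm_section {n r : ℕ} (S : EuclideanSpace ℝ (Fin (2 * r)) →ₗ[ℝ] (Fin n → ℝ))
    (hS : Function.Injective S) :
    ∃ a > 0, ∃ F : Submodule ℝ (EuclideanSpace ℝ (Fin (2 * r))),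
      Module.finrank ℝ F = r ∧ ∀ x ∈ F, euclNorm (S x) = a * ‖x‖ := by
  obtain ⟨a, ha, F, hF, h⟩ := exists_isometric_section
    ((WithLp.linearEquiv 2 ℝ (Fin n → ℝ)).symm.toLinearMap ∘ₗ S)
    ((WithLp.linearEquiv 2 ℝ (Fin n → ℝ)).symm.injective.comp hS)
  refine ⟨a, ha, F, hF, fun x hx => ?_⟩
  rw [← h x hx, ← norm_toLp_eq_euclNorm]
  rfl

lemma euclNorm_smul {n : ℕ} (t : ℝ) (x : Fin n → ℝ) : euclNorm (t • x) = |t| * euclNorm x := by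
  rw [← norm_toLp_eq_euclNorm, ← norm_toLp_eq_euclNorm, WithLp.toLp_smul, norm_smul,
    Real.norm_eq_abs]

lemma euclNorm_pos {n : ℕ} {x : Fin n → ℝ} (hx : x ≠ 0) : 0 < euclNorm x := by
  rw [← norm_toLp_eq_euclNorm]
  simpa using hx

lemma exists_line {n : ℕ} (hn : 1 ≤ n) (N : Seminorm ℝ (Fin n → ℝ)) (hN : ∀ x, N x = 0 → x = 0)
    {ε : ℝ} (h0 : 0 < ε) :
    ∃ E : Submodule ℝ (Fin n → ℝ), Module.finrank ℝ E = 1 ∧ ∃ a > (0 : ℝ), ∀ x ∈ E,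
      (1 - ε) * a * euclNorm x ≤ N x ∧ N x ≤ (1 + ε) * a * euclNorm x := by
  set v : Fin n → ℝ := Pi.single ⟨0, hn⟩ 1 with hv
  have hv0 : v ≠ 0 := by simp [hv]
  have hNv : 0 < N v := (apply_nonneg N v).lt_of_ne' fun h => hv0 (hN v h)
  have hev := euclNorm_pos hv0
  refine ⟨ℝ ∙ v, finrank_span_singleton hv0, N v / euclNorm v, div_pos hNv hev, fun x hx => ?_⟩
  obtain ⟨t, rfl⟩ := Submodule.mem_span_singleton.1 hx
  have h : N v / euclNorm v * euclNorm (t • v) = N (t • v) := by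
    rw [euclNorm_smul, map_smul_eq_mul, Real.norm_eq_abs]
    field_simp
  have hp := apply_nonneg N (t • v)
  rw [mul_assoc, mul_assoc, h]
  constructor <;> nlinarith

lemma exists_subspace_of_concentration {c : ℝ} {s n r : ℕ}
    (hc : ∀ f : Seminorm ℝ (Fin (2 ^ (64 * s)) → ℝ), (∀ x, f x ≤ euclNorm x) →
      (∀ i, 1 / 4 ≤ f (Pi.single i 1)) → ∃ A : Finset (Fin (2 ^ (64 * s))), ∃ M : ℝ, 0 < M ∧
        ∀ ε : ℝ, 0 ≤ ε → ε ≤ 1 / 2 → (gauss (2 ^ (64 * s))).real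
          {x | ε * M ≤ |f.comp (coordProj A) x - M|} ≤ 2 * rexp (2 - c * ε * s))
    (hn : 2 * 2 ^ (64 * s) ≤ n) (N : Seminorm ℝ (Fin n → ℝ)) (hN : ∀ x, N x = 0 → x = 0)
    {ε : ℝ} (h0 : 0 < ε) (h1 : ε < 1 / 2)
    (hr : (1 + 8 / ε) ^ (2 * r) * (2 * rexp (2 - c * (ε / 4) * s)) < 1) :
    ∃ E : Submodule ℝ (Fin n → ℝ), Module.finrank ℝ E = r ∧ ∃ a > (0 : ℝ), ∀ x ∈ E,
      (1 - ε) * a * euclNorm x ≤ N x ∧ N x ≤ (1 + ε) * a * euclNorm x := by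
  obtain ⟨L, hL, hLu, hLl⟩ := exists_position N hN hn
  obtain ⟨A, M, hM, hA⟩ := hc (N.comp L) hLu hLl
  obtain ⟨S, hS1, hSnet, hScard⟩ := exists_net (V := EuclideanSpace ℝ (Fin (2 * r)))
    (e := ε / 4) (by positivity)
  have hScard' : (S.card : ℝ) ≤ (1 + 8 / ε) ^ (2 * r) := by
    refine hScard.trans_eq ?_
    rw [finrank_euclideanSpace, Fintype.card_fin]
    congr 2
    field_simp
    norm_num
  obtain ⟨G, hG⟩ := exists_matrix_of_card_lt S hS1 ((N.comp L).comp (coordProj A))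
    (hA (ε / 4) (by positivity) (by linarith))
    ((mul_le_mul_of_nonneg_right hScard' (by positivity)).trans_lt hr)
  set T : EuclideanSpace ℝ (Fin (2 * r)) →ₗ[ℝ] (Fin n → ℝ) := L ∘ₗ coordProj A ∘ₗ G with hT
  have hcont : Continuous (N.comp T) :=
    (seminorm_continuous N).comp T.continuous_of_finiteDimensional
  have hb := seminorm_bounds_of_net hcont h0 h1 hM hSnet hG
  have hTi : Function.Injective T := by
    rw [injective_iff_map_eq_zero]
    intro x hx
    by_contra hx0
    have h := (hb x).1
    have : (N.comp T) x = 0 := by rw [Seminorm.comp_apply, hx, map_zero]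
    rw [this] at h
    have : 0 < (1 - ε) * M * ‖x‖ :=
      mul_pos (mul_pos (by linarith) hM) (norm_pos_iff.2 hx0)
    linarith
  obtain ⟨a, ha, F, hF, hFa⟩ := exists_euclNorm_section T hTi
  refine ⟨F.map T, ?_, M / a, div_pos hM ha, ?_⟩
  · rw [← (F.equivMapOfInjective T hTi).finrank_eq, hF]
  · rintro _ ⟨x, hx, rfl⟩
    have h := hb x
    have h2 : M / a * euclNorm (T x) = M * ‖x‖ := by
      rw [hFa x hx]
      field_simp
    rw [mul_assoc, mul_assoc, h2, ← mul_assoc, ← mul_assoc]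
    exact h

lemma net_card_mul_exp_lt {c ε : ℝ} {s r : ℕ} (hr : 1 ≤ r) (h0 : 0 < ε) (h1 : ε < 1 / 2)
    (h : (r : ℝ) ≤ c / 64 * ε * s / Real.log (1 / ε)) :
    (1 + 8 / ε) ^ (2 * r) * (2 * rexp (2 - c * (ε / 4) * s)) < 1 := by
  have hl2 := Real.log_two_gt_d9
  have hl : Real.log 2 ≤ Real.log (1 / ε) :=
    Real.log_le_log two_pos ((le_div_iff₀ h0).2 (by linarith))
  set l := Real.log (1 / ε) with hlε
  have hlpos : 0 < l := by linarith
  rw [le_div_iff₀ hlpos] at h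
  have hbase : 1 + 8 / ε ≤ rexp (5 * l) := by
    have h2 : rexp l = 1 / ε := Real.exp_log (by positivity)
    have h3 : rexp (5 * l) = (1 / ε) ^ 5 := by
      rw [← h2, ← Real.exp_nat_mul]
      norm_num
    rw [h3]
    have ht : 2 ≤ 1 / ε := (le_div_iff₀ h0).2 (by linarith)
    have h8 : 8 / ε = 8 * (1 / ε) := by ring
    rw [h8]
    set t := 1 / ε
    have h4 : (2 : ℝ) ^ 4 ≤ t ^ 4 := pow_le_pow_left₀ (by norm_num) ht 4
    nlinarith
  have h2e : (2 : ℝ) ≤ rexp 1 := by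
    have := Real.add_one_le_exp 1
    linarith
  calc (1 + 8 / ε) ^ (2 * r) * (2 * rexp (2 - c * (ε / 4) * s))
      ≤ rexp (5 * l) ^ (2 * r) * (rexp 1 * rexp (2 - c * (ε / 4) * s)) := by
        gcongr
    _ = rexp ((2 * r : ℕ) * (5 * l) + (1 + (2 - c * (ε / 4) * s))) := by
        rw [← Real.exp_nat_mul, ← Real.exp_add, ← Real.exp_add]
    _ < 1 := by
        rw [Real.exp_lt_one_iff]
        push_cast
        have hr' : (1 : ℝ) ≤ r := by exact_mod_cast hr
        nlinarith

lemma exists_two_pow_le_and_log_le {n : ℕ} (hn : 2 ≤ n) :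
    ∃ s : ℕ, 2 * 2 ^ (64 * s) ≤ n ∧ Real.log n ≤ 64 * s + 65 := by
  obtain ⟨s, hs⟩ : ∃ s, s = Nat.log 2 (n / 2) / 64 := ⟨_, rfl⟩
  have h1 : 2 ^ (64 * s) ≤ n / 2 := Nat.pow_le_of_le_log (by omega) (by omega)
  have h2 : n / 2 < 2 ^ (64 * s + 64) := Nat.lt_pow_of_log_lt (by norm_num) (by omega)
  have h3 : n ≤ 2 ^ (64 * s + 65) := by
    rw [show 64 * s + 65 = (64 * s + 64) + 1 by ring, pow_succ]
    omega
  refine ⟨s, by omega, ?_⟩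
  have h4 : (n : ℝ) ≤ 2 ^ (64 * s + 65) := by exact_mod_cast h3
  have h5 := Real.log_le_log (by exact_mod_cast (by omega : 0 < n)) h4
  rw [Real.log_pow] at h5
  push_cast at h5
  clear h1 h2 h3 h4
  have hs0 : (0 : ℝ) ≤ s := s.cast_nonneg
  have hl2 := Real.log_two_lt_d9
  refine h5.trans ?_
  nlinarith

lemma exists_subspace_of_seminorm :
    ∃ c > (0 : ℝ), ∀ ε : ℝ, 0 < ε → ε < 1 / 2 → ∀ n : ℕ, 2 ≤ n →
      ∀ N : Seminorm ℝ (Fin n → ℝ), (∀ x, N x = 0 → x = 0) →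
        ∃ E : Submodule ℝ (Fin n → ℝ),
          c * ε * Real.log n / Real.log (1 / ε) ≤ (Module.finrank ℝ E : ℝ) ∧
          ∃ a > (0 : ℝ), ∀ x ∈ E,
            (1 - ε) * a * euclNorm x ≤ N x ∧ N x ≤ (1 + ε) * a * euclNorm x := by
  obtain ⟨c, hc, H⟩ := exists_concentrated_projection
  refine ⟨min (c / 64 / 258) (1 / 1665), by positivity, fun ε h0 h1 n hn N hN => ?_⟩
  set C := min (c / 64 / 258) (1 / 1665) with hC
  have hC0 : 0 < C := by positivity
  have hl2 := Real.log_two_gt_d9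
  have hl : Real.log 2 ≤ Real.log (1 / ε) :=
    Real.log_le_log two_pos ((le_div_iff₀ h0).2 (by linarith))
  set l := Real.log (1 / ε) with hlε
  have hlpos : 0 < l := by linarith
  have hln : 0 ≤ Real.log n := Real.log_natCast_nonneg n
  obtain ⟨s, hlow, hupp⟩ := exists_two_pow_le_and_log_le hn
  by_cases hY : 26 ≤ s ∧ 1 ≤ c / 64 * ε * s / l
  · obtain ⟨hs26, hY1⟩ := hY
    have hs0 : (26 : ℝ) ≤ s := by exact_mod_cast hs26
    have hr1 : 1 ≤ ⌊c / 64 * ε * s / l⌋₊ := Nat.le_floor (by exact_mod_cast hY1)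
    obtain ⟨E, hE, h⟩ := exists_subspace_of_concentration (H s hs26) hlow N hN h0 h1
      (net_card_mul_exp_lt hr1 h0 h1 (Nat.floor_le (by positivity)))
    refine ⟨E, ?_, h⟩
    rw [hE]
    have hfl := Nat.lt_floor_add_one (c / 64 * ε * s / l)
    have hr1' : (1 : ℝ) ≤ ⌊c / 64 * ε * s / l⌋₊ := by exact_mod_cast hr1
    have hle : C * ε * Real.log n / l ≤ c / 64 * ε * s / l / 2 := by
      rw [div_right_comm]
      gcongr
      calc C * ε * Real.log n ≤ c / 64 / 258 * ε * (129 * s) := by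
            gcongr
            · exact min_le_left _ _
            · linarith
        _ = c / 64 * ε * s / 2 := by ring
    linarith
  · obtain ⟨E, hE, h⟩ := exists_line (by omega) N hN h0
    refine ⟨E, ?_, h⟩
    rw [hE, Nat.cast_one, div_le_one hlpos]
    by_cases hs26 : 26 ≤ s
    · have hs0 : (26 : ℝ) ≤ s := by exact_mod_cast hs26
      have hY1 : c / 64 * ε * s / l < 1 := not_le.1 fun h => hY ⟨hs26, h⟩
      rw [div_lt_one hlpos] at hY1
      calc C * ε * Real.log n ≤ c / 64 / 258 * ε * (129 * s) := by
            gcongr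
            · exact min_le_left _ _
            · linarith
        _ = c / 64 * ε * s / 2 := by ring
        _ ≤ l := by
            have : 0 ≤ c / 64 * ε * s := by positivity
            linarith
    · have hs0 : (s : ℝ) ≤ 25 := by exact_mod_cast (by omega : s ≤ 25)
      calc C * ε * Real.log n ≤ 1 / 1665 * (1 / 2) * 1665 := by
            gcongr
            · exact min_le_right _ _
            · linarith
        _ ≤ l := by linarith

end Dvoretzky

/-- Improved existential Dvoretzky theorem: every `n`-dimensional normed space
(`n ≥ 2`) has a `(1+ε)`-Euclidean subspace of dimension `k ≥ c ε log n / log(1/ε)`. -/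
theorem statement14 :
    ∃ c > (0 : ℝ), ∀ ε : ℝ, 0 < ε → ε < 1 / 2 → ∀ n : ℕ, 2 ≤ n →
      ∀ N : (Fin n → ℝ) → ℝ,
        (∀ x y, N (x + y) ≤ N x + N y) →
        (∀ (r : ℝ) (x), N (r • x) = |r| * N x) →
        (∀ x, N x = 0 → x = 0) →
        ∃ E : Submodule ℝ (Fin n → ℝ),
          c * ε * Real.log n / Real.log (1 / ε) ≤ (Module.finrank ℝ E : ℝ) ∧
          ∃ a > (0 : ℝ), ∀ x ∈ E,
            (1 - ε) * a * euclNorm x ≤ N x ∧ N x ≤ (1 + ε) * a * euclNorm x := by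
  obtain ⟨c, hc, H⟩ := Dvoretzky.exists_subspace_of_seminorm
  exact ⟨c, hc, fun ε h0 h1 n hn N hadd hsmul hN =>
    H ε h0 h1 n hn (Seminorm.of N hadd fun r x => by rw [hsmul, Real.norm_eq_abs]) hN⟩
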